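/- Let p ≥ 0 and let μ be a finite Borel measure on ℝ^d with 0 < Θ^{n,*}(x,μ) < ∞ for μ-a.e. x. If ∫₀¹ β_{μ,2}(x,r)² Θ_μ(x,r)^p dr/r < ∞ for μ-a.e. x ∈ ℝ^d, then μ is n-rectifiable. -/

import Mathlib

open MeasureTheory Metric Set Filter
open scoped ENNReal NNReal

/-- The squared `L²` Jones beta number `β_{μ,2}(x,r)²`, infimum over affine `n`-planes. -/
noncomputable def beta2sq (n d : ℕ) (μ : Measure (EuclideanSpace ℝ (Fin d)))
    (x : EuclideanSpace ℝ (Fin d)) (r : ℝ) : ℝ≥0∞ :=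
  ⨅ L : {L : AffineSubspace ℝ (EuclideanSpace ℝ (Fin d)) //
      Module.finrank ℝ L.direction = n},
    (∫⁻ y in closedBall x r,
        ENNReal.ofReal ((infDist y (L.1 : Set (EuclideanSpace ℝ (Fin d))) / r) ^ 2) ∂μ) /
      ENNReal.ofReal (r ^ n)

/-- The upper `n`-dimensional density `Θ^{n,*}(x,μ)`. -/
noncomputable def upperDensity (n d : ℕ) (μ : Measure (EuclideanSpace ℝ (Fin d)))
    (x : EuclideanSpace ℝ (Fin d)) : ℝ≥0∞ :=
  Filter.limsup (fun r : ℝ => μ (closedBall x r) / ENNReal.ofReal ((2 * r) ^ n))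
    (nhdsWithin 0 (Set.Ioi 0))

/-- The density `Θ_μ(x,r) = μ(B(x,r))/r^n`. -/
noncomputable def densityN (n d : ℕ) (μ : Measure (EuclideanSpace ℝ (Fin d)))
    (x : EuclideanSpace ℝ (Fin d)) (r : ℝ) : ℝ≥0∞ :=
  μ (closedBall x r) / ENNReal.ofReal (r ^ n)

open MeasureTheory Metric Set Filter
open scoped ENNReal NNReal

/-- A Vitali type covering bound. -/
theorem vitali_bound {d n : ℕ} (σ : Measure (EuclideanSpace ℝ (Fin d)))
    (S : Set (EuclideanSpace ℝ (Fin d))) (ρ : EuclideanSpace ℝ (Fin d) → ℝ) (R : ℝ)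
    (hρ : ∀ x ∈ S, 0 < ρ x ∧ ρ x ≤ R) (κ Q : ℝ≥0∞)
    (hκ : ∀ x ∈ S, σ (closedBall x (5 * ρ x)) ≤ κ * ENNReal.ofReal (ρ x ^ n))
    (hQ : ∀ F : Finset (EuclideanSpace ℝ (Fin d)), (F : Set _) ⊆ S →
      (F : Set _).PairwiseDisjoint (fun x => closedBall x (ρ x)) →
      ∑ x ∈ F, ENNReal.ofReal (ρ x ^ n) ≤ Q) : σ S ≤ κ * Q := by
  obtain ⟨u, hut, hdis, hcov⟩ := Vitali.exists_disjoint_subfamily_covering_enlargement_closedBall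
    S (fun x => x) ρ R (fun a ha => (hρ a ha).2) 5 (by norm_num)
  have hcount : u.Countable := by
    apply hdis.countable_of_nonempty_interior
    intro x hx
    refine ⟨x, ?_⟩
    apply ball_subset_interior_closedBall
    exact mem_ball_self (hρ x (hut hx)).1
  have hsub : S ⊆ ⋃ x ∈ u, closedBall x (5 * ρ x) := by
    intro a ha
    obtain ⟨b, hb, hab⟩ := hcov a ha
    simp only [mem_iUnion]
    exact ⟨b, hb, hab (mem_closedBall_self (hρ a ha).1.le)⟩
  calc σ S ≤ σ (⋃ x ∈ u, closedBall x (5 * ρ x)) := measure_mono hsub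
    _ ≤ ∑' x : u, σ (closedBall (x : EuclideanSpace ℝ (Fin d)) (5 * ρ x)) :=
        measure_biUnion_le _ hcount _
    _ ≤ ∑' x : u, κ * ENNReal.ofReal (ρ x ^ n) :=
        ENNReal.tsum_le_tsum fun x => hκ x (hut x.2)
    _ = κ * ∑' x : u, ENNReal.ofReal (ρ x ^ n) := ENNReal.tsum_mul_left
    _ ≤ κ * Q := by
        gcongr
        rw [ENNReal.tsum_eq_iSup_sum]
        apply iSup_le
        intro F
        have := hQ (F.map (Function.Embedding.subtype _)) (by
          intro x hx
          simp only [Finset.coe_map, Function.Embedding.subtype_apply, mem_image] at hx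
          obtain ⟨y, _, rfl⟩ := hx
          exact hut y.2) (by
          apply hdis.subset
          intro x hx
          simp only [Finset.coe_map, Function.Embedding.subtype_apply, mem_image] at hx
          obtain ⟨y, _, rfl⟩ := hx
          exact y.2)
        simpa using this

/-- Packing of disjoint balls. -/
theorem packing {n : ℕ} (hn : 0 < n) {ι : Type*} (F : Finset ι)
    (w : ι → EuclideanSpace ℝ (Fin n))
    (s : ι → ℝ) (hs : ∀ i ∈ F, 0 < s i) (w0 : EuclideanSpace ℝ (Fin n)) (R : ℝ) (hR : 0 ≤ R)
    (hdis : (F : Set ι).PairwiseDisjoint (fun i => ball (w i) (s i)))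
    (hsub : ∀ i ∈ F, ball (w i) (s i) ⊆ closedBall w0 R) :
    ∑ i ∈ F, s i ^ n ≤ R ^ n := by
  have : Nonempty (Fin n) := ⟨⟨0, hn⟩⟩
  have : Nontrivial (EuclideanSpace ℝ (Fin n)) := inferInstance
  have h1 : volume (⋃ i ∈ F, ball (w i) (s i)) ≤ volume (closedBall w0 R) := by
    apply measure_mono
    simpa using hsub
  rw [measure_biUnion_finset hdis (fun i _ => measurableSet_ball),
    Measure.addHaar_closedBall _ _ hR] at h1
  rw [Finset.sum_congr rfl (fun i hi => Measure.addHaar_ball volume (w i) (hs i hi).le),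
    ← Finset.sum_mul] at h1
  have hpos : volume (ball (0 : EuclideanSpace ℝ (Fin n)) 1) ≠ 0 :=
    (measure_ball_pos _ _ one_pos).ne'
  have hfin : volume (ball (0 : EuclideanSpace ℝ (Fin n)) 1) ≠ ⊤ := measure_ball_lt_top.ne
  rw [ENNReal.mul_le_mul_iff_left hpos hfin, finrank_euclideanSpace_fin,
    ← ENNReal.ofReal_sum_of_nonneg (fun i hi => pow_nonneg (hs i hi).le _),
    ENNReal.ofReal_le_ofReal_iff (by positivity)] at h1
  exact h1

open MeasureTheory Metric Set Filter
open scoped ENNReal NNReal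

/-- One dimensional smooth partition function. -/
noncomputable def chi (t : ℝ) : ℝ := Real.smoothTransition (t + 1) - Real.smoothTransition t

/-- The product partition function. -/
noncomputable def theta (n : ℕ) (w : EuclideanSpace ℝ (Fin n)) : ℝ := ∏ i, chi (w i)

/-- Rescaled and translated partition function. -/
noncomputable def thetaS {n : ℕ} (r : ℝ) (v w : EuclideanSpace ℝ (Fin n)) : ℝ :=
  theta n (r⁻¹ • w - v)

/-- Integer vectors. -/
noncomputable def zv {n : ℕ} (z : Fin n → ℤ) : EuclideanSpace ℝ (Fin n) :=
  WithLp.toLp 2 (fun i => (z i : ℝ))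

theorem zv_apply {n : ℕ} (z : Fin n → ℤ) (i : Fin n) : zv z i = z i := rfl

theorem chi_nonneg (t : ℝ) : 0 ≤ chi t := by
  unfold chi
  have := Real.smoothTransition.monotone (show t ≤ t + 1 by linarith)
  linarith

theorem chi_le_one (t : ℝ) : chi t ≤ 1 := by
  unfold chi
  have := Real.smoothTransition.le_one (t + 1)
  have := Real.smoothTransition.nonneg t
  linarith

theorem chi_eq_zero {t : ℝ} (h : 1 ≤ |t|) : chi t = 0 := by
  unfold chi
  rcases le_abs.1 h with h | h
  · rw [Real.smoothTransition.one_of_one_le h, Real.smoothTransition.one_of_one_le (by linarith)]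
    simp
  · rw [Real.smoothTransition.zero_of_nonpos (by linarith),
      Real.smoothTransition.zero_of_nonpos (by linarith)]
    simp

theorem chi_contDiff : ContDiff ℝ 2 chi := by
  unfold chi
  exact (Real.smoothTransition.contDiff.comp (contDiff_id.add contDiff_const)).sub
    Real.smoothTransition.contDiff

theorem chi_sum (t : ℝ) : ∑ m ∈ ({⌊t⌋, ⌊t⌋ + 1} : Finset ℤ), chi (t - m) = 1 := by
  rw [Finset.sum_pair (by simp)]
  have h1 := Int.floor_le t
  have h2 := Int.lt_floor_add_one t
  unfold chi
  push_cast
  rw [Real.smoothTransition.one_of_one_le (show 1 ≤ t - ⌊t⌋ + 1 by linarith),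
    Real.smoothTransition.zero_of_nonpos (show t - (⌊t⌋ + 1) ≤ 0 by linarith)]
  ring_nf

theorem theta_contDiff (n : ℕ) : ContDiff ℝ 2 (theta n) := by
  unfold theta
  apply contDiff_prod
  intro i _
  apply chi_contDiff.comp
  fun_prop

theorem theta_nonneg {n : ℕ} (w : EuclideanSpace ℝ (Fin n)) : 0 ≤ theta n w :=
  Finset.prod_nonneg fun i _ => chi_nonneg _

theorem theta_le_one {n : ℕ} (w : EuclideanSpace ℝ (Fin n)) : theta n w ≤ 1 :=
  Finset.prod_le_one (fun i _ => chi_nonneg _) fun i _ => chi_le_one _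

theorem theta_eq_zero {n : ℕ} {w : EuclideanSpace ℝ (Fin n)} (h : ∃ i, 1 ≤ |w i|) :
    theta n w = 0 := by
  obtain ⟨i, hi⟩ := h
  exact Finset.prod_eq_zero (Finset.mem_univ i) (chi_eq_zero hi)

theorem thetaS_apply {n : ℕ} (r : ℝ) (v w : EuclideanSpace ℝ (Fin n)) :
    thetaS r v w = ∏ i, chi (r⁻¹ * w i - v i) := by
  simp [thetaS, theta]

theorem thetaS_nonneg {n : ℕ} (r : ℝ) (v w : EuclideanSpace ℝ (Fin n)) : 0 ≤ thetaS r v w :=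
  theta_nonneg _

theorem thetaS_le_one {n : ℕ} (r : ℝ) (v w : EuclideanSpace ℝ (Fin n)) : thetaS r v w ≤ 1 :=
  theta_le_one _

theorem thetaS_eq_zero {n : ℕ} {r : ℝ} {v w : EuclideanSpace ℝ (Fin n)}
    (h : ∃ i, 1 ≤ |r⁻¹ * w i - v i|) : thetaS r v w = 0 := by
  apply theta_eq_zero
  simpa using h

theorem thetaS_contDiff {n : ℕ} (r : ℝ) (v : EuclideanSpace ℝ (Fin n)) :
    ContDiff ℝ 2 (thetaS r v) := by
  unfold thetaS
  apply (theta_contDiff n).comp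
  fun_prop

theorem thetaS_sum {n : ℕ} (r : ℝ) (w : EuclideanSpace ℝ (Fin n)) (Z : Finset (Fin n → ℤ))
    (hZ : ∀ z : Fin n → ℤ, (∀ i, |r⁻¹ * w i - z i| < 1) → z ∈ Z) :
    ∑ z ∈ Z, thetaS r (zv z) w = 1 := by
  classical
  set T : Finset (Fin n → ℤ) :=
    Fintype.piFinset (fun i => ({⌊r⁻¹ * w i⌋, ⌊r⁻¹ * w i⌋ + 1} : Finset ℤ)) with hT
  have h1 : ∑ z ∈ T, thetaS r (zv z) w = 1 := by
    have := Finset.prod_univ_sum (fun i => ({⌊r⁻¹ * w i⌋, ⌊r⁻¹ * w i⌋ + 1} : Finset ℤ))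
      (fun i (m : ℤ) => chi (r⁻¹ * w i - m))
    rw [Finset.prod_congr rfl (fun i _ => chi_sum (r⁻¹ * w i))] at this
    simp only [thetaS_apply, zv_apply]
    rw [← this]; simp
  have h2 : ∑ z ∈ Z, thetaS r (zv z) w = ∑ z ∈ Z ∪ T, thetaS r (zv z) w := by
    apply Finset.sum_subset Finset.subset_union_left
    intro z _ hz
    apply thetaS_eq_zero
    by_contra hcon
    push Not at hcon
    exact hz (hZ z hcon)
  have h3 : ∑ z ∈ T, thetaS r (zv z) w = ∑ z ∈ Z ∪ T, thetaS r (zv z) w := by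
    apply Finset.sum_subset Finset.subset_union_right
    intro z _ hz
    apply thetaS_eq_zero
    by_contra hcon
    push Not at hcon
    apply hz
    rw [hT, Fintype.mem_piFinset]
    intro i
    have := hcon i
    rw [zv_apply, abs_lt] at this
    simp only [Finset.mem_insert, Finset.mem_singleton]
    have h1 := Int.floor_le (r⁻¹ * w i)
    have h2 := Int.lt_floor_add_one (r⁻¹ * w i)
    have h3 : (z i : ℝ) < ⌊r⁻¹ * w i⌋ + 2 := by linarith
    have h4 : (⌊r⁻¹ * w i⌋ : ℝ) - 1 < z i := by linarith
    have h3' : z i < ⌊r⁻¹ * w i⌋ + 2 := by exact_mod_cast h3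
    have h4' : ⌊r⁻¹ * w i⌋ - 1 < z i := by exact_mod_cast h4
    omega
  rw [h2, ← h3, h1]

theorem card_near {n : ℕ} (t : Fin n → ℝ) (a : ℕ) (Z : Finset (Fin n → ℤ))
    (hZ : ∀ z ∈ Z, ∀ i, |t i - z i| ≤ a) : Z.card ≤ (2 * a + 1) ^ n := by
  classical
  have hsub : Z ⊆ Fintype.piFinset (fun i => Finset.Icc (⌈t i - a⌉) (⌊t i + a⌋)) := by
    intro z hz
    rw [Fintype.mem_piFinset]
    intro i
    have := abs_le.1 (hZ z hz i)
    rw [Finset.mem_Icc, Int.ceil_le, Int.le_floor]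
    constructor <;> linarith
  refine (Finset.card_le_card hsub).trans ?_
  rw [Fintype.card_piFinset]
  calc _ ≤ ∏ i : Fin n, (2 * a + 1) := by
        apply Finset.prod_le_prod' 
        intro i _
        rw [Int.card_Icc]
        have h1 := Int.floor_le (t i + a)
        have h2 := Int.le_ceil (t i - a)
        have h3 : (⌊t i + a⌋ : ℝ) ≤ ⌈t i - a⌉ + 2 * a := by linarith
        have h3' : ⌊t i + a⌋ ≤ ⌈t i - a⌉ + 2 * a := by exact_mod_cast h3
        omega
    _ = _ := by simp

theorem norm_le_of_coord {n : ℕ} (w : EuclideanSpace ℝ (Fin n)) (a : ℝ)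
    (h : ∀ i, |w i| ≤ a) : ‖w‖ ≤ n * a := by
  have h1 : w = ∑ i, w i • EuclideanSpace.basisFun (Fin n) ℝ i := by
    conv_lhs => rw [← (EuclideanSpace.basisFun (Fin n) ℝ).sum_repr w]
    simp
  rw [h1]
  refine (norm_sum_le _ _).trans ?_
  calc _ ≤ ∑ i : Fin n, a := by
        apply Finset.sum_le_sum
        intro i _
        rw [norm_smul]
        simpa using h i
    _ = _ := by simp

theorem coord_le_norm {n : ℕ} (w : EuclideanSpace ℝ (Fin n)) (i : Fin n) : |w i| ≤ ‖w‖ := by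
  simpa using PiLp.norm_apply_le w i

theorem theta_hasCompactSupport (n : ℕ) : HasCompactSupport (theta n) := by
  apply HasCompactSupport.intro (isCompact_closedBall (0 : EuclideanSpace ℝ (Fin n)) (n * 1))
  intro w hw
  by_contra hcon
  apply hw
  rw [mem_closedBall_zero_iff]
  apply norm_le_of_coord
  intro i
  by_contra hi
  exact hcon (theta_eq_zero ⟨i, (not_le.1 hi).le⟩)

theorem theta_bound (n : ℕ) : ∃ C : ℝ, 1 ≤ C ∧ ∀ m ≤ 2, ∀ w,
    ‖iteratedFDeriv ℝ m (theta n) w‖ ≤ C := by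
  have key : ∀ m : ℕ, m ≤ 2 → ∃ C : ℝ, ∀ w, ‖iteratedFDeriv ℝ m (theta n) w‖ ≤ C := by
    intro m hm
    have hc : Continuous (iteratedFDeriv ℝ m (theta n)) :=
      (theta_contDiff n).continuous_iteratedFDeriv (by exact_mod_cast hm)
    exact hc.bounded_above_of_compact_support ((theta_hasCompactSupport n).iteratedFDeriv m)
  obtain ⟨C0, h0⟩ := key 0 (by norm_num)
  obtain ⟨C1, h1⟩ := key 1 (by norm_num)
  obtain ⟨C2, h2⟩ := key 2 (by norm_num)
  refine ⟨max 1 (max C0 (max C1 C2)), le_max_left _ _, ?_⟩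
  intro m hm w
  interval_cases m
  · exact (h0 w).trans (by simp)
  · exact (h1 w).trans (by simp)
  · exact (h2 w).trans (by simp)

/-- The derivative bound constant of the partition function. -/
noncomputable def Cth (n : ℕ) : ℝ := (theta_bound n).choose

theorem Cth_one (n : ℕ) : 1 ≤ Cth n := (theta_bound n).choose_spec.1

theorem Cth_bound (n : ℕ) : ∀ m ≤ 2, ∀ w, ‖iteratedFDeriv ℝ m (theta n) w‖ ≤ Cth n :=
  (theta_bound n).choose_spec.2

/-- Scale invariant bounds on derivatives up to order two. -/
def DB {n : ℕ} {F : Type*} [NormedAddCommGroup F] [NormedSpace ℝ F]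
    (f : EuclideanSpace ℝ (Fin n) → F) (w : EuclideanSpace ℝ (Fin n)) (r C : ℝ) : Prop :=
  ∀ m : ℕ, m ≤ 2 → ‖iteratedFDeriv ℝ m f w‖ * r ^ m ≤ C

section DBlemmas
variable {n : ℕ} {F : Type*} [NormedAddCommGroup F] [NormedSpace ℝ F]

theorem DB.mono {f : EuclideanSpace ℝ (Fin n) → F} {w : EuclideanSpace ℝ (Fin n)} {r C C' : ℝ}
    (h : DB f w r C) (hC : C ≤ C') : DB f w r C' := fun m hm => (h m hm).trans hC

theorem DB.congr {f g : EuclideanSpace ℝ (Fin n) → F} {w : EuclideanSpace ℝ (Fin n)} {r C : ℝ}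
    (h : DB f w r C) (hfg : g =ᶠ[nhds w] f) : DB g w r C := by
  intro m hm
  rw [(Filter.EventuallyEq.iteratedFDeriv ℝ hfg m).eq_of_nhds]
  exact h m hm

theorem DB_zero (w : EuclideanSpace ℝ (Fin n)) (r : ℝ) :
    DB (fun _ => (0 : F)) w r 0 := by
  intro m _
  have : iteratedFDeriv ℝ m (fun _ : EuclideanSpace ℝ (Fin n) => (0 : F)) = 0 :=
    iteratedFDeriv_fun_zero
  simp [this]

theorem DB.smul {f : EuclideanSpace ℝ (Fin n) → ℝ} {g : EuclideanSpace ℝ (Fin n) → F}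
    {w : EuclideanSpace ℝ (Fin n)} {r C C' : ℝ} (hr : 0 ≤ r) (hf : ContDiff ℝ 2 f)
    (hg : ContDiff ℝ 2 g) (h : DB f w r C) (h' : DB g w r C') :
    DB (fun w => f w • g w) w r (4 * (C * C')) := by
  have hC : 0 ≤ C := le_trans (by positivity) (h 0 (by norm_num))
  have hC' : 0 ≤ C' := le_trans (by positivity) (h' 0 (by norm_num))
  intro m hm
  have h1 := norm_iteratedFDeriv_smul_le hf hg w (n := m) (by exact_mod_cast hm)
  calc _ ≤ (∑ i ∈ Finset.range (m + 1), ↑(m.choose i) * ‖iteratedFDeriv ℝ i f w‖ *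
        ‖iteratedFDeriv ℝ (m - i) g w‖) * r ^ m := by gcongr
    _ = ∑ i ∈ Finset.range (m + 1), (m.choose i : ℝ) * ((‖iteratedFDeriv ℝ i f w‖ * r ^ i) *
        (‖iteratedFDeriv ℝ (m - i) g w‖ * r ^ (m - i))) := by
        rw [Finset.sum_mul]
        apply Finset.sum_congr rfl
        intro i hi
        rw [Finset.mem_range] at hi
        have : r ^ m = r ^ i * r ^ (m - i) := by rw [← pow_add]; congr 1; omega
        rw [this]; ring
    _ ≤ ∑ i ∈ Finset.range (m + 1), (m.choose i : ℝ) * (C * C') := by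
        apply Finset.sum_le_sum
        intro i hi
        rw [Finset.mem_range] at hi
        have e1 := h i (by omega)
        have e2 := h' (m - i) (by omega)
        gcongr
    _ = 2 ^ m * (C * C') := by
        rw [← Finset.sum_mul]
        congr 1
        exact_mod_cast Nat.sum_range_choose m
    _ ≤ 4 * (C * C') := by
        gcongr
        calc (2 : ℝ) ^ m ≤ 2 ^ 2 := by gcongr; norm_num
          _ = 4 := by norm_num

theorem DB.sum {ι : Type*} (Z : Finset ι) {f : ι → EuclideanSpace ℝ (Fin n) → F}
    {w : EuclideanSpace ℝ (Fin n)} {r : ℝ} {C : ι → ℝ} (hr : 0 ≤ r)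
    (hf : ∀ z ∈ Z, ContDiff ℝ 2 (f z))
    (h : ∀ z ∈ Z, DB (f z) w r (C z)) : DB (fun w => ∑ z ∈ Z, f z w) w r (∑ z ∈ Z, C z) := by
  intro m hm
  have : iteratedFDeriv ℝ m (fun w => ∑ z ∈ Z, f z w) w = ∑ z ∈ Z, iteratedFDeriv ℝ m (f z) w := by
    rw [iteratedFDeriv_fun_sum_apply]
    intro z hz
    exact ((hf z hz).of_le (by exact_mod_cast hm)).contDiffAt
  rw [this]
  calc _ ≤ (∑ z ∈ Z, ‖iteratedFDeriv ℝ m (f z) w‖) * r ^ m := by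
        gcongr; exact norm_sum_le _ _
    _ = ∑ z ∈ Z, ‖iteratedFDeriv ℝ m (f z) w‖ * r ^ m := by rw [Finset.sum_mul]
    _ ≤ _ := Finset.sum_le_sum fun z hz => h z hz m hm

theorem DB_affine (a : F) (T : EuclideanSpace ℝ (Fin n) →L[ℝ] F) (w : EuclideanSpace ℝ (Fin n))
    {r : ℝ} (hr : 0 ≤ r) : DB (fun w => a + T w) w r (‖a + T w‖ + ‖T‖ * r) := by
  intro m hm
  have hfd : fderiv ℝ (fun w => a + T w) = fun _ => T := by
    ext1 x
    rw [fderiv_const_add]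
    exact T.fderiv
  interval_cases m
  · rw [norm_iteratedFDeriv_zero]; simp; positivity
  · rw [norm_iteratedFDeriv_one, hfd]; simp
  · rw [← norm_fderiv_iteratedFDeriv]
    have h2 : ‖fderiv ℝ (iteratedFDeriv ℝ 1 (fun w => a + T w)) w‖
        = ‖iteratedFDeriv ℝ 1 (fderiv ℝ (fun w => a + T w)) w‖ := by
      rw [norm_iteratedFDeriv_fderiv, norm_fderiv_iteratedFDeriv]
    rw [h2, hfd, norm_iteratedFDeriv_one]
    simp; positivity

theorem DB_thetaS (r : ℝ) (hr : 0 < r) (v w : EuclideanSpace ℝ (Fin n)) :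
    DB (thetaS r v) w r (Cth n) := by
  intro m hm
  have h1 : thetaS r v = fun w => (fun u => theta n (u + (-v))) (r⁻¹ • w) := by
    ext w; simp [thetaS, sub_eq_add_neg]
  have hcd : ContDiff ℝ m (fun u => theta n (u + (-v))) := by
    apply ((theta_contDiff n).of_le (by exact_mod_cast hm)).comp
    fun_prop
  rw [h1, iteratedFDeriv_comp_const_smul r⁻¹ hcd]
  simp only [iteratedFDeriv_comp_add_right]
  rw [norm_smul]
  have := Cth_bound n m hm (r⁻¹ • w + -v)
  have h3 : ‖r⁻¹ ^ m‖ * r ^ m = 1 := by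
    rw [Real.norm_of_nonneg (by positivity), ← mul_pow, inv_mul_cancel₀ hr.ne', one_pow]
  calc _ = ‖iteratedFDeriv ℝ m (theta n) (r⁻¹ • w + -v)‖ * (‖r⁻¹ ^ m‖ * r ^ m) := by ring
    _ ≤ _ := by rw [h3, mul_one]; exact this

end DBlemmas

open MeasureTheory Metric Set Filter
open scoped ENNReal NNReal

section Geo
variable {n d : ℕ} (ι : EuclideanSpace ℝ (Fin n) →ₗᵢ[ℝ] EuclideanSpace ℝ (Fin d))
  (p0 : EuclideanSpace ℝ (Fin d))

/-- Orthogonal projection on the reference plane, in coordinates. -/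
noncomputable def qm (y : EuclideanSpace ℝ (Fin d)) : EuclideanSpace ℝ (Fin n) :=
  ContinuousLinearMap.adjoint ι.toContinuousLinearMap (y - p0)

/-- Height above the reference plane. -/
noncomputable def hm (y : EuclideanSpace ℝ (Fin d)) : EuclideanSpace ℝ (Fin d) :=
  y - p0 - ι (qm ι p0 y)

theorem adj_iota (w : EuclideanSpace ℝ (Fin n)) :
    ContinuousLinearMap.adjoint ι.toContinuousLinearMap (ι w) = w := by
  apply ext_inner_left ℝ
  intro v
  rw [ContinuousLinearMap.adjoint_inner_right]
  exact ι.inner_map_map v w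

theorem qm_sub (y y' : EuclideanSpace ℝ (Fin d)) : qm ι p0 y - qm ι p0 y' =
    ContinuousLinearMap.adjoint ι.toContinuousLinearMap (y - y') := by
  unfold qm
  rw [← map_sub]; congr 1; abel

theorem hm_sub (y y' : EuclideanSpace ℝ (Fin d)) : hm ι p0 y - hm ι p0 y' =
    (y - y') - ι (qm ι p0 y - qm ι p0 y') := by
  unfold hm
  rw [map_sub]; abel

theorem pyth (y y' : EuclideanSpace ℝ (Fin d)) : ‖y - y'‖ ^ 2 =
    ‖qm ι p0 y - qm ι p0 y'‖ ^ 2 + ‖hm ι p0 y - hm ι p0 y'‖ ^ 2 := by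
  rw [hm_sub]
  set w := qm ι p0 y - qm ι p0 y' with hw
  have h1 : inner ℝ (y - y') (ι w) = ‖w‖ ^ 2 := by
    have : inner ℝ (y - y') (ι w) =
      inner ℝ (ContinuousLinearMap.adjoint ι.toContinuousLinearMap (y - y')) w := by
      rw [ContinuousLinearMap.adjoint_inner_left]; rfl
    rw [this, ← qm_sub ι p0, ← hw, real_inner_self_eq_norm_sq]
  have h2 := norm_sub_sq_real (y - y') (ι w)
  rw [h1, ι.norm_map] at h2
  linarith

theorem qm_le (y y' : EuclideanSpace ℝ (Fin d)) :
    ‖qm ι p0 y - qm ι p0 y'‖ ≤ ‖y - y'‖ := by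
  have := pyth ι p0 y y'
  apply (pow_le_pow_iff_left₀ (norm_nonneg _) (norm_nonneg _) two_ne_zero).1
  nlinarith [sq_nonneg ‖hm ι p0 y - hm ι p0 y'‖]

theorem hm_le (y y' : EuclideanSpace ℝ (Fin d)) :
    ‖hm ι p0 y - hm ι p0 y'‖ ≤ ‖y - y'‖ := by
  have := pyth ι p0 y y'
  apply (pow_le_pow_iff_left₀ (norm_nonneg _) (norm_nonneg _) two_ne_zero).1
  nlinarith [sq_nonneg ‖qm ι p0 y - qm ι p0 y'‖]

theorem dist_le_qh (y y' : EuclideanSpace ℝ (Fin d)) :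
    ‖y - y'‖ ≤ ‖qm ι p0 y - qm ι p0 y'‖ + ‖hm ι p0 y - hm ι p0 y'‖ := by
  have := pyth ι p0 y y'
  apply (pow_le_pow_iff_left₀ (norm_nonneg _) (by positivity) two_ne_zero).1
  nlinarith [norm_nonneg (qm ι p0 y - qm ι p0 y'), norm_nonneg (hm ι p0 y - hm ι p0 y')]

abbrev Aff (n d : ℕ) : Type :=
  EuclideanSpace ℝ (Fin d) × (EuclideanSpace ℝ (Fin n) →L[ℝ] EuclideanSpace ℝ (Fin d))

/-- Evaluation of an affine map. -/
def ev (P : Aff n d) (w : EuclideanSpace ℝ (Fin n)) : EuclideanSpace ℝ (Fin d) := P.1 + P.2 w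

theorem ev_sub (P P' : Aff n d) (w : EuclideanSpace ℝ (Fin n)) :
    ev (P - P') w = ev P w - ev P' w := by
  simp [ev]; abel

theorem ev_diff (P : Aff n d) (w w' : EuclideanSpace ℝ (Fin n)) :
    ‖ev P w - ev P w'‖ ≤ ‖P.2‖ * ‖w - w'‖ := by
  have : ev P w - ev P w' = P.2 (w - w') := by simp [ev]
  rw [this]; exact P.2.le_opNorm _

theorem slab (σ : Measure (EuclideanSpace ℝ (Fin d))) [IsFiniteMeasure σ] (hn : 0 < n) (C0 : ℝ)
    (hC0 : 0 ≤ C0)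
    (hreg : ∀ x ρ, 0 < ρ → σ.real (closedBall x ρ) ≤ C0 * ρ ^ n)
    (P : Aff n d) (hP : ‖P.2‖ ≤ 1) (c : ℝ) (u : EuclideanSpace ℝ (Fin n)) (hu : ‖u‖ = 1)
    (x : EuclideanSpace ℝ (Fin d)) (ρ : ℝ) (hρ : 0 < ρ) (δ : ℝ) (hδ : 0 < δ) (hδ1 : δ ≤ 1 / 4) :
    σ.real {y ∈ closedBall x ρ | ‖hm ι p0 y - ev P (qm ι p0 y)‖ ≤ δ * ρ ∧
      |c + inner ℝ u (qm ι p0 y)| ≤ δ * ρ} ≤ 8 * 60 ^ n * C0 * δ * ρ ^ n := by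
  set S := {y ∈ closedBall x ρ | ‖hm ι p0 y - ev P (qm ι p0 y)‖ ≤ δ * ρ ∧
      |c + inner ℝ u (qm ι p0 y)| ≤ δ * ρ} with hS
  set s : ℝ := 4 * δ * ρ with hs
  have hspos : 0 < s := by positivity
  set J : ℕ := ⌊1 / (4 * δ)⌋₊ with hJ
  have hJ1 : (J : ℝ) * (4 * δ) ≤ 1 := by
    have := Nat.floor_le (show 0 ≤ 1 / (4 * δ) by positivity)
    rw [le_div_iff₀ (by positivity)] at this
    exact this
  have hJ2 : 1 ≤ (J : ℝ) * (8 * δ) := by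
    have h1 := Nat.lt_floor_add_one (1 / (4 * δ))
    rw [div_lt_iff₀ (by positivity)] at h1
    have h2 : 1 ≤ J := by
      rw [hJ, Nat.one_le_floor_iff, le_div_iff₀ (by positivity)]; linarith
    have h3 : (1 : ℝ) ≤ J := by exact_mod_cast h2
    nlinarith
  have key := vitali_bound (n := n) σ S (fun _ => s) s (fun x _ => ⟨hspos, le_rfl⟩)
    (ENNReal.ofReal (C0 * 5 ^ n)) (ENNReal.ofReal (8 * δ * 12 ^ n * ρ ^ n))
    (by
      intro y _
      rw [← ENNReal.ofReal_mul (by positivity), ← ofReal_measureReal]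
      apply ENNReal.ofReal_le_ofReal
      refine (hreg y _ (by positivity)).trans ?_
      rw [mul_pow]; apply le_of_eq; ring)
    (by
      intro F hF hdis
      rw [← ENNReal.ofReal_sum_of_nonneg (fun _ _ => by positivity)]
      apply ENNReal.ofReal_le_ofReal
      have hsep : ∀ y ∈ F, ∀ y' ∈ F, y ≠ y' → 4 * δ * ρ < ‖qm ι p0 y - qm ι p0 y'‖ := by
        intro y hy y' hy' hne
        have h1 := hdis hy hy' hne
        rw [Function.onFun, disjoint_closedBall_closedBall_iff hspos.le hspos.le, dist_eq_norm] at h1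
        have a1 := (hF hy).2.1
        have a2 := (hF hy').2.1
        have a3 := ev_diff P (qm ι p0 y) (qm ι p0 y')
        have a4 : ‖P.2‖ * ‖qm ι p0 y - qm ι p0 y'‖ ≤ ‖qm ι p0 y - qm ι p0 y'‖ :=
          mul_le_of_le_one_left (norm_nonneg _) hP
        have a5 : ‖hm ι p0 y - hm ι p0 y'‖ ≤ ‖qm ι p0 y - qm ι p0 y'‖ + 2 * δ * ρ := by
          have : hm ι p0 y - hm ι p0 y' = (hm ι p0 y - ev P (qm ι p0 y))
            + (ev P (qm ι p0 y) - ev P (qm ι p0 y')) - (hm ι p0 y' - ev P (qm ι p0 y')) := by abel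
          rw [this]
          refine (norm_sub_le _ _).trans ?_
          have := norm_add_le (hm ι p0 y - ev P (qm ι p0 y))
            (ev P (qm ι p0 y) - ev P (qm ι p0 y'))
          linarith
        have a6 := pyth ι p0 y y'
        by_contra hcon
        push Not at hcon
        have b1 : 0 < δ * ρ := by positivity
        have b2 := norm_nonneg (qm ι p0 y - qm ι p0 y')
        have b3 : ‖hm ι p0 y - hm ι p0 y'‖ ≤ 6 * (δ * ρ) := by linarith
        have b4 := pow_le_pow_left₀ (norm_nonneg _) b3 2
        have b5 := pow_le_pow_left₀ (norm_nonneg _) hcon 2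
        have b6 := pow_le_pow_left₀ (by positivity) h1.le 2
        have b7 : 0 < (δ * ρ) ^ 2 := by positivity
        nlinarith
      have hpk := packing (n := n) hn (F ×ˢ Finset.range J)
        (fun p => qm ι p0 p.1 + ((p.2 : ℝ) * s) • u) (fun _ => δ * ρ)
        (fun _ _ => by positivity) (qm ι p0 x) (3 * ρ) (by positivity)
        (by
          rintro ⟨y, j⟩ hy ⟨y', j'⟩ hy' hne
          simp only [Finset.coe_product, mem_prod, Finset.mem_coe] at hy hy'
          apply ball_disjoint_ball
          rw [dist_eq_norm]
          simp only
          by_cases hj : j = j'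
          · subst hj
            have hyy : y ≠ y' := fun h => hne (by rw [h])
            have := hsep y hy.1 y' hy'.1 hyy
            rw [add_sub_add_right_eq_sub]
            have b1 : 0 < δ * ρ := by positivity
            linarith
          · have h1 := abs_le.1 (hF hy.1).2.2
            have h2 := abs_le.1 (hF hy'.1).2.2
            have h3 : inner ℝ u (qm ι p0 y + ((j : ℝ) * s) • u - (qm ι p0 y' + ((j' : ℝ) * s) • u))
              = (c + inner ℝ u (qm ι p0 y)) - (c + inner ℝ u (qm ι p0 y')) + ((j : ℝ) - j') * s := by
              simp only [inner_sub_right, inner_add_right, inner_smul_right,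
                real_inner_self_eq_norm_sq, hu]
              ring
            have h4 := abs_real_inner_le_norm u
              (qm ι p0 y + ((j : ℝ) * s) • u - (qm ι p0 y' + ((j' : ℝ) * s) • u))
            rw [hu, one_mul, h3] at h4
            refine le_trans ?_ h4
            rcases lt_or_gt_of_ne hj with hlt | hlt
            · have : (j : ℝ) + 1 ≤ j' := by exact_mod_cast hlt
              have : ((j : ℝ) - j') * s ≤ -s := by nlinarith
              rw [abs_of_nonpos (by linarith)]
              linarith
            · have : (j' : ℝ) + 1 ≤ j := by exact_mod_cast hlt
              have : s ≤ ((j : ℝ) - j') * s := by nlinarith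
              rw [abs_of_nonneg (by linarith)]
              linarith)
        (by
          rintro ⟨y, j⟩ hy
          simp only [Finset.mem_product, Finset.mem_range] at hy
          apply (ball_subset_closedBall).trans
          apply closedBall_subset_closedBall'
          rw [dist_eq_norm]
          have h1 := (hF hy.1).1
          rw [mem_closedBall, dist_eq_norm] at h1
          have h2 := (qm_le ι p0 y x).trans h1
          have h3 : (j : ℝ) ≤ J := by exact_mod_cast hy.2.le
          have h4 : ‖((j : ℝ) * s) • u‖ ≤ ρ := by
            rw [norm_smul, hu, mul_one, Real.norm_of_nonneg (by positivity)]
            calc (j : ℝ) * s ≤ J * s := by gcongr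
              _ = (J * (4 * δ)) * ρ := by rw [hs]; ring
              _ ≤ 1 * ρ := by gcongr
              _ = ρ := one_mul _
          have h5 : ‖qm ι p0 y + ((j : ℝ) * s) • u - qm ι p0 x‖ ≤ ρ + ρ := by
            have : qm ι p0 y + ((j : ℝ) * s) • u - qm ι p0 x
              = (qm ι p0 y - qm ι p0 x) + ((j : ℝ) * s) • u := by abel
            rw [this]
            exact (norm_add_le _ _).trans (add_le_add h2 h4)
          have h6 : δ * ρ ≤ ρ := by nlinarith
          linarith)
      simp only [Finset.sum_const, Finset.card_product, Finset.card_range, nsmul_eq_mul] at hpk ⊢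
      push_cast at hpk
      rw [hs]
      calc (F.card : ℝ) * (4 * δ * ρ) ^ n = 1 * (F.card * (4 ^ n * (δ * ρ) ^ n)) := by
            rw [mul_assoc, mul_pow]; ring
        _ ≤ ((J : ℝ) * (8 * δ)) * (F.card * (4 ^ n * (δ * ρ) ^ n)) := by gcongr
        _ = 8 * δ * 4 ^ n * (F.card * J * (δ * ρ) ^ n) := by ring
        _ ≤ 8 * δ * 4 ^ n * (3 * ρ) ^ n := by gcongr
        _ = 8 * δ * 12 ^ n * ρ ^ n := by
            rw [mul_pow, show (12 : ℝ) = 4 * 3 by norm_num, mul_pow]; ring)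
  rw [← ENNReal.ofReal_mul (by positivity), ← ofReal_measureReal,
    ENNReal.ofReal_le_ofReal_iff (by positivity)] at key
  refine key.trans (le_of_eq ?_)
  rw [show (60 : ℝ) = 5 * 12 by norm_num, mul_pow]; ring

end Geo

open MeasureTheory Metric Set Filter
open scoped ENNReal NNReal

section Geo2
variable {n d : ℕ} (ι : EuclideanSpace ℝ (Fin n) →ₗᵢ[ℝ] EuclideanSpace ℝ (Fin d))
  (p0 : EuclideanSpace ℝ (Fin d))

/-- Weak closeness of the measure to the graph of an affine map. -/
def Cl (σ : Measure (EuclideanSpace ℝ (Fin d))) (x : EuclideanSpace ℝ (Fin d)) (R r b : ℝ)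
    (P : Aff n d) : Prop :=
  ∀ t : ℝ, 0 < t → σ.real {y ∈ closedBall x R | t * r < ‖hm ι p0 y - ev P (qm ι p0 y)‖}
    ≤ b / t ^ 2 * r ^ n

theorem notslab (σ : Measure (EuclideanSpace ℝ (Fin d))) [IsFiniteMeasure σ] (hn : 0 < n)
    (C0 : ℝ) (hC0 : 0 ≤ C0)
    (hreg : ∀ x ρ, 0 < ρ → σ.real (closedBall x ρ) ≤ C0 * ρ ^ n)
    (P : Aff n d) (hP : ‖P.2‖ ≤ 1) (c : ℝ) (u : EuclideanSpace ℝ (Fin n)) (hu : ‖u‖ = 1)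
    (x : EuclideanSpace ℝ (Fin d)) (ρ : ℝ) (hρ : 0 < ρ) (δ : ℝ) (hδ : 0 < δ) (hδ1 : δ ≤ 1 / 4)
    (τ : ℝ) (hδτ : 8 * 60 ^ n * C0 * δ < τ / 2)
    (hD : τ * ρ ^ n ≤ σ.real (closedBall x ρ))
    (h1 : σ.real {y ∈ closedBall x ρ | δ * ρ < ‖hm ι p0 y - ev P (qm ι p0 y)‖} ≤ τ / 4 * ρ ^ n)
    (A : Set (EuclideanSpace ℝ (Fin d))) (hA : σ.real A ≤ τ / 4 * ρ ^ n)
    (hAS : ∀ y ∈ closedBall x ρ, y ∉ A → |c + inner ℝ u (qm ι p0 y)| ≤ δ * ρ) : False := by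
  have hs := slab ι p0 σ hn C0 hC0 hreg P hP c u hu x ρ hρ δ hδ hδ1
  set S := {y ∈ closedBall x ρ | ‖hm ι p0 y - ev P (qm ι p0 y)‖ ≤ δ * ρ ∧
      |c + inner ℝ u (qm ι p0 y)| ≤ δ * ρ} with hS
  set B := {y ∈ closedBall x ρ | δ * ρ < ‖hm ι p0 y - ev P (qm ι p0 y)‖} with hB
  have hcov : closedBall x ρ ⊆ (S ∪ B) ∪ A := by
    intro y hy
    by_cases hyA : y ∈ A
    · exact Or.inr hyA
    · left
      by_cases hyB : δ * ρ < ‖hm ι p0 y - ev P (qm ι p0 y)‖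
      · exact Or.inr ⟨hy, hyB⟩
      · exact Or.inl ⟨hy, not_lt.1 hyB, hAS y hy hyA⟩
  have a1 : σ.real (closedBall x ρ) ≤ σ.real ((S ∪ B) ∪ A) := measureReal_mono hcov
  have a2 : σ.real ((S ∪ B) ∪ A) ≤ σ.real (S ∪ B) + σ.real A := measureReal_union_le _ _
  have a3 : σ.real (S ∪ B) ≤ σ.real S + σ.real B := measureReal_union_le _ _
  have a4 : 0 < ρ ^ n := by positivity
  nlinarith

theorem lemA (σ : Measure (EuclideanSpace ℝ (Fin d))) [IsFiniteMeasure σ] (hn : 0 < n)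
    (C0 : ℝ) (hC0 : 0 ≤ C0)
    (hreg : ∀ x ρ, 0 < ρ → σ.real (closedBall x ρ) ≤ C0 * ρ ^ n)
    (P : Aff n d) (hP : ‖P.2‖ ≤ 1)
    (x : EuclideanSpace ℝ (Fin d)) (ρ : ℝ) (hρ : 0 < ρ) (δ : ℝ) (hδ : 0 < δ) (hδ1 : δ ≤ 1 / 4)
    (τ : ℝ) (hδτ : 8 * 60 ^ n * C0 * δ < τ / 2)
    (hD : τ * ρ ^ n ≤ σ.real (closedBall x ρ))
    (h1 : σ.real {y ∈ closedBall x ρ | δ * ρ < ‖hm ι p0 y - ev P (qm ι p0 y)‖} ≤ τ / 4 * ρ ^ n)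
    (Q : Aff n d) (s : ℝ) (hs : 0 < s)
    (h2 : σ.real {y ∈ closedBall x ρ | s * ρ < ‖ev Q (qm ι p0 y)‖} ≤ τ / 4 * ρ ^ n) :
    ‖Q.2‖ ≤ 2 / δ * s ∧ ‖ev Q (qm ι p0 x)‖ ≤ (1 + 2 / δ) * s * ρ := by
  have hτ : 0 < τ := by
    have : 0 ≤ 8 * 60 ^ n * C0 * δ := by positivity
    linarith
  have hT : ‖Q.2‖ ≤ 2 / δ * s := by
    by_contra hcon
    push Not at hcon
    obtain ⟨u0, hu0⟩ : ∃ u0, 2 / δ * s * ‖u0‖ < ‖Q.2 u0‖ := by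
      by_contra h
      push Not at h
      exact absurd (Q.2.opNorm_le_bound (by positivity) h) (not_le.2 hcon)
    have hTu : 0 < ‖Q.2 u0‖ := lt_of_le_of_lt (by positivity) hu0
    set v := ContinuousLinearMap.adjoint Q.2 (Q.2 u0) with hv
    have hvin : ∀ w, inner ℝ v w = inner ℝ (Q.2 u0) (Q.2 w) := fun w => by
      rw [hv, ContinuousLinearMap.adjoint_inner_left]
    have hvn : 2 / δ * s * ‖Q.2 u0‖ < ‖v‖ := by
      have a1 : ‖Q.2 u0‖ ^ 2 ≤ ‖v‖ * ‖u0‖ := by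
        rw [← real_inner_self_eq_norm_sq, ← hvin]
        exact real_inner_le_norm v u0
      have a2 : 0 < ‖u0‖ := by
        rw [norm_pos_iff]; rintro rfl; simp at hTu
      by_contra h
      push Not at h
      nlinarith
    have hvpos : 0 < ‖v‖ := lt_of_le_of_lt (by positivity) hvn
    refine notslab ι p0 σ hn C0 hC0 hreg P hP (‖v‖⁻¹ * inner ℝ (Q.2 u0) Q.1) (‖v‖⁻¹ • v)
      (by rw [norm_smul, norm_inv, norm_norm, inv_mul_cancel₀ hvpos.ne']) x ρ hρ δ hδ hδ1 τ hδτ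
      hD h1 _ h2 ?_
    intro y hy hyA
    have hy2 : ‖ev Q (qm ι p0 y)‖ ≤ s * ρ := by
      by_contra h
      exact hyA ⟨hy, not_le.1 h⟩
    have e1 : ‖v‖⁻¹ * inner ℝ (Q.2 u0) Q.1 + inner ℝ (‖v‖⁻¹ • v) (qm ι p0 y)
        = ‖v‖⁻¹ * inner ℝ (Q.2 u0) (ev Q (qm ι p0 y)) := by
      rw [real_inner_smul_left, hvin, ev, inner_add_right]; ring
    rw [e1, abs_mul, abs_of_pos (inv_pos.2 hvpos), inv_mul_le_iff₀ hvpos]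
    refine (abs_real_inner_le_norm _ _).trans ?_
    calc ‖Q.2 u0‖ * ‖ev Q (qm ι p0 y)‖ ≤ ‖Q.2 u0‖ * (s * ρ) := by gcongr
      _ = (2 / δ * s * ‖Q.2 u0‖) * (δ / 2 * ρ) := by field_simp
      _ ≤ ‖v‖ * (δ / 2 * ρ) := by gcongr
      _ ≤ ‖v‖ * (δ * ρ) := by gcongr; linarith
  refine ⟨hT, ?_⟩
  have hex : ∃ y ∈ closedBall x ρ, ‖ev Q (qm ι p0 y)‖ ≤ s * ρ := by
    by_contra h
    push Not at h
    have : {y ∈ closedBall x ρ | s * ρ < ‖ev Q (qm ι p0 y)‖} = closedBall x ρ := by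
      ext y
      simp only [mem_ofPred_eq, and_iff_left_iff_imp]
      exact fun hy => h y hy
    rw [this] at h2
    have : 0 < ρ ^ n := by positivity
    nlinarith
  obtain ⟨y, hy, hyQ⟩ := hex
  have a1 := ev_diff Q (qm ι p0 x) (qm ι p0 y)
  have a2 := qm_le ι p0 x y
  have a3 : ‖x - y‖ ≤ ρ := by rw [← dist_eq_norm, dist_comm]; exact hy
  have a4 : ‖ev Q (qm ι p0 x)‖ ≤ ‖ev Q (qm ι p0 x) - ev Q (qm ι p0 y)‖ + ‖ev Q (qm ι p0 y)‖ := by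
    have := norm_add_le (ev Q (qm ι p0 x) - ev Q (qm ι p0 y)) (ev Q (qm ι p0 y))
    rwa [sub_add_cancel] at this
  have a5 : ‖Q.2‖ * ‖qm ι p0 x - qm ι p0 y‖ ≤ 2 / δ * s * ρ := by
    gcongr
    exact a2.trans a3
  linarith

/-- Comparison of affine maps. -/
theorem lemComp (σ : Measure (EuclideanSpace ℝ (Fin d))) [IsFiniteMeasure σ] (hn : 0 < n)
    (C0 : ℝ) (hC0 : 0 ≤ C0)
    (hreg : ∀ x ρ, 0 < ρ → σ.real (closedBall x ρ) ≤ C0 * ρ ^ n)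
    (δ : ℝ) (hδ : 0 < δ) (hδ1 : δ ≤ 1 / 4)
    (τ : ℝ) (hδτ : 8 * 60 ^ n * C0 * δ < τ / 2)
    (P P' : Aff n d) (hP' : ‖P'.2‖ ≤ 1)
    (x x' : EuclideanSpace ℝ (Fin d)) (M r r' b b' : ℝ) (hr' : 0 < r') (hM : 1 ≤ M)
    (hrr : r ≤ 2 * r') (hrr' : r' ≤ r) (hb : 0 < b) (hb' : 0 < b') (hbb : 16 * b' ≤ τ * δ ^ 2)
    (hsub : closedBall x' r' ⊆ closedBall x (M * r))
    (hD : τ * r' ^ n ≤ σ.real (closedBall x' r'))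
    (hcl : Cl ι p0 σ x (M * r) r (4 * b) P) (hcl' : Cl ι p0 σ x' (M * r') r' (4 * b') P') :
    ‖(P - P').2‖ ≤ (1 + 2 / δ) * √(256 * 2 ^ n / τ) * √(b + b') ∧
    ‖ev (P - P') (qm ι p0 x')‖ ≤ (1 + 2 / δ) * √(256 * 2 ^ n / τ) * √(b + b') * r' := by
  have hτ : 0 < τ := by
    have : 0 ≤ 8 * 60 ^ n * C0 * δ := by positivity
    linarith
  set s := √(256 * 2 ^ n / τ) * √(b + b') with hs
  have hspos : 0 < s := by positivity
  have hs2 : s ^ 2 = 256 * 2 ^ n / τ * (b + b') := by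
    rw [hs, mul_pow, Real.sq_sqrt (by positivity), Real.sq_sqrt (by positivity)]
  have hsub' : closedBall x' r' ⊆ closedBall x' (M * r') :=
    closedBall_subset_closedBall (by nlinarith)
  have hrn : r ^ n ≤ 2 ^ n * r' ^ n := by
    rw [← mul_pow]; exact pow_le_pow_left₀ (by linarith) hrr n
  have key := lemA ι p0 σ hn C0 hC0 hreg P' hP' x' r' hr' δ hδ hδ1 τ hδτ hD
    (by
      refine (measureReal_mono ?_).trans ((hcl' δ hδ).trans ?_)
      · exact fun y hy => ⟨hsub' hy.1, hy.2⟩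
      · apply mul_le_mul_of_nonneg_right _ (by positivity)
        rw [div_le_iff₀ (by positivity)]; linarith)
    (P - P') s hspos
    (by
      have hcov : {y ∈ closedBall x' r' | s * r' < ‖ev (P - P') (qm ι p0 y)‖} ⊆
        {y ∈ closedBall x (M * r) | s / 4 * r < ‖hm ι p0 y - ev P (qm ι p0 y)‖} ∪
        {y ∈ closedBall x' (M * r') | s / 2 * r' < ‖hm ι p0 y - ev P' (qm ι p0 y)‖} := by
        intro y hy
        by_cases h : s / 2 * r' < ‖hm ι p0 y - ev P' (qm ι p0 y)‖
        · exact Or.inr ⟨hsub' hy.1, h⟩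
        · left
          refine ⟨hsub hy.1, ?_⟩
          have h1 := hy.2
          rw [ev_sub] at h1
          have h2 : ev P (qm ι p0 y) - ev P' (qm ι p0 y) =
            (hm ι p0 y - ev P' (qm ι p0 y)) - (hm ι p0 y - ev P (qm ι p0 y)) := by abel
          rw [h2] at h1
          have h3 := norm_sub_le (hm ι p0 y - ev P' (qm ι p0 y)) (hm ι p0 y - ev P (qm ι p0 y))
          nlinarith
      refine (measureReal_mono hcov).trans ((measureReal_union_le _ _).trans ?_)
      have e1 := hcl (s / 4) (by positivity)
      have e2 := hcl' (s / 2) (by positivity)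
      have e3 : 4 * b / (s / 4) ^ 2 * r ^ n ≤ 4 * b / (s / 4) ^ 2 * (2 ^ n * r' ^ n) := by gcongr
      have e4 : 4 * b / (s / 4) ^ 2 * (2 ^ n * r' ^ n) = τ / 4 * (b / (b + b')) * r' ^ n := by
        rw [div_pow, hs2]; field_simp; ring
      have e5 : 4 * b' / (s / 2) ^ 2 * r' ^ n ≤ τ / 4 * (b' / (b + b')) * r' ^ n := by
        have : 4 * b' / (s / 2) ^ 2 = τ / (16 * 2 ^ n) * (b' / (b + b')) := by
          rw [div_pow, hs2]; field_simp; ring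
        rw [this]
        gcongr
        have : (1 : ℝ) ≤ 2 ^ n := one_le_pow₀ (by norm_num)
        linarith
      have e6 : b / (b + b') + b' / (b + b') = 1 := by field_simp
      have e7 : τ / 4 * (b / (b + b')) * r' ^ n + τ / 4 * (b' / (b + b')) * r' ^ n
        = τ / 4 * r' ^ n := by
        rw [← add_mul, ← mul_add, e6, mul_one]
      linarith)
  refine ⟨key.1.trans ?_, key.2.trans ?_⟩
  · rw [hs, mul_assoc (1 + 2 / δ)]
    have : 0 < 2 / δ := by positivity
    nlinarith
  · apply le_of_eq; rw [hs]; ring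

theorem lemGraph (σ : Measure (EuclideanSpace ℝ (Fin d))) [IsFiniteMeasure σ] (hn : 0 < n)
    (C0 : ℝ) (hC0 : 0 ≤ C0)
    (hreg : ∀ x ρ, 0 < ρ → σ.real (closedBall x ρ) ≤ C0 * ρ ^ n)
    (δ : ℝ) (hδ : 0 < δ) (hδ1 : δ ≤ 1 / 4)
    (τ : ℝ) (hδτ : 8 * 60 ^ n * C0 * δ < τ / 2)
    (P : Aff n d) (hP : ‖P.2‖ ≤ 1 / 8)
    (x : EuclideanSpace ℝ (Fin d)) (M r r' b b' : ℝ) (hr' : 0 < r') (hM : 1 ≤ M)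
    (hrr : r = 2 * r') (hb : 0 < b) (hb' : 0 < b')
    (hbb : 2 ^ 20 * 2 ^ n * (b + b') ≤ τ * δ ^ 2)
    (hD : τ * r' ^ n ≤ σ.real (closedBall x r'))
    (hcl : Cl ι p0 σ x (M * r) r (4 * b) P)
    (L : AffineSubspace ℝ (EuclideanSpace ℝ (Fin d))) (pL : EuclideanSpace ℝ (Fin d))
    (hpL : pL ∈ L) (hLn : Module.finrank ℝ L.direction = n)
    (hL : ∀ t : ℝ, 0 < t → σ.real {y ∈ closedBall x (M * r') | t * r' <
      infDist y (L : Set (EuclideanSpace ℝ (Fin d)))} ≤ b' / t ^ 2 * r' ^ n) :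
    ∃ P' : Aff n d, ‖P'.2‖ ≤ 1 / 4 ∧ Cl ι p0 σ x (M * r') r' (4 * b') P' := by
  have hτ : 0 < τ := by
    have : 0 ≤ 8 * 60 ^ n * C0 * δ := by positivity
    linarith
  have h2n : (1 : ℝ) ≤ 2 ^ n := one_le_pow₀ (by norm_num)
  have hrn : r ^ n = 2 ^ n * r' ^ n := by rw [hrr, mul_pow]
  have hrn' : 0 < r' ^ n := by positivity
  have hLne : (L : Set (EuclideanSpace ℝ (Fin d))).Nonempty := ⟨pL, hpL⟩
  have hsub' : closedBall x r' ⊆ closedBall x (M * r') :=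
    closedBall_subset_closedBall (by nlinarith)
  have hsub : closedBall x r' ⊆ closedBall x (M * r) :=
    closedBall_subset_closedBall (by nlinarith)
  have hbad1 : σ.real {y ∈ closedBall x r' | δ * r' < ‖hm ι p0 y - ev P (qm ι p0 y)‖}
      ≤ τ / 4 * r' ^ n := by
    refine (measureReal_mono (s₂ := {y ∈ closedBall x (M * r) |
      δ / 2 * r < ‖hm ι p0 y - ev P (qm ι p0 y)‖}) ?_).trans
      ((hcl (δ / 2) (by positivity)).trans ?_)
    · refine fun y hy => ⟨hsub hy.1, ?_⟩
      have := hy.2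
      rw [hrr]; linarith
    · rw [hrn, ← mul_assoc]
      apply mul_le_mul_of_nonneg_right _ (by positivity)
      rw [div_mul_eq_mul_div, div_le_iff₀ (by positivity)]
      have : 0 < 2 ^ n * b := by positivity
      have : 0 < 2 ^ n * b' := by positivity
      nlinarith
  set V := L.direction with hV
  let φ : V →ₗ[ℝ] EuclideanSpace ℝ (Fin n) :=
    (ContinuousLinearMap.adjoint ι.toContinuousLinearMap).toLinearMap ∘ₗ V.subtype
  have hφ : ∀ v : V, φ v = ContinuousLinearMap.adjoint ι.toContinuousLinearMap (v : _) :=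
    fun v => rfl
  have hsurj : Function.Surjective φ := by
    rw [← LinearMap.range_eq_top]
    by_contra hcon
    have hbot : (LinearMap.range φ)ᗮ ≠ ⊥ := by
      rwa [Ne, Submodule.orthogonal_eq_bot_iff]
    obtain ⟨u0, hu0, hu0ne⟩ := Submodule.exists_mem_ne_zero_of_ne_bot hbot
    set u := ‖u0‖⁻¹ • u0 with hu
    have hu1 : ‖u‖ = 1 := by
      rw [hu, norm_smul, norm_inv, norm_norm, inv_mul_cancel₀ (norm_ne_zero_iff.2 hu0ne)]
    have hu2 : ∀ v : V, inner ℝ u (φ v) = 0 := by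
      intro v
      rw [hu, real_inner_smul_left, real_inner_comm]
      rw [(Submodule.mem_orthogonal _ _).1 hu0 (φ v) (LinearMap.mem_range_self φ v), mul_zero]
    refine notslab ι p0 σ hn C0 hC0 hreg P (by linarith) (- inner ℝ u (qm ι p0 pL)) u hu1 x r' hr'
      δ hδ hδ1 τ hδτ hD hbad1 {y ∈ closedBall x (M * r') | δ * r' <
      infDist y (L : Set (EuclideanSpace ℝ (Fin d)))} ((hL δ hδ).trans ?_) ?_
    · apply mul_le_mul_of_nonneg_right _ (by positivity)
      rw [div_le_iff₀ (by positivity)]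
      nlinarith
    · intro y hy hyA
      have h1 : infDist y (L : Set (EuclideanSpace ℝ (Fin d))) ≤ δ * r' := by
        by_contra h
        exact hyA ⟨hsub' hy, not_le.1 h⟩
      refine le_trans ?_ h1
      rw [le_infDist hLne]
      intro z hz
      have h2 : inner ℝ u (qm ι p0 z - qm ι p0 pL) = 0 := by
        rw [qm_sub]
        exact hu2 ⟨z - pL, AffineSubspace.vsub_mem_direction hz hpL⟩
      have h3 : - inner ℝ u (qm ι p0 pL) + inner ℝ u (qm ι p0 y)
          = inner ℝ u (qm ι p0 y - qm ι p0 z) := by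
        rw [inner_sub_right] at h2 ⊢
        linarith
      rw [h3, dist_eq_norm]
      refine (abs_real_inner_le_norm _ _).trans ?_
      rw [hu1, one_mul]
      exact qm_le ι p0 y z
  have hinj : Function.Injective φ :=
    (LinearMap.injective_iff_surjective_of_finrank_eq_finrank (by rw [hLn]; simp)).2 hsurj
  let φe : V ≃ₗ[ℝ] EuclideanSpace ℝ (Fin n) := LinearEquiv.ofBijective φ ⟨hinj, hsurj⟩
  let S : EuclideanSpace ℝ (Fin n) →L[ℝ] EuclideanSpace ℝ (Fin d) :=
    LinearMap.toContinuousLinearMap (V.subtype ∘ₗ φe.symm.toLinearMap)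
  have hS : ∀ v : V, S (ContinuousLinearMap.adjoint ι.toContinuousLinearMap (v : _)) = v := by
    intro v
    have : S (φe v) = v := by
      change ((φe.symm (φe v) : V) : EuclideanSpace ℝ (Fin d)) = v
      rw [LinearEquiv.symm_apply_apply]
    exact this
  set P' : Aff n d := (pL - p0 - S (qm ι p0 pL), S - ι.toContinuousLinearMap) with hP'
  have hev : ∀ z ∈ L, ev P' (qm ι p0 z) = hm ι p0 z := by
    intro z hz
    have h1 := hS ⟨z - pL, AffineSubspace.vsub_mem_direction hz hpL⟩
    simp only at h1
    rw [← qm_sub ι p0, map_sub] at h1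
    have h2 : S (qm ι p0 z) = S (qm ι p0 pL) + (z - pL) := by rw [← h1]; abel
    simp only [ev, hP', hm, _root_.sub_apply, h2,
      LinearIsometry.coe_toContinuousLinearMap]
    abel
  have hinf : ∀ y, ‖hm ι p0 y - ev P' (qm ι p0 y)‖ ≤
      (1 + ‖P'.2‖) * infDist y (L : Set (EuclideanSpace ℝ (Fin d))) := by
    intro y
    have hN : 0 < 1 + ‖P'.2‖ := by positivity
    rw [← div_le_iff₀' hN, le_infDist hLne]
    intro z hz
    rw [div_le_iff₀' hN, dist_eq_norm]
    have h1 : hm ι p0 y - ev P' (qm ι p0 y) =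
      (hm ι p0 y - hm ι p0 z) - (ev P' (qm ι p0 y) - ev P' (qm ι p0 z)) := by
      rw [hev z hz]; abel
    rw [h1]
    refine (norm_sub_le _ _).trans ?_
    have h2 := hm_le ι p0 y z
    have h3 := ev_diff P' (qm ι p0 y) (qm ι p0 z)
    have h4 : ‖P'.2‖ * ‖qm ι p0 y - qm ι p0 z‖ ≤ ‖P'.2‖ * ‖y - z‖ := by
      gcongr; exact qm_le ι p0 y z
    linarith
  have hslope : ‖P'.2‖ ≤ 1 / 4 := by
    set N := 1 + ‖P'.2‖ with hN
    have hN1 : 1 ≤ N := by have := norm_nonneg P'.2; linarith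
    have h1 := (lemA ι p0 σ hn C0 hC0 hreg P (by linarith) x r' hr' δ hδ hδ1 τ hδτ hD hbad1
      (P' - P) (N * (δ / 64)) (by positivity) (by
        have hcov : {y ∈ closedBall x r' | N * (δ / 64) * r' < ‖ev (P' - P) (qm ι p0 y)‖} ⊆
          {y ∈ closedBall x (M * r) | δ / 256 * r < ‖hm ι p0 y - ev P (qm ι p0 y)‖} ∪
          {y ∈ closedBall x (M * r') | δ / 128 * r' <
            infDist y (L : Set (EuclideanSpace ℝ (Fin d)))} := by
          intro y hy
          by_cases h : δ / 128 * r' < infDist y (L : Set (EuclideanSpace ℝ (Fin d)))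
          · exact Or.inr ⟨hsub' hy.1, h⟩
          · left
            refine ⟨hsub hy.1, ?_⟩
            have h1 := hy.2
            push Not at h
            have h5 : N * infDist y (L : Set (EuclideanSpace ℝ (Fin d))) ≤ N * (δ / 128 * r') := by
              gcongr
            rw [ev_sub] at h1
            have h2 : ev P' (qm ι p0 y) - ev P (qm ι p0 y) =
              (hm ι p0 y - ev P (qm ι p0 y)) - (hm ι p0 y - ev P' (qm ι p0 y)) := by abel
            rw [h2] at h1
            have h3 := norm_sub_le (hm ι p0 y - ev P (qm ι p0 y)) (hm ι p0 y - ev P' (qm ι p0 y))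
            have h4 := hinf y
            have h6 : 1 * (δ / 128 * r') ≤ N * (δ / 128 * r') := by gcongr
            rw [hrr]
            linarith
        refine (measureReal_mono hcov).trans ((measureReal_union_le _ _).trans ?_)
        have e1 := hcl (δ / 256) (by positivity)
        have e2 := hL (δ / 128) (by positivity)
        have e3 : (4 * b / (δ / 256) ^ 2 * 2 ^ n + b' / (δ / 128) ^ 2) * r' ^ n
          ≤ τ / 4 * r' ^ n := by
          apply mul_le_mul_of_nonneg_right _ (by positivity)
          have : 4 * b / (δ / 256) ^ 2 * 2 ^ n + b' / (δ / 128) ^ 2 =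
            (4 * 256 ^ 2 * 2 ^ n * b + 128 ^ 2 * b') / δ ^ 2 := by field_simp
          rw [this, div_le_iff₀ (by positivity)]
          have : 0 < 2 ^ n * b := by positivity
          have : b' ≤ 2 ^ n * b' := by nlinarith
          nlinarith
        rw [hrn] at e1
        linarith)).1
    have h2 : 2 / δ * (N * (δ / 64)) = N / 32 := by field_simp; norm_num
    rw [h2] at h1
    have h3 : ‖P'.2‖ ≤ ‖(P' - P).2‖ + ‖P.2‖ := by
      have := norm_add_le (P' - P).2 P.2
      simpa using this
    linarith
  refine ⟨P', hslope, ?_⟩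
  intro t ht
  refine (measureReal_mono ?_).trans ((hL (t / 2) (by positivity)).trans (le_of_eq ?_))
  · intro y hy
    refine ⟨hy.1, ?_⟩
    have h1 := hinf y
    have h2 := hy.2
    have h3 : (1 + ‖P'.2‖) * infDist y (L : Set (EuclideanSpace ℝ (Fin d))) ≤
      2 * infDist y (L : Set (EuclideanSpace ℝ (Fin d))) := by
      gcongr
      · exact infDist_nonneg
      · linarith
    linarith
  · field_simp; norm_num

end Geo2

open MeasureTheory Metric Set Filter
open scoped ENNReal NNReal

/-- The data of the construction. -/
structure Dat (n d : ℕ) where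
  σ : Measure (EuclideanSpace ℝ (Fin d))
  fin : IsFiniteMeasure σ
  hn : 0 < n
  ι : EuclideanSpace ℝ (Fin n) →ₗᵢ[ℝ] EuclideanSpace ℝ (Fin d)
  p0 : EuclideanSpace ℝ (Fin d)
  x0 : EuclideanSpace ℝ (Fin d)
  r0 : ℝ
  hr0 : 0 < r0
  B0 : Set (EuclideanSpace ℝ (Fin d))
  hB0 : B0 ⊆ closedBall x0 (r0 / 2)
  C0 : ℝ
  hC0 : 0 ≤ C0
  hreg : ∀ x ρ, 0 < ρ → σ.real (closedBall x ρ) ≤ C0 * ρ ^ n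
  τ : ℝ
  δ : ℝ
  η : ℝ
  M : ℝ
  hδ : 0 < δ
  hδ1 : δ ≤ 1 / 4
  hδτ : 8 * 60 ^ n * C0 * δ < τ / 2
  hM : 100 * (n + 1) ≤ M
  hη : 0 < η
  hη1 : 2 ^ 20 * 2 ^ n * (η + η) ≤ τ * δ ^ 2
  hη2 : (1 + 2 / δ) * √(256 * 2 ^ n / τ) * √(η + η) ≤ 1 / 300
  b : EuclideanSpace ℝ (Fin d) → ℕ → ℝ
  hb : ∀ x k, 0 < b x k
  g : ℕ → EuclideanSpace ℝ (Fin d) → ℝ≥0∞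
  hg1 : ∀ x' ∈ B0, ∀ k, τ * (r0 / 2 ^ k) ^ n ≤ σ.real (closedBall x' (r0 / 2 ^ k)) →
    ∀ x ∈ closedBall x' (r0 / 2 ^ k), ENNReal.ofReal (b x' k) ≤ g k x
  hg2 : ∀ᵐ x ∂σ, ∑' k, g k x ≤ ENNReal.ofReal η
  plane0 : ∀ x ∈ B0, Cl ι p0 σ x (M * r0) r0 (4 * b x 0) 0
  plane : ∀ x ∈ B0, ∀ k, 1 ≤ k → τ * (r0 / 2 ^ k) ^ n ≤ σ.real (closedBall x (r0 / 2 ^ k)) →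
    ∃ (L : AffineSubspace ℝ (EuclideanSpace ℝ (Fin d))) (pL : EuclideanSpace ℝ (Fin d)),
      pL ∈ L ∧ Module.finrank ℝ L.direction = n ∧
      ∀ t : ℝ, 0 < t → σ.real {y ∈ closedBall x (M * (r0 / 2 ^ k)) | t * (r0 / 2 ^ k) <
        infDist y (L : Set (EuclideanSpace ℝ (Fin d)))} ≤ b x k / t ^ 2 * (r0 / 2 ^ k) ^ n

namespace Dat
variable {n d : ℕ} (A : Dat n d)

/-- Dyadic scales. -/
noncomputable def r (k : ℕ) : ℝ := A.r0 / 2 ^ k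

theorem r_pos (k : ℕ) : 0 < A.r k := by have := A.hr0; unfold r; positivity

theorem r_zero : A.r 0 = A.r0 := by simp [r]

theorem r_succ (k : ℕ) : A.r k = 2 * A.r (k + 1) := by
  unfold r; rw [pow_succ]; field_simp

theorem r_le (k : ℕ) : A.r k ≤ A.r0 := by
  have := A.hr0
  exact div_le_self this.le (one_le_pow₀ (by norm_num))

/-- Projection. -/
noncomputable def q (y : EuclideanSpace ℝ (Fin d)) : EuclideanSpace ℝ (Fin n) := qm A.ι A.p0 y

/-- Height. -/
noncomputable def h (y : EuclideanSpace ℝ (Fin d)) : EuclideanSpace ℝ (Fin d) := hm A.ι A.p0 y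

/-- Density condition. -/
def D (x : EuclideanSpace ℝ (Fin d)) (k : ℕ) : Prop :=
  A.τ * A.r k ^ n ≤ A.σ.real (closedBall x (A.r k))

/-- Existence of a good affine map. -/
def HasP (x : EuclideanSpace ℝ (Fin d)) (k : ℕ) : Prop :=
  ∃ P : Aff n d, ‖P.2‖ ≤ 1 / 4 ∧ Cl A.ι A.p0 A.σ x (A.M * A.r k) (A.r k) (4 * A.b x k) P

open Classical in
/-- The chosen affine map. -/
noncomputable def Pm (x : EuclideanSpace ℝ (Fin d)) (k : ℕ) : Aff n d :=
  if k = 0 then 0 else if hP : A.HasP x k then hP.choose else 0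

/-- Good points at a level. -/
def Good (x : EuclideanSpace ℝ (Fin d)) (k : ℕ) : Prop :=
  A.D x k ∧ A.HasP x k ∧ ‖A.h x - ev (A.Pm x k) (A.q x)‖ ≤ A.r k / 300

/-- Points good up to a level. -/
def E (k : ℕ) : Set (EuclideanSpace ℝ (Fin d)) := {x ∈ A.B0 | ∀ j ≤ k, A.Good x j}

/-- Comparison constant. -/
noncomputable def Λ : ℝ := (1 + 2 / A.δ) * √(256 * 2 ^ n / A.τ)

theorem τ_pos : 0 < A.τ := by
  have h1 := A.hδτ
  have h2 := A.hC0
  have h3 := A.hδ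
  have : 0 ≤ 8 * 60 ^ n * A.C0 * A.δ := by positivity
  linarith

theorem Λ_pos : 0 < A.Λ := by
  have := A.τ_pos
  have h3 := A.hδ
  unfold Λ; positivity

theorem E_anti {k l : ℕ} (hkl : k ≤ l) : A.E l ⊆ A.E k :=
  fun _ hx => ⟨hx.1, fun j hj => hx.2 j (hj.trans hkl)⟩

theorem b_le {x : EuclideanSpace ℝ (Fin d)} {k : ℕ} (hx : x ∈ A.B0) (hD : A.D x k) :
    A.b x k ≤ A.η := by
  have h1 : A.σ (closedBall x (A.r k)) ≠ 0 := by
    intro h0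
    have h2 : A.σ.real (closedBall x (A.r k)) = 0 := by simp [measureReal_def, h0]
    unfold D at hD
    rw [h2] at hD
    have := A.τ_pos
    have := A.r_pos k
    have : 0 < A.τ * A.r k ^ n := by positivity
    linarith
  have h2 : ∃ y ∈ closedBall x (A.r k), ∑' k, A.g k y ≤ ENNReal.ofReal A.η := by
    by_contra hcon
    push Not at hcon
    apply h1
    refine measure_mono_null (fun y hy => ?_) (ae_iff.1 A.hg2)
    exact not_le.2 (hcon y hy)
  obtain ⟨y, hy, hy2⟩ := h2
  have h3 := A.hg1 x hx k hD y hy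
  have h4 := (h3.trans (ENNReal.le_tsum k)).trans hy2
  exact (ENNReal.ofReal_le_ofReal_iff A.hη.le).1 h4

theorem Pm_spec {x : EuclideanSpace ℝ (Fin d)} {k : ℕ} (hx : x ∈ A.B0) (hP : A.HasP x k) :
    ‖(A.Pm x k).2‖ ≤ 1 / 4 ∧
    Cl A.ι A.p0 A.σ x (A.M * A.r k) (A.r k) (4 * A.b x k) (A.Pm x k) := by
  unfold Pm
  by_cases hk : k = 0
  · subst hk
    rw [if_pos rfl, r_zero]
    exact ⟨by simp, A.plane0 x hx⟩
  · rw [if_neg hk, dif_pos hP]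
    exact hP.choose_spec

theorem mem_spec {x : EuclideanSpace ℝ (Fin d)} {k : ℕ} (hx : x ∈ A.E k) :
    A.D x k ∧ ‖(A.Pm x k).2‖ ≤ 1 / 4 ∧
    Cl A.ι A.p0 A.σ x (A.M * A.r k) (A.r k) (4 * A.b x k) (A.Pm x k) ∧
    ‖A.h x - ev (A.Pm x k) (A.q x)‖ ≤ A.r k / 300 ∧ A.b x k ≤ A.η := by
  have hg := hx.2 k le_rfl
  have hp := A.Pm_spec hx.1 hg.2.1
  exact ⟨hg.1, hp.1, hp.2, hg.2.2, A.b_le hx.1 hg.1⟩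

theorem M_ge : 100 ≤ A.M := by
  have h1 := A.hM
  have h2 : (0 : ℝ) ≤ n := by positivity
  linarith

/-- Comparison of the chosen affine maps; the second point only needs density. -/
theorem compare' {x x' : EuclideanSpace ℝ (Fin d)} {k k' : ℕ} (hx : x ∈ A.E k) (hx' : x' ∈ A.B0)
    (hD' : A.D x' k') (hP' : A.HasP x' k')
    (hk : k' = k ∨ k' = k + 1) (hd : dist x x' ≤ (A.M - 1) * A.r k) :
    ‖(A.Pm x k - A.Pm x' k').2‖ ≤ A.Λ * √(A.b x k + A.b x' k') ∧
    ‖ev (A.Pm x k - A.Pm x' k') (A.q x')‖ ≤ A.Λ * √(A.b x k + A.b x' k') * A.r k' := by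
  have := A.fin
  obtain ⟨hD, hs, hcl, -, hbη⟩ := A.mem_spec hx
  obtain ⟨hs', hcl'⟩ := A.Pm_spec hx' hP'
  have hbη' := A.b_le hx' hD'
  have hr := A.r_pos k
  have hr' := A.r_pos k'
  have hrr : A.r k ≤ 2 * A.r k' := by
    rcases hk with rfl | rfl
    · linarith
    · rw [A.r_succ k]
  have hrr' : A.r k' ≤ A.r k := by
    rcases hk with rfl | rfl
    · rfl
    · rw [A.r_succ k]; linarith
  have hη1 := A.hη1
  have hη := A.hη
  have hτ := A.τ_pos
  have h2n : (1 : ℝ) ≤ 2 ^ n := one_le_pow₀ (by norm_num)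
  have hδ := A.hδ
  exact lemComp A.ι A.p0 A.σ A.hn A.C0 A.hC0 A.hreg A.δ A.hδ A.hδ1 A.τ A.hδτ (A.Pm x k)
    (A.Pm x' k') (by linarith) x x' A.M (A.r k) (A.r k') (A.b x k) (A.b x' k') hr'
    (by linarith [A.M_ge]) hrr hrr' (A.hb _ _) (A.hb _ _)
    (by
      have : A.η ≤ 2 ^ n * A.η := by nlinarith
      nlinarith)
    (by
      apply closedBall_subset_closedBall'
      rw [dist_comm]
      linarith) hD' hcl hcl'

theorem compare {x x' : EuclideanSpace ℝ (Fin d)} {k k' : ℕ} (hx : x ∈ A.E k) (hx' : x' ∈ A.E k')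
    (hk : k' = k ∨ k' = k + 1) (hd : dist x x' ≤ (A.M - 1) * A.r k) :
    ‖(A.Pm x k - A.Pm x' k').2‖ ≤ A.Λ * √(A.b x k + A.b x' k') ∧
    ‖ev (A.Pm x k - A.Pm x' k') (A.q x')‖ ≤ A.Λ * √(A.b x k + A.b x' k') * A.r k' :=
  A.compare' hx hx'.1 (A.mem_spec hx').1 (hx'.2 k' le_rfl).2.1 hk hd

theorem Λη {a b : ℝ} (ha : a ≤ A.η) (hb : b ≤ A.η) : A.Λ * √(a + b) ≤ 1 / 300 := by
  refine le_trans ?_ A.hη2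
  have := A.Λ_pos
  have h1 : √(a + b) ≤ √(A.η + A.η) := Real.sqrt_le_sqrt (by linarith)
  exact mul_le_mul_of_nonneg_left h1 this.le

theorem dist_qh (y y' : EuclideanSpace ℝ (Fin d)) :
    dist y y' ≤ ‖A.q y - A.q y'‖ + ‖A.h y - A.h y'‖ := by
  rw [dist_eq_norm]; exact dist_le_qh _ _ _ _

theorem q_le (y y' : EuclideanSpace ℝ (Fin d)) : ‖A.q y - A.q y'‖ ≤ dist y y' := by
  rw [dist_eq_norm]; exact qm_le _ _ _ _

theorem cone0 {x x' : EuclideanSpace ℝ (Fin d)} {l : ℕ} (hx : x ∈ A.E l) (hx' : x' ∈ A.E l)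
    (h1 : A.r l ≤ 10 * dist x x') (h2 : dist x x' ≤ A.r l) :
    7 / 10 * dist x x' ≤ ‖A.q x - A.q x'‖ := by
  have hr := A.r_pos l
  have hM := A.M_ge
  obtain ⟨hD, hs, hcl, hF, hbη⟩ := A.mem_spec hx
  obtain ⟨hD', hs', hcl', hF', hbη'⟩ := A.mem_spec hx'
  have hc := (A.compare hx hx' (Or.inl rfl) (by nlinarith)).2
  have hc2 := A.Λη hbη hbη'
  have hc3 : ‖ev (A.Pm x l - A.Pm x' l) (A.q x')‖ ≤ 1 / 300 * A.r l :=
    hc.trans (by gcongr)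
  have e1 := ev_diff (A.Pm x l) (A.q x) (A.q x')
  have e2 : ‖(A.Pm x l).2‖ * ‖A.q x - A.q x'‖ ≤ 1 / 4 * ‖A.q x - A.q x'‖ := by gcongr
  have e3 : A.h x - A.h x' = (A.h x - ev (A.Pm x l) (A.q x)) +
      (ev (A.Pm x l) (A.q x) - ev (A.Pm x l) (A.q x')) +
      ev (A.Pm x l - A.Pm x' l) (A.q x') - (A.h x' - ev (A.Pm x' l) (A.q x')) := by
    rw [ev_sub]; abel
  have e4 : ‖A.h x - A.h x'‖ ≤ A.r l / 300 + 1 / 4 * ‖A.q x - A.q x'‖ + 1 / 300 * A.r l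
      + A.r l / 300 := by
    rw [e3]
    refine (norm_sub_le _ _).trans (add_le_add ?_ hF')
    refine (norm_add_le _ _).trans (add_le_add ?_ hc3)
    exact (norm_add_le _ _).trans (add_le_add hF (e1.trans e2))
  have e5 := A.dist_qh x x'
  linarith

theorem cone {x x' : EuclideanSpace ℝ (Fin d)} {k k' : ℕ} (hx : x ∈ A.E k) (hx' : x' ∈ A.E k')
    (hk : k ≤ k') (h1 : A.r k ≤ 10 * dist x x') :
    7 / 10 * dist x x' ≤ ‖A.q x - A.q x'‖ := by
  have hdist : dist x x' ≤ A.r 0 := by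
    have a1 := A.hB0 hx.1
    have a2 := A.hB0 hx'.1
    rw [mem_closedBall] at a1 a2
    have := dist_triangle_right x x' A.x0
    rw [r_zero]; linarith
  -- find the right scale by induction
  have key : ∀ j l, l + j = k → dist x x' ≤ A.r l → 7 / 10 * dist x x' ≤ ‖A.q x - A.q x'‖ := by
    intro j
    induction j with
    | zero =>
      intro l hl hdl
      have : l = k := by omega
      subst this
      exact A.cone0 hx (A.E_anti hk hx') h1 hdl
    | succ j ih =>
      intro l hl hdl
      by_cases hdl2 : dist x x' ≤ A.r (l + 1)
      · exact ih (l + 1) (by omega) hdl2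
      · apply A.cone0 (A.E_anti (by omega) hx) (A.E_anti (by omega) hx') _ hdl
        push Not at hdl2
        have := A.r_succ l
        have := A.r_pos (l + 1)
        linarith
  exact key k 0 (by omega) hdist

/-- Points with close projections are close. -/
theorem dist_le_of_q {x x' : EuclideanSpace ℝ (Fin d)} {k k' : ℕ} (hx : x ∈ A.E k)
    (hx' : x' ∈ A.E k') (hk : k ≤ k') {R : ℝ} (hR : ‖A.q x - A.q x'‖ ≤ R) (hR1 : A.r k ≤ R) :
    dist x x' ≤ 10 / 7 * R := by
  by_cases h1 : A.r k ≤ 10 * dist x x'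
  · have := A.cone hx hx' hk h1
    linarith
  · push Not at h1
    have := A.r_pos k
    linarith

/-- The good set projects injectively with Lipschitz inverse. -/
theorem cone_lim {x x' : EuclideanSpace ℝ (Fin d)} (hx : ∀ k, x ∈ A.E k) (hx' : ∀ k, x' ∈ A.E k) :
    7 / 10 * dist x x' ≤ ‖A.q x - A.q x'‖ := by
  by_cases h0 : dist x x' = 0
  · rw [h0]; simp
  · have hpos : 0 < dist x x' := lt_of_le_of_ne dist_nonneg (Ne.symm h0)
    have : Tendsto (fun k : ℕ => A.r k) atTop (nhds 0) := by
      unfold r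
      have := tendsto_pow_atTop_nhds_zero_of_lt_one (r := (1 / 2 : ℝ)) (by norm_num) (by norm_num)
      have := this.const_mul A.r0
      simpa [div_eq_mul_inv] using this
    obtain ⟨k, hk⟩ := (this.eventually (gt_mem_nhds (show 0 < 10 * dist x x' by positivity))).exists
    exact A.cone (hx k) (hx' k) le_rfl hk.le

end Dat

open MeasureTheory Metric Set Filter
open scoped ENNReal NNReal

theorem ev_contDiff {n d : ℕ} (P : Aff n d) : ContDiff ℝ 2 (ev P) := by
  unfold ev
  fun_prop

namespace Dat
variable {n d : ℕ} (A : Dat n d)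

/-- Good grid points. -/
def gd (k : ℕ) (z : Fin n → ℤ) : Prop :=
  ∃ x ∈ A.E k, ∀ i, |(A.r k)⁻¹ * A.q x i - z i| ≤ 4

theorem gd_finite (k : ℕ) : {z | A.gd k z}.Finite := by
  set R : ℝ := (A.r k)⁻¹ * (‖A.q A.x0‖ + A.r0) + 4 with hR
  have hr := A.r_pos k
  apply Set.Finite.subset (s := ((Fintype.piFinset
    (fun _ : Fin n => Finset.Icc (-⌈R⌉) ⌈R⌉) : Finset (Fin n → ℤ)) : Set (Fin n → ℤ)))
    (Finset.finite_toSet _)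
  rintro z ⟨x, hx, hz⟩
  rw [Finset.mem_coe, Fintype.mem_piFinset]
  intro i
  have h1 := A.hB0 hx.1
  rw [mem_closedBall] at h1
  have h2 := A.q_le x A.x0
  have h3 : ‖A.q x‖ ≤ ‖A.q A.x0‖ + A.r0 := by
    have := norm_le_insert' (A.q x) (A.q A.x0)
    have := A.hr0
    linarith
  have h4 := coord_le_norm (A.q x) i
  have h5 : |(A.r k)⁻¹ * A.q x i| ≤ (A.r k)⁻¹ * (‖A.q A.x0‖ + A.r0) := by
    rw [abs_mul, abs_of_pos (inv_pos.2 hr)]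
    gcongr
    linarith
  have h6 : |(z i : ℝ)| ≤ R := by
    have := abs_sub_abs_le_abs_sub (z i : ℝ) ((A.r k)⁻¹ * A.q x i)
    rw [abs_sub_comm] at this
    linarith [hz i]
  have h7 := abs_le.1 (h6.trans (Int.le_ceil R))
  rw [Finset.mem_Icc]
  constructor
  · have : ((-⌈R⌉ : ℤ) : ℝ) ≤ z i := by push_cast; exact h7.1
    exact_mod_cast this
  · exact_mod_cast h7.2

/-- The finite set of good grid points. -/
noncomputable def Gd (k : ℕ) : Finset (Fin n → ℤ) := (A.gd_finite k).toFinset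

theorem mem_Gd {k : ℕ} {z : Fin n → ℤ} : z ∈ A.Gd k ↔ A.gd k z := by
  simp [Gd]

open Classical in
/-- Chosen point. -/
noncomputable def X (k : ℕ) (z : Fin n → ℤ) : EuclideanSpace ℝ (Fin d) :=
  if h : A.gd k z then h.choose else 0

theorem X_spec {k : ℕ} {z : Fin n → ℤ} (hz : z ∈ A.Gd k) :
    A.X k z ∈ A.E k ∧ ∀ i, |(A.r k)⁻¹ * A.q (A.X k z) i - z i| ≤ 4 := by
  have hz := A.mem_Gd.1 hz
  unfold X
  rw [dif_pos hz]
  exact hz.choose_spec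

/-- Affine map attached to a grid point. -/
noncomputable def Pz (k : ℕ) (z : Fin n → ℤ) : Aff n d := A.Pm (A.X k z) k

/-- Flatness coefficient attached to a grid point. -/
noncomputable def bz (k : ℕ) (z : Fin n → ℤ) : ℝ := A.b (A.X k z) k

theorem bz_pos (k : ℕ) (z : Fin n → ℤ) : 0 < A.bz k z := A.hb _ _

/-- The bump. -/
noncomputable def th (k : ℕ) (z : Fin n → ℤ) (w : EuclideanSpace ℝ (Fin n)) : ℝ :=
  thetaS (A.r k) (zv z) w

/-- The approximating functions. -/
noncomputable def Fn : ℕ → EuclideanSpace ℝ (Fin n) → EuclideanSpace ℝ (Fin d)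
  | 0 => fun _ => 0
  | k + 1 => fun w => Fn k w + ∑ z ∈ A.Gd (k + 1), A.th (k + 1) z w • (ev (A.Pz (k + 1) z) w - Fn k w)

theorem Fn_contDiff (k : ℕ) : ContDiff ℝ 2 (A.Fn k) := by
  induction k with
  | zero => exact contDiff_const
  | succ k ih =>
    unfold Fn
    apply ih.add
    apply ContDiff.sum
    intro z _
    apply ContDiff.smul (thetaS_contDiff _ _)
    exact (ev_contDiff _).sub ih

/-- Core region. -/
def core (k : ℕ) (w : EuclideanSpace ℝ (Fin n)) : Prop :=
  ∃ x ∈ A.E k, ∀ i, |w i - A.q x i| < 3 * A.r k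

theorem core_nhds {k : ℕ} {w : EuclideanSpace ℝ (Fin n)} (h : A.core k w) :
    ∀ᶠ w' in nhds w, A.core k w' := by
  obtain ⟨x, hx, hw⟩ := h
  have : ∀ᶠ w' in nhds w, ∀ i, |w' i - A.q x i| < 3 * A.r k := by
    rw [eventually_all]
    intro i
    have hc : Continuous (fun w' : EuclideanSpace ℝ (Fin n) => |w' i - A.q x i|) := by fun_prop
    exact hc.continuousAt.eventually (gt_mem_nhds (hw i))
  exact this.mono fun w' hw' => ⟨x, hx, hw'⟩

theorem core_sum {k : ℕ} {w : EuclideanSpace ℝ (Fin n)} (h : A.core k w) :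
    ∑ z ∈ A.Gd k, A.th k z w = 1 := by
  obtain ⟨x, hx, hw⟩ := h
  have hr := A.r_pos k
  apply thetaS_sum
  intro z hz
  rw [mem_Gd]
  refine ⟨x, hx, fun i => ?_⟩
  have h1 : |(A.r k)⁻¹ * (w i - A.q x i)| ≤ 3 := by
    rw [abs_mul, abs_of_pos (inv_pos.2 hr), inv_mul_le_iff₀ hr]
    linarith [hw i]
  have h2 : (A.r k)⁻¹ * A.q x i - z i = ((A.r k)⁻¹ * w i - z i) - (A.r k)⁻¹ * (w i - A.q x i) := by
    ring
  rw [h2]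
  have := abs_sub ((A.r k)⁻¹ * w i - z i) ((A.r k)⁻¹ * (w i - A.q x i))
  linarith [hz i]

theorem core_eq {k : ℕ} {w : EuclideanSpace ℝ (Fin n)} (h : A.core k w) :
    A.Fn k w = ∑ z ∈ A.Gd k, A.th k z w • ev (A.Pz k z) w := by
  have hs := A.core_sum h
  cases k with
  | zero =>
    have : ∀ z, A.Pz 0 z = 0 := fun z => by simp [Pz, Pm]
    simp [Fn, this, ev]
  | succ k =>
    have e : A.Fn (k + 1) w = A.Fn k w + ∑ z ∈ A.Gd (k + 1), A.th (k + 1) z w •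
      (ev (A.Pz (k + 1) z) w - A.Fn k w) := by rw [Fn]
    rw [e]
    simp only [smul_sub, Finset.sum_sub_distrib]
    rw [← Finset.sum_smul, hs, one_smul]
    abel

/-- Closed support cell. -/
def S (k : ℕ) (z : Fin n → ℤ) (w : EuclideanSpace ℝ (Fin n)) : Prop :=
  ∀ i, |(A.r k)⁻¹ * w i - z i| ≤ 1

open Classical in
/-- Active grid points. -/
noncomputable def N (k : ℕ) (w : EuclideanSpace ℝ (Fin n)) : Finset (Fin n → ℤ) :=
  (A.Gd k).filter (fun z => A.S k z w)

theorem mem_N {k : ℕ} {w : EuclideanSpace ℝ (Fin n)} {z : Fin n → ℤ} :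
    z ∈ A.N k w ↔ z ∈ A.Gd k ∧ A.S k z w := by simp [N]

theorem card_N (k : ℕ) (w : EuclideanSpace ℝ (Fin n)) : (A.N k w).card ≤ 3 ^ n := by
  refine (card_near (fun i => (A.r k)⁻¹ * w i) 1 _ ?_).trans (by norm_num)
  intro z hz i
  simpa using (A.mem_N.1 hz).2 i

theorem N_nhds (k : ℕ) (w : EuclideanSpace ℝ (Fin n)) :
    ∀ᶠ w' in nhds w, ∀ z ∈ A.Gd k, z ∉ A.N k w → A.th k z w' = 0 := by
  rw [eventually_all_finset]
  intro z hz
  by_cases hzN : z ∈ A.N k w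
  · exact Eventually.of_forall fun _ h => absurd hzN h
  · have : ¬ A.S k z w := fun h => hzN (A.mem_N.2 ⟨hz, h⟩)
    unfold S at this
    push Not at this
    obtain ⟨i, hi⟩ := this
    have hc : Continuous (fun w' : EuclideanSpace ℝ (Fin n) => |(A.r k)⁻¹ * w' i - z i|) := by
      fun_prop
    filter_upwards [hc.continuousAt.eventually (lt_mem_nhds hi)] with w' hw' _
    exact thetaS_eq_zero ⟨i, hw'.le⟩

theorem sum_N {V : Type*} [AddCommGroup V] [Module ℝ V] {k : ℕ} {w w' : EuclideanSpace ℝ (Fin n)}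
    (h : ∀ z ∈ A.Gd k, z ∉ A.N k w → A.th k z w' = 0) (f : (Fin n → ℤ) → V) :
    ∑ z ∈ A.Gd k, A.th k z w' • f z = ∑ z ∈ A.N k w, A.th k z w' • f z := by
  symm
  apply Finset.sum_subset
  · intro z hz; exact (A.mem_N.1 hz).1
  · intro z hz hzN
    rw [h z hz hzN, zero_smul]

theorem S_dist {k : ℕ} {w : EuclideanSpace ℝ (Fin n)} {z : Fin n → ℤ} (hz : z ∈ A.N k w) (i : Fin n) :
    |w i - A.q (A.X k z) i| ≤ 5 * A.r k := by
  have hr := A.r_pos k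
  obtain ⟨h1, h2⟩ := A.mem_N.1 hz
  have h3 := (A.X_spec h1).2 i
  have h4 := h2 i
  have h5 : |(A.r k)⁻¹ * (w i - A.q (A.X k z) i)| ≤ 5 := by
    have : (A.r k)⁻¹ * (w i - A.q (A.X k z) i) = ((A.r k)⁻¹ * w i - z i) -
      ((A.r k)⁻¹ * A.q (A.X k z) i - z i) := by ring
    rw [this]
    have := abs_sub ((A.r k)⁻¹ * w i - z i) ((A.r k)⁻¹ * A.q (A.X k z) i - z i)
    linarith
  rw [abs_mul, abs_of_pos (inv_pos.2 hr), inv_mul_le_iff₀ hr] at h5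
  linarith

theorem S_dist' {k : ℕ} {w : EuclideanSpace ℝ (Fin n)} {z : Fin n → ℤ} (hz : z ∈ A.N k w) :
    ‖w - A.q (A.X k z)‖ ≤ n * (5 * A.r k) := by
  apply norm_le_of_coord
  intro i
  exact A.S_dist hz i

theorem core_of_N {k : ℕ} {w : EuclideanSpace ℝ (Fin n)} {z : Fin n → ℤ}
    (hz : z ∈ A.N (k + 1) w) : A.core k w := by
  refine ⟨A.X (k + 1) z, A.E_anti (Nat.le_succ k) (A.X_spec (A.mem_N.1 hz).1).1, fun i => ?_⟩
  have h1 := A.S_dist hz i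
  have h2 := A.r_succ k
  have h3 := A.r_pos (k + 1)
  linarith

/-- Local sum of the flatness coefficients. -/
noncomputable def bs (k : ℕ) (w : EuclideanSpace ℝ (Fin n)) : ℝ := ∑ z ∈ A.N k w, A.bz k z

theorem bs_nonneg (k : ℕ) (w : EuclideanSpace ℝ (Fin n)) : 0 ≤ A.bs k w :=
  Finset.sum_nonneg fun z _ => (A.bz_pos k z).le

theorem bz_le_bs {k : ℕ} {w : EuclideanSpace ℝ (Fin n)} {z : Fin n → ℤ} (hz : z ∈ A.N k w) :
    A.bz k z ≤ A.bs k w :=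
  Finset.single_le_sum (fun z _ => (A.bz_pos k z).le) hz

theorem bs_le (k : ℕ) (w : EuclideanSpace ℝ (Fin n)) : A.bs k w ≤ 3 ^ n * A.η := by
  have h1 : A.bs k w ≤ ∑ z ∈ A.N k w, A.η := by
    apply Finset.sum_le_sum
    intro z hz
    exact (A.mem_spec (A.X_spec (A.mem_N.1 hz).1).1).2.2.2.2
  refine h1.trans ?_
  rw [Finset.sum_const, nsmul_eq_mul]
  have := A.hη
  gcongr
  exact_mod_cast A.card_N k w

/-- The local oscillation. -/
noncomputable def eps (k : ℕ) (w : EuclideanSpace ℝ (Fin n)) : ℝ := √(A.bs k w + A.bs (k + 1) w)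

theorem n_one {n d : ℕ} (A : Dat n d) : (1 : ℝ) ≤ n := by exact_mod_cast A.hn

theorem PzPz {k : ℕ} {w : EuclideanSpace ℝ (Fin n)} {z z' : Fin n → ℤ}
    (hz : z ∈ A.N (k + 1) w) (hz' : z' ∈ A.N k w) :
    ‖(A.Pz (k + 1) z - A.Pz k z').2‖ ≤ A.Λ * A.eps k w ∧
    ‖ev (A.Pz (k + 1) z - A.Pz k z') w‖ ≤ (3 * n + 1) * (A.Λ * A.eps k w) * A.r k := by
  have hX := (A.X_spec (A.mem_N.1 hz).1).1
  have hX' := (A.X_spec (A.mem_N.1 hz').1).1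
  have hn := A.n_one
  have hr := A.r_pos k
  have hΛ := A.Λ_pos
  have hrs := A.r_succ k
  have d1 := A.S_dist' hz
  have d2 := A.S_dist' hz'
  have d3 : ‖A.q (A.X k z') - A.q (A.X (k + 1) z)‖ ≤ 8 * n * A.r k := by
    have : A.q (A.X k z') - A.q (A.X (k + 1) z) = (w - A.q (A.X (k + 1) z)) -
      (w - A.q (A.X k z')) := by abel
    rw [this]
    refine (norm_sub_le _ _).trans ?_
    nlinarith
  have d4 := A.dist_le_of_q hX' hX (Nat.le_succ k) d3 (by nlinarith)
  have hM := A.hM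
  obtain ⟨c1, c2⟩ := A.compare hX' hX (Or.inr rfl) (d4.trans (by nlinarith))
  have e1 : √(A.b (A.X k z') k + A.b (A.X (k + 1) z) (k + 1)) ≤ A.eps k w := by
    apply Real.sqrt_le_sqrt
    exact add_le_add (A.bz_le_bs hz') (A.bz_le_bs hz)
  have e2 : A.Λ * √(A.b (A.X k z') k + A.b (A.X (k + 1) z) (k + 1)) ≤ A.Λ * A.eps k w := by
    gcongr
  have e3 : A.Pz (k + 1) z - A.Pz k z' =
    -(A.Pm (A.X k z') k - A.Pm (A.X (k + 1) z) (k + 1)) := by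
    rw [neg_sub]; rfl
  set Q := A.Pm (A.X k z') k - A.Pm (A.X (k + 1) z) (k + 1) with hQ
  have e4 : ∀ w, ev (-Q) w = - ev Q w := fun w => by simp [ev]; abel
  have e5 : 0 ≤ A.Λ * A.eps k w := mul_nonneg hΛ.le (Real.sqrt_nonneg _)
  rw [e3]
  refine ⟨?_, ?_⟩
  · rw [Prod.snd_neg, norm_neg]
    exact c1.trans e2
  · rw [e4, norm_neg]
    have f1 := ev_diff Q w (A.q (A.X (k + 1) z))
    have f2 : ‖Q.2‖ * ‖w - A.q (A.X (k + 1) z)‖ ≤ (A.Λ * A.eps k w) * (n * (5 * A.r (k + 1))) := by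
      apply mul_le_mul (c1.trans e2) d1 (norm_nonneg _) e5
    have f3 : ‖ev Q w‖ ≤ ‖ev Q w - ev Q (A.q (A.X (k + 1) z))‖ + ‖ev Q (A.q (A.X (k + 1) z))‖ := by
      have := norm_add_le (ev Q w - ev Q (A.q (A.X (k + 1) z))) (ev Q (A.q (A.X (k + 1) z)))
      rwa [sub_add_cancel] at this
    have f4 := mul_le_mul_of_nonneg_right e2 (A.r_pos (k + 1)).le
    have f5 : A.r (k + 1) = A.r k / 2 := by linarith
    rw [f5] at f2 f4 c2
    have f6 : 0 ≤ A.Λ * A.eps k w * A.r k := by positivity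
    have f7 : 0 ≤ A.Λ * A.eps k w * A.r k * n := by positivity
    linarith

/-- Constant for the differences. -/
noncomputable def C1 : ℝ := 3 ^ n * (4 * (Cth n * ((3 * n + 2) * A.Λ)))

/-- Constant for the increments. -/
noncomputable def C2 : ℝ := 3 ^ n * (4 * ((4 * Cth n) * A.C1))

theorem C1_pos : 0 < A.C1 := by
  have h1 := A.Λ_pos
  have h2 := Cth_one n
  unfold C1; positivity

theorem C2_pos : 0 < A.C2 := by
  have h1 := A.C1_pos
  have h2 := Cth_one n
  unfold C2; positivity

theorem eps_nonneg (k : ℕ) (w : EuclideanSpace ℝ (Fin n)) : 0 ≤ A.eps k w := Real.sqrt_nonneg _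

theorem card_mul_le {k : ℕ} {w : EuclideanSpace ℝ (Fin n)} {c : ℝ} (hc : 0 ≤ c) :
    ∑ _z ∈ A.N k w, c ≤ 3 ^ n * c := by
  rw [Finset.sum_const, nsmul_eq_mul]
  gcongr
  exact_mod_cast A.card_N k w

/-- Bounds on the differences with the affine maps. -/
theorem DB_diff {k : ℕ} {w : EuclideanSpace ℝ (Fin n)} {z : Fin n → ℤ} (hz : z ∈ A.N (k + 1) w) :
    DB (fun w => ev (A.Pz (k + 1) z) w - A.Fn k w) w (A.r k) (A.C1 * A.eps k w * A.r k) := by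
  have hr := A.r_pos k
  have hΛ := A.Λ_pos
  have hC := Cth_one n
  have hε := A.eps_nonneg k w
  have hcong : (fun w => ev (A.Pz (k + 1) z) w - A.Fn k w) =ᶠ[nhds w]
      fun w' => ∑ z' ∈ A.N k w, A.th k z' w' • ev (A.Pz (k + 1) z - A.Pz k z') w' := by
    filter_upwards [A.core_nhds (A.core_of_N hz), A.N_nhds k w] with w' h1 h2
    rw [A.core_eq h1, ← A.sum_N h2]
    simp only [ev_sub, smul_sub, Finset.sum_sub_distrib]
    rw [← Finset.sum_smul, A.core_sum h1, one_smul]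
  have key : DB (fun w' => ∑ z' ∈ A.N k w, A.th k z' w' • ev (A.Pz (k + 1) z - A.Pz k z') w') w (A.r k)
      (∑ z' ∈ A.N k w, 4 * (Cth n * ((3 * n + 2) * (A.Λ * A.eps k w) * A.r k))) := by
    apply DB.sum _ hr.le
    · intro z' _
      exact (thetaS_contDiff _ _).smul (ev_contDiff _)
    · intro z' hz'
      apply DB.smul hr.le (thetaS_contDiff _ _) (ev_contDiff _) (DB_thetaS _ hr _ _)
      obtain ⟨c1, c2⟩ := A.PzPz hz hz'
      refine (DB_affine _ _ w hr.le).mono ?_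
      have c3 := mul_le_mul_of_nonneg_right c1 hr.le
      unfold ev at c2
      linarith
  refine (key.congr hcong).mono ?_
  refine (A.card_mul_le (by positivity)).trans (le_of_eq ?_)
  unfold C1; ring

/-- The increments. -/
noncomputable def Bn (k : ℕ) (w : EuclideanSpace ℝ (Fin n)) : EuclideanSpace ℝ (Fin d) :=
  ∑ z ∈ A.Gd (k + 1), A.th (k + 1) z w • (ev (A.Pz (k + 1) z) w - A.Fn k w)

theorem Fn_succ (k : ℕ) : A.Fn (k + 1) = fun w => A.Fn k w + A.Bn k w := rfl

theorem Bn_contDiff (k : ℕ) : ContDiff ℝ 2 (A.Bn k) := by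
  unfold Bn
  apply ContDiff.sum
  intro z _
  apply ContDiff.smul (thetaS_contDiff _ _)
  exact (ev_contDiff _).sub (A.Fn_contDiff k)

theorem DB_thetaS_succ (k : ℕ) (z : Fin n → ℤ) (w : EuclideanSpace ℝ (Fin n)) :
    DB (A.th (k + 1) z) w (A.r k) (4 * Cth n) := by
  have hr := A.r_pos (k + 1)
  intro m hm
  have := DB_thetaS (A.r (k + 1)) hr (zv z) w m hm
  rw [A.r_succ k, mul_pow]
  have h2 : (2 : ℝ) ^ m ≤ 4 := by
    calc (2 : ℝ) ^ m ≤ 2 ^ 2 := by gcongr; norm_num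
      _ = 4 := by norm_num
  calc _ = 2 ^ m * (‖iteratedFDeriv ℝ m (A.th (k + 1) z) w‖ * A.r (k + 1) ^ m) := by ring
    _ ≤ 4 * Cth n := mul_le_mul h2 this (by positivity) (by norm_num)

theorem Bn_near (k : ℕ) (w : EuclideanSpace ℝ (Fin n)) : A.Bn k =ᶠ[nhds w]
    fun w' => ∑ z ∈ A.N (k + 1) w, A.th (k + 1) z w' • (ev (A.Pz (k + 1) z) w' - A.Fn k w') := by
  filter_upwards [A.N_nhds (k + 1) w] with w' h2
  unfold Bn
  exact A.sum_N h2 (fun z => ev (A.Pz (k + 1) z) w' - A.Fn k w')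

theorem DB_Bn (k : ℕ) (w : EuclideanSpace ℝ (Fin n)) :
    DB (A.Bn k) w (A.r k) (A.C2 * A.eps k w * A.r k) := by
  have hr := A.r_pos k
  have hC := Cth_one n
  have hC1 := A.C1_pos
  have hε := A.eps_nonneg k w
  have key : DB (fun w' => ∑ z ∈ A.N (k + 1) w, A.th (k + 1) z w' •
      (ev (A.Pz (k + 1) z) w' - A.Fn k w')) w (A.r k)
      (∑ z ∈ A.N (k + 1) w, 4 * ((4 * Cth n) * (A.C1 * A.eps k w * A.r k))) := by
    apply DB.sum _ hr.le
    · intro z _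
      exact (thetaS_contDiff _ _).smul ((ev_contDiff _).sub (A.Fn_contDiff k))
    · intro z hz
      exact DB.smul hr.le (thetaS_contDiff _ _) ((ev_contDiff _).sub (A.Fn_contDiff k))
        (A.DB_thetaS_succ k z w) (A.DB_diff hz)
  refine (key.congr (A.Bn_near k w)).mono ?_
  refine (A.card_mul_le (by positivity)).trans (le_of_eq ?_)
  unfold C2; ring

end Dat

open MeasureTheory Metric Set Filter
open scoped ENNReal NNReal

/-- Standard basis vectors. -/
noncomputable def eb {n : ℕ} (i : Fin n) : EuclideanSpace ℝ (Fin n) := EuclideanSpace.single i 1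

theorem eb_norm {n : ℕ} (i : Fin n) : ‖eb i‖ = 1 := by simp [eb]

/-- Dirichlet energy. -/
noncomputable def En {n d : ℕ} (f : EuclideanSpace ℝ (Fin n) → EuclideanSpace ℝ (Fin d)) : ℝ :=
  ∑ i, ∫ w, ‖fderiv ℝ f w (eb i)‖ ^ 2

section energy
variable {n d : ℕ}

theorem fderiv_apply_contDiff {f : EuclideanSpace ℝ (Fin n) → EuclideanSpace ℝ (Fin d)}
    (hf : ContDiff ℝ 2 f) (e : EuclideanSpace ℝ (Fin n)) :
    ContDiff ℝ 1 (fun w => fderiv ℝ f w e) := by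
  have : ContDiff ℝ 1 (fderiv ℝ f) := hf.fderiv_right (by norm_num)
  exact this.clm_apply contDiff_const

theorem fderiv_apply_supp {f : EuclideanSpace ℝ (Fin n) → EuclideanSpace ℝ (Fin d)}
    (hf : HasCompactSupport f) (e : EuclideanSpace ℝ (Fin n)) :
    HasCompactSupport (fun w => fderiv ℝ f w e) := by
  exact hf.fderiv_apply (𝕜 := ℝ) e

theorem fderiv2_norm {f : EuclideanSpace ℝ (Fin n) → EuclideanSpace ℝ (Fin d)}
    (hf : ContDiff ℝ 2 f) (i : Fin n) (w : EuclideanSpace ℝ (Fin n)) :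
    ‖fderiv ℝ (fun w => fderiv ℝ f w (eb i)) w (eb i)‖ ≤ ‖iteratedFDeriv ℝ 2 f w‖ := by
  have h1 : ContDiff ℝ 1 (fderiv ℝ f) := hf.fderiv_right (by norm_num)
  have h2 : DifferentiableAt ℝ (fderiv ℝ f) w := (h1.differentiable (by norm_num)) w
  have h3 : fderiv ℝ (fun w => fderiv ℝ f w (eb i)) w (eb i)
      = fderiv ℝ (fderiv ℝ f) w (eb i) (eb i) := by
    rw [fderiv_clm_apply h2 (differentiableAt_const _)]
    simp
  rw [h3, ← norm_iteratedFDeriv_fderiv, norm_iteratedFDeriv_one]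
  have h4 := (fderiv ℝ (fderiv ℝ f) w (eb i)).le_opNorm (eb i)
  have h5 := (fderiv ℝ (fderiv ℝ f) w).le_opNorm (eb i)
  rw [eb_norm, mul_one] at h4 h5
  exact h4.trans h5

theorem energy_step {F B : EuclideanSpace ℝ (Fin n) → EuclideanSpace ℝ (Fin d)}
    (hF : ContDiff ℝ 2 F) (hB : ContDiff ℝ 2 B) (hFs : HasCompactSupport F)
    (hBs : HasCompactSupport B) (φ : EuclideanSpace ℝ (Fin n) → ℝ) (hφ : Integrable φ)
    (hle : ∀ w i, ‖fderiv ℝ B w (eb i)‖ ^ 2 + 2 * (‖B w‖ * ‖iteratedFDeriv ℝ 2 F w‖) ≤ φ w) :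
    En (fun w => F w + B w) ≤ En F + n * ∫ w, φ w := by
  unfold En
  have hcard : (n : ℝ) * ∫ w, φ w = ∑ _i : Fin n, ∫ w, φ w := by simp
  rw [hcard, ← Finset.sum_add_distrib]
  apply Finset.sum_le_sum
  intro i _
  have cF := fderiv_apply_contDiff hF (eb i)
  have cB := fderiv_apply_contDiff hB (eb i)
  have sF := fderiv_apply_supp hFs (eb i)
  have sB := fderiv_apply_supp hBs (eb i)
  have cF2 : Continuous (fun w => fderiv ℝ (fun w => fderiv ℝ F w (eb i)) w (eb i)) :=
    ((cF.continuous_fderiv (by norm_num)).clm_apply continuous_const)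
  have iF : Integrable (fun w => ‖fderiv ℝ F w (eb i)‖ ^ 2) := by
    apply Continuous.integrable_of_hasCompactSupport
    · exact (cF.continuous.norm.pow 2)
    · exact sF.norm.comp_left (g := fun t : ℝ => t ^ 2) (by norm_num)
  have iB : Integrable (fun w => ‖fderiv ℝ B w (eb i)‖ ^ 2) := by
    apply Continuous.integrable_of_hasCompactSupport
    · exact (cB.continuous.norm.pow 2)
    · exact sB.norm.comp_left (g := fun t : ℝ => t ^ 2) (by norm_num)
  have iFB : Integrable (fun w => innerSL ℝ (fderiv ℝ F w (eb i)) (fderiv ℝ B w (eb i))) := by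
    apply Continuous.integrable_of_hasCompactSupport
    · simp only [innerSL_apply_apply]; exact cF.continuous.inner cB.continuous
    · apply sB.mono
      intro w hw
      simp only [Function.mem_support] at hw ⊢
      intro h; apply hw; rw [h]; simp
  have iFB2 : Integrable (fun w => innerSL ℝ
      (fderiv ℝ (fun w => fderiv ℝ F w (eb i)) w (eb i)) (B w)) := by
    apply Continuous.integrable_of_hasCompactSupport
    · simp only [innerSL_apply_apply]; exact cF2.inner hB.continuous
    · apply hBs.mono
      intro w hw
      simp only [Function.mem_support] at hw ⊢
      intro h; apply hw; rw [h]; simp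
  have iFB3 : Integrable (fun w => innerSL ℝ (fderiv ℝ F w (eb i)) (B w)) := by
    apply Continuous.integrable_of_hasCompactSupport
    · simp only [innerSL_apply_apply]; exact cF.continuous.inner hB.continuous
    · apply hBs.mono
      intro w hw
      simp only [Function.mem_support] at hw ⊢
      intro h; apply hw; rw [h]; simp
  have hparts := integral_bilinear_fderiv_right_eq_neg_left_of_integrable (μ := volume)
    (f := fun w => fderiv ℝ F w (eb i)) (g := B) (v := eb i) (B := innerSL ℝ) iFB2 iFB iFB3
    (fun w _ => (cF.differentiable (by norm_num)) w)
    (fun w _ => (hB.differentiable (by norm_num)) w)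
  have hexp : ∀ w, ‖fderiv ℝ (fun w => F w + B w) w (eb i)‖ ^ 2 = ‖fderiv ℝ F w (eb i)‖ ^ 2 +
      (‖fderiv ℝ B w (eb i)‖ ^ 2 + 2 * innerSL ℝ (fderiv ℝ F w (eb i)) (fderiv ℝ B w (eb i))) := by
    intro w
    rw [fderiv_fun_add ((hF.differentiable (by norm_num)) w) ((hB.differentiable (by norm_num)) w)]
    rw [add_apply, @norm_add_sq_real, innerSL_apply_apply]
    ring
  have hI : ∫ w, ‖fderiv ℝ (fun w => F w + B w) w (eb i)‖ ^ 2 = (∫ w, ‖fderiv ℝ F w (eb i)‖ ^ 2) +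
      ∫ w, (‖fderiv ℝ B w (eb i)‖ ^ 2 - 2 * innerSL ℝ
      (fderiv ℝ (fun w => fderiv ℝ F w (eb i)) w (eb i)) (B w)) := by
    simp_rw [hexp]
    have iX : Integrable (fun w => ‖fderiv ℝ B w (eb i)‖ ^ 2 +
        2 * innerSL ℝ (fderiv ℝ F w (eb i)) (fderiv ℝ B w (eb i))) := iB.add (iFB.const_mul 2)
    rw [integral_add iF iX, integral_add iB (iFB.const_mul 2),
      integral_const_mul, hparts, integral_sub iB (iFB2.const_mul 2), integral_const_mul]
    ring
  rw [hI]
  refine add_le_add le_rfl ?_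
  have iY : Integrable (fun w => ‖fderiv ℝ B w (eb i)‖ ^ 2 - 2 * innerSL ℝ
      (fderiv ℝ (fun w => fderiv ℝ F w (eb i)) w (eb i)) (B w)) := iB.sub (iFB2.const_mul 2)
  refine integral_mono iY hφ ?_
  intro w
  refine le_trans ?_ (hle w i)
  simp only
  have h1 := abs_real_inner_le_norm (fderiv ℝ (fun w => fderiv ℝ F w (eb i)) w (eb i)) (B w)
  have h2 := fderiv2_norm hF i w
  have h3 : ‖fderiv ℝ (fun w => fderiv ℝ F w (eb i)) w (eb i)‖ * ‖B w‖ ≤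
    ‖iteratedFDeriv ℝ 2 F w‖ * ‖B w‖ := by gcongr
  have h4 := neg_abs_le (inner ℝ (fderiv ℝ (fun w => fderiv ℝ F w (eb i)) w (eb i)) (B w))
  rw [innerSL_apply_apply]
  linarith

end energy

theorem lint_superadd {α ι : Type*} [MeasurableSpace α] (μ : Measure α) (s : Finset ι)
    (f : ι → α → ℝ≥0∞) : ∑ i ∈ s, ∫⁻ x, f i x ∂μ ≤ ∫⁻ x, ∑ i ∈ s, f i x ∂μ := by
  classical
  induction s using Finset.induction_on with
  | empty => simp
  | insert a s ha ih =>
    simp only [Finset.sum_insert ha]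
    refine (add_le_add_right ih _).trans ?_
    exact le_lintegral_add (f a) (fun x => ∑ i ∈ s, f i x)

namespace Dat
variable {n d : ℕ} (A : Dat n d)

theorem th_supp (k : ℕ) (z : Fin n → ℤ) : HasCompactSupport (A.th k z) := by
  have hr := A.r_pos k
  apply HasCompactSupport.intro (isCompact_closedBall (A.r k • zv z) (n * A.r k))
  intro w hw
  apply thetaS_eq_zero
  by_contra hcon
  push Not at hcon
  apply hw
  rw [mem_closedBall, dist_eq_norm]
  apply norm_le_of_coord
  intro i
  have h1 := hcon i
  have h2 : (w - A.r k • zv z) i = A.r k * ((A.r k)⁻¹ * w i - zv z i) := by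
    simp; field_simp
  rw [h2, abs_mul, abs_of_pos hr]
  nlinarith

theorem Bn_supp (k : ℕ) : HasCompactSupport (A.Bn k) := by
  have : A.Bn k = ∑ z ∈ A.Gd (k + 1), fun w => A.th (k + 1) z w •
      (ev (A.Pz (k + 1) z) w - A.Fn k w) := by
    ext1 w; simp [Bn]
  rw [this]
  refine Finset.sum_induction _ HasCompactSupport (fun f g hf hg => hf.add hg) ?_ ?_
  · exact HasCompactSupport.zero
  · intro z _
    exact (A.th_supp (k + 1) z).smul_right

theorem Fn_supp (k : ℕ) : HasCompactSupport (A.Fn k) := by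
  induction k with
  | zero => exact HasCompactSupport.zero
  | succ k ih => rw [Fn_succ]; exact ih.add (A.Bn_supp k)

/-- Volume of the unit ball. -/
noncomputable def Vn (n : ℕ) : ℝ := volume.real (ball (0 : EuclideanSpace ℝ (Fin n)) 1)

/-- The weighted sum of the flatness coefficients at a level. -/
noncomputable def bsum (k : ℕ) : ℝ := ∑ z ∈ A.Gd k, A.bz k z * A.r k ^ n

theorem bsum_nonneg (k : ℕ) : 0 ≤ A.bsum k := by
  have := A.r_pos k
  apply Finset.sum_nonneg
  intro z _
  have := A.bz_pos k z
  positivity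

theorem S_sub (k : ℕ) (z : Fin n → ℤ) : {w | A.S k z w} ⊆ closedBall (A.r k • zv z) (n * A.r k) := by
  intro w hw
  have hr := A.r_pos k
  rw [mem_closedBall, dist_eq_norm]
  apply norm_le_of_coord
  intro i
  have h1 : |(A.r k)⁻¹ * w i - zv z i| ≤ 1 := hw i
  have h2 : (w - A.r k • zv z) i = A.r k * ((A.r k)⁻¹ * w i - zv z i) := by
    simp; field_simp
  rw [h2, abs_mul, abs_of_pos hr]
  nlinarith

theorem S_meas (k : ℕ) (z : Fin n → ℤ) : MeasurableSet {w | A.S k z w} := by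
  have : {w | A.S k z w} = ⋂ i, {w : EuclideanSpace ℝ (Fin n) | |(A.r k)⁻¹ * w i - z i| ≤ 1} := by
    ext w; simp [S]
  rw [this]
  apply MeasurableSet.iInter
  intro i
  apply IsClosed.measurableSet
  apply isClosed_le _ continuous_const
  fun_prop

theorem bs_eq (k : ℕ) : A.bs k = fun w => ∑ z ∈ A.Gd k, {w | A.S k z w}.indicator (fun _ => A.bz k z) w := by
  classical
  ext w
  unfold bs N
  rw [Finset.sum_filter]
  apply Finset.sum_congr rfl
  intro z _
  by_cases h : A.S k z w
  · simp [h]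
  · simp [h]

theorem vol_cell (k : ℕ) (z : Fin n → ℤ) : volume {w | A.S k z w} < ⊤ :=
  lt_of_le_of_lt (measure_mono (A.S_sub k z)) measure_closedBall_lt_top

theorem bs_integrable (k : ℕ) : Integrable (A.bs k) := by
  rw [bs_eq]
  apply integrable_finsetSum
  intro z _
  exact (integrable_indicator_iff (A.S_meas k z)).2 (integrableOn_const (A.vol_cell k z).ne)

theorem bs_integral (k : ℕ) : ∫ w, A.bs k w ≤ Vn n * n ^ n * A.bsum k := by
  have hr := A.r_pos k
  rw [bs_eq, integral_finsetSum]
  · unfold bsum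
    rw [Finset.mul_sum]
    apply Finset.sum_le_sum
    intro z _
    rw [integral_indicator (A.S_meas k z), setIntegral_const, smul_eq_mul]
    have h1 : volume.real {w | A.S k z w} ≤ (n * A.r k) ^ n * Vn n := by
      refine (measureReal_mono (A.S_sub k z) measure_closedBall_lt_top.ne).trans (le_of_eq ?_)
      rw [Measure.addHaar_real_closedBall _ _ (by positivity)]
      simp [Vn]
    have := A.bz_pos k z
    calc _ ≤ (n * A.r k) ^ n * Vn n * A.bz k z := by gcongr
      _ = _ := by rw [mul_pow]; ring
  · intro z _
    exact (integrable_indicator_iff (A.S_meas k z)).2 (integrableOn_const (A.vol_cell k z).ne)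

/-- Energy constant. -/
noncomputable def C3 : ℝ := n * ((A.C2 ^ 2 + 2 * (A.C2 * A.C1)) * (Vn n * n ^ n))

theorem Bn_D2 (k : ℕ) (w : EuclideanSpace ℝ (Fin n)) (hw : (A.N (k + 1) w).Nonempty) :
    ‖iteratedFDeriv ℝ 2 (A.Fn k) w‖ * A.r k ≤ A.C1 * A.eps k w := by
  obtain ⟨z, hz⟩ := hw
  have hr := A.r_pos k
  have h1 := A.DB_diff hz 2 le_rfl
  have h2 : iteratedFDeriv ℝ 2 (fun w => ev (A.Pz (k + 1) z) w - A.Fn k w) w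
      = - iteratedFDeriv ℝ 2 (A.Fn k) w := by
    change iteratedFDeriv ℝ 2 (ev (A.Pz (k + 1) z) - A.Fn k) w = _
    rw [iteratedFDeriv_sub_apply (ev_contDiff _).contDiffAt (A.Fn_contDiff k).contDiffAt]
    have h3 : ‖iteratedFDeriv ℝ 2 (ev (A.Pz (k + 1) z)) w‖ = 0 := by
      have hfd : fderiv ℝ (ev (A.Pz (k + 1) z)) = fun _ => (A.Pz (k + 1) z).2 := by
        ext1 x
        unfold ev
        rw [fderiv_const_add]
        exact (A.Pz (k + 1) z).2.fderiv
      rw [← norm_iteratedFDeriv_fderiv, hfd, norm_iteratedFDeriv_one]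
      simp
    rw [norm_eq_zero] at h3
    rw [h3, zero_sub]
  rw [h2, norm_neg] at h1
  have : ‖iteratedFDeriv ℝ 2 (A.Fn k) w‖ * A.r k * A.r k ≤ A.C1 * A.eps k w * A.r k := by
    linarith
  exact le_of_mul_le_mul_right this hr

theorem energy_succ (k : ℕ) : En (A.Fn (k + 1)) ≤ En (A.Fn k) + A.C3 * (A.bsum k + A.bsum (k + 1)) := by
  have hC1 := A.C1_pos
  have hC2 := A.C2_pos
  have hr := A.r_pos k
  have h := energy_step (A.Fn_contDiff k) (A.Bn_contDiff k) (A.Fn_supp k) (A.Bn_supp k)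
    (fun w => (A.C2 ^ 2 + 2 * (A.C2 * A.C1)) * (A.bs k w + A.bs (k + 1) w))
    (((A.bs_integrable k).add (A.bs_integrable (k + 1))).const_mul _)
    (by
      intro w i
      have hε := A.eps_nonneg k w
      have hε2 : A.eps k w ^ 2 = A.bs k w + A.bs (k + 1) w :=
        Real.sq_sqrt (add_nonneg (A.bs_nonneg _ _) (A.bs_nonneg _ _))
      rw [← hε2]
      have hd1 := A.DB_Bn k w 1 (by norm_num)
      have hd0 := A.DB_Bn k w 0 (by norm_num)
      rw [norm_iteratedFDeriv_one] at hd1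
      rw [norm_iteratedFDeriv_zero, pow_zero, mul_one] at hd0
      rw [pow_one] at hd1
      have hd1' := le_of_mul_le_mul_right hd1 hr
      have hd2 : ‖fderiv ℝ (A.Bn k) w (eb i)‖ ≤ A.C2 * A.eps k w := by
        refine ((fderiv ℝ (A.Bn k) w).le_opNorm _).trans ?_
        rw [eb_norm, mul_one]; exact hd1'
      have hd3 : ‖fderiv ℝ (A.Bn k) w (eb i)‖ ^ 2 ≤ (A.C2 * A.eps k w) ^ 2 := by gcongr
      have hd4 : ‖A.Bn k w‖ * ‖iteratedFDeriv ℝ 2 (A.Fn k) w‖ ≤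
          (A.C2 * A.eps k w) * (A.C1 * A.eps k w) := by
        rcases (A.N (k + 1) w).eq_empty_or_nonempty with he | hne
        · have : A.Bn k w = 0 := by
            have := (A.Bn_near k w).eq_of_nhds
            rw [this, he]; simp
          rw [this]; simp; positivity
        · calc _ ≤ (A.C2 * A.eps k w * A.r k) * ‖iteratedFDeriv ℝ 2 (A.Fn k) w‖ := by gcongr
            _ = (A.C2 * A.eps k w) * (‖iteratedFDeriv ℝ 2 (A.Fn k) w‖ * A.r k) := by ring
            _ ≤ _ := mul_le_mul_of_nonneg_left (A.Bn_D2 k w hne) (by positivity)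
      nlinarith)
  rw [Fn_succ]
  refine h.trans ?_
  refine add_le_add le_rfl ?_
  rw [integral_const_mul, integral_add (A.bs_integrable k) (A.bs_integrable (k + 1))]
  unfold C3
  have h1 := A.bs_integral k
  have h2 := A.bs_integral (k + 1)
  calc _ ≤ (n : ℝ) * ((A.C2 ^ 2 + 2 * (A.C2 * A.C1)) * (Vn n * n ^ n * A.bsum k +
        Vn n * n ^ n * A.bsum (k + 1))) := by gcongr
    _ = _ := by ring

theorem C3_nonneg : 0 ≤ A.C3 := by
  have hC1 := A.C1_pos
  have hC2 := A.C2_pos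
  have : 0 ≤ Vn n := measureReal_nonneg
  unfold C3; positivity

theorem energy_le (K : ℕ) : En (A.Fn K) ≤ 2 * A.C3 * ∑ k ∈ Finset.range (K + 1), A.bsum k := by
  have hC := A.C3_nonneg
  have hstrong : En (A.Fn K) + A.C3 * A.bsum K ≤ 2 * A.C3 * ∑ k ∈ Finset.range (K + 1), A.bsum k := by
    induction K with
    | zero =>
      have : En (A.Fn 0) = 0 := by simp [En, Fn]
      rw [this]
      simp only [zero_add, Finset.range_one, Finset.sum_singleton]
      have := mul_nonneg hC (A.bsum_nonneg 0)
      linarith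
    | succ k ih =>
      rw [Finset.sum_range_succ]
      have := A.energy_succ k
      linarith
  have := mul_nonneg hC (A.bsum_nonneg K)
  linarith

theorem q_coord {x x' : EuclideanSpace ℝ (Fin d)} (i : Fin n) : |A.q x i - A.q x' i| ≤ dist x x' :=
  (coord_le_norm (A.q x - A.q x') i).trans (A.q_le x x')

theorem bsum_le (k : ℕ) : ENNReal.ofReal (A.bsum k) ≤
    ENNReal.ofReal (11 ^ n * A.τ⁻¹) * ∫⁻ x in closedBall A.x0 (2 * A.r0), A.g k x ∂A.σ := by
  classical
  have := A.fin
  have hτ := A.τ_pos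
  have hr := A.r_pos k
  unfold bsum
  rw [ENNReal.ofReal_sum_of_nonneg (fun z _ => by have := A.bz_pos k z; positivity)]
  set ν := A.σ.restrict (closedBall A.x0 (2 * A.r0)) with hν
  have step1 : ∀ z ∈ A.Gd k, ENNReal.ofReal (A.bz k z * A.r k ^ n) ≤
      ENNReal.ofReal A.τ⁻¹ * ∫⁻ x, (closedBall (A.X k z) (A.r k)).indicator (A.g k) x ∂ν := by
    intro z hz
    have hX := (A.X_spec hz).1
    have hD := (A.mem_spec hX).1
    have hsub : closedBall (A.X k z) (A.r k) ⊆ closedBall A.x0 (2 * A.r0) := by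
      apply closedBall_subset_closedBall'
      have h1 := A.hB0 hX.1
      rw [mem_closedBall] at h1
      have := A.r_le k
      have := A.hr0
      linarith
    rw [lintegral_indicator measurableSet_closedBall, hν,
      Measure.restrict_restrict measurableSet_closedBall, inter_eq_left.2 hsub]
    have h2 : ∫⁻ _x in closedBall (A.X k z) (A.r k), ENNReal.ofReal (A.bz k z) ∂A.σ ≤
        ∫⁻ x in closedBall (A.X k z) (A.r k), A.g k x ∂A.σ := by
      apply setLIntegral_mono' measurableSet_closedBall
      intro x hx
      exact A.hg1 _ hX.1 k hD x hx
    rw [setLIntegral_const, ← ofReal_measureReal, ← ENNReal.ofReal_mul (A.bz_pos k z).le] at h2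
    refine le_trans ?_ (mul_le_mul_right h2 _)
    rw [← ENNReal.ofReal_mul (by positivity)]
    apply ENNReal.ofReal_le_ofReal
    unfold D at hD
    have := A.bz_pos k z
    calc A.bz k z * A.r k ^ n = A.τ⁻¹ * (A.bz k z * (A.τ * A.r k ^ n)) := by field_simp
      _ ≤ _ := by gcongr
  calc _ ≤ ∑ z ∈ A.Gd k, ENNReal.ofReal A.τ⁻¹ *
        ∫⁻ x, (closedBall (A.X k z) (A.r k)).indicator (A.g k) x ∂ν := Finset.sum_le_sum step1
    _ = ENNReal.ofReal A.τ⁻¹ * ∑ z ∈ A.Gd k,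
        ∫⁻ x, (closedBall (A.X k z) (A.r k)).indicator (A.g k) x ∂ν := by rw [Finset.mul_sum]
    _ ≤ ENNReal.ofReal A.τ⁻¹ * ∫⁻ x, ∑ z ∈ A.Gd k,
        (closedBall (A.X k z) (A.r k)).indicator (A.g k) x ∂ν := by
        gcongr; exact lint_superadd _ _ _
    _ ≤ ENNReal.ofReal A.τ⁻¹ * ∫⁻ x, 11 ^ n * A.g k x ∂ν := by
        gcongr with x
        have h1 : ∑ z ∈ A.Gd k, (closedBall (A.X k z) (A.r k)).indicator (A.g k) x =
          ((A.Gd k).filter (fun z => x ∈ closedBall (A.X k z) (A.r k))).card * A.g k x := by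
          rw [← nsmul_eq_mul, ← Finset.sum_const, Finset.sum_filter]
          apply Finset.sum_congr rfl
          intro z _
          simp only [indicator]
        rw [h1]
        gcongr
        have h2 : ((A.Gd k).filter (fun z => x ∈ closedBall (A.X k z) (A.r k))).card ≤
          (2 * 5 + 1) ^ n := by
          apply card_near (fun i => (A.r k)⁻¹ * A.q x i)
          intro z hz i
          rw [Finset.mem_filter] at hz
          have h3 := (A.X_spec hz.1).2 i
          have h4 := hz.2
          rw [mem_closedBall] at h4
          have h5 := (A.q_coord (x := x) (x' := A.X k z) i).trans h4
          have h6 : |(A.r k)⁻¹ * (A.q x i - A.q (A.X k z) i)| ≤ 1 := by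
            rw [abs_mul, abs_of_pos (inv_pos.2 hr), inv_mul_le_iff₀ hr]
            linarith
          have h7 : (A.r k)⁻¹ * A.q x i - z i = (A.r k)⁻¹ * (A.q x i - A.q (A.X k z) i) +
            ((A.r k)⁻¹ * A.q (A.X k z) i - z i) := by ring
          rw [h7]
          refine (abs_add_le _ _).trans ?_
          push_cast
          linarith
        exact_mod_cast h2
    _ = _ := by
        rw [lintegral_const_mul' _ _ (by finiteness), ← mul_assoc, mul_comm (11 ^ n : ℝ) A.τ⁻¹,
          ENNReal.ofReal_mul (by positivity), ENNReal.ofReal_pow (by norm_num)]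
        norm_num

/-- Total bound on the flatness sums. -/
theorem bsum_total (K : ℕ) : ∑ k ∈ Finset.range K, A.bsum k ≤
    11 ^ n * A.τ⁻¹ * (A.C0 * 2 ^ n) * (A.η * A.r0 ^ n) := by
  have := A.fin
  have hτ := A.τ_pos
  have hη := A.hη
  have hC0 := A.hC0
  have hr0 := A.hr0
  have key : ENNReal.ofReal (∑ k ∈ Finset.range K, A.bsum k) ≤
      ENNReal.ofReal (11 ^ n * A.τ⁻¹ * (A.C0 * 2 ^ n) * (A.η * A.r0 ^ n)) := by
    rw [ENNReal.ofReal_sum_of_nonneg (fun k _ => A.bsum_nonneg k)]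
    calc _ ≤ ∑ k ∈ Finset.range K, ENNReal.ofReal (11 ^ n * A.τ⁻¹) *
          ∫⁻ x in closedBall A.x0 (2 * A.r0), A.g k x ∂A.σ :=
          Finset.sum_le_sum fun k _ => A.bsum_le k
      _ = ENNReal.ofReal (11 ^ n * A.τ⁻¹) * ∑ k ∈ Finset.range K,
          ∫⁻ x in closedBall A.x0 (2 * A.r0), A.g k x ∂A.σ := by rw [Finset.mul_sum]
      _ ≤ ENNReal.ofReal (11 ^ n * A.τ⁻¹) *
          ∫⁻ x in closedBall A.x0 (2 * A.r0), ∑ k ∈ Finset.range K, A.g k x ∂A.σ := by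
          gcongr; exact lint_superadd _ _ _
      _ ≤ ENNReal.ofReal (11 ^ n * A.τ⁻¹) *
          ∫⁻ _x in closedBall A.x0 (2 * A.r0), ENNReal.ofReal A.η ∂A.σ := by
          refine mul_le_mul_right ?_ _
          apply lintegral_mono_ae
          filter_upwards [ae_restrict_of_ae A.hg2] with x hx
          exact (ENNReal.sum_le_tsum _).trans hx
      _ ≤ _ := by
          rw [setLIntegral_const, ← ofReal_measureReal, ← ENNReal.ofReal_mul hη.le,
            ← ENNReal.ofReal_mul (by positivity)]
          apply ENNReal.ofReal_le_ofReal
          have h1 := A.hreg A.x0 (2 * A.r0) (by positivity)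
          rw [mul_pow] at h1
          calc _ ≤ 11 ^ n * A.τ⁻¹ * (A.η * (A.C0 * (2 ^ n * A.r0 ^ n))) := by gcongr
            _ = _ := by ring
  exact (ENNReal.ofReal_le_ofReal_iff (by positivity)).1 key

end Dat

open MeasureTheory Metric Set Filter
open scoped ENNReal NNReal

namespace Dat
variable {n d : ℕ} (A : Dat n d)

theorem r_anti {k l : ℕ} (h : k ≤ l) : A.r l ≤ A.r k := by
  have := A.hr0
  unfold r
  gcongr
  norm_num

theorem ld0 : A.σ {x ∈ A.B0 | ¬ A.D x 0} ≤ ENNReal.ofReal (A.τ * A.r0 ^ n) := by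
  have := A.fin
  rcases {x ∈ A.B0 | ¬ A.D x 0}.eq_empty_or_nonempty with he | ⟨x, hx⟩
  · rw [he]; simp
  · have h1 : {x ∈ A.B0 | ¬ A.D x 0} ⊆ closedBall x A.r0 := by
      intro y hy
      have a1 := A.hB0 hx.1
      have a2 := A.hB0 hy.1
      rw [mem_closedBall] at a1 a2 ⊢
      have := dist_triangle_right y x A.x0
      linarith
    refine (measure_mono h1).trans ?_
    rw [← ofReal_measureReal]
    apply ENNReal.ofReal_le_ofReal
    have := hx.2
    unfold D at this
    rw [r_zero] at this
    linarith

theorem cone_sep {x x' : EuclideanSpace ℝ (Fin d)} {k k' : ℕ} (hx : x ∈ A.E k) (hx' : x' ∈ A.E k')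
    (h1 : A.r k + A.r k' ≤ 10 * dist x x') :
    7 / 10 * dist x x' ≤ ‖A.q x - A.q x'‖ := by
  have hr := A.r_pos k
  have hr' := A.r_pos k'
  rcases le_total k k' with h | h
  · exact A.cone hx hx' h (by linarith)
  · rw [dist_comm, norm_sub_rev]
    exact A.cone hx' hx h (by rw [dist_comm]; linarith)

theorem ld : A.σ {x | ∃ k, x ∈ A.E k ∧ ¬ A.D x (k + 1)} ≤
    ENNReal.ofReal (A.τ * 5 ^ n) * ENNReal.ofReal (2 ^ n * A.r0 ^ n) := by
  classical
  have := A.fin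
  have hτ := A.τ_pos
  have hr0 := A.hr0
  have hch : ∀ x : EuclideanSpace ℝ (Fin d), ∃ k, x ∈ {x | ∃ k, x ∈ A.E k ∧ ¬ A.D x (k + 1)} →
      x ∈ A.E k ∧ ¬ A.D x (k + 1) := by
    intro x
    by_cases h : x ∈ {x | ∃ k, x ∈ A.E k ∧ ¬ A.D x (k + 1)}
    · obtain ⟨k, hk⟩ := h
      exact ⟨k, fun _ => hk⟩
    · exact ⟨0, fun h' => absurd h' h⟩
  choose κ hκ using hch
  apply vitali_bound (n := n) A.σ _ (fun x => A.r (κ x + 1) / 5) A.r0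
  · intro x hx
    have h1 := A.r_pos (κ x + 1)
    have h2 := A.r_le (κ x + 1)
    exact ⟨by positivity, by linarith⟩
  · intro x hx
    have h1 := A.r_pos (κ x + 1)
    have h := (hκ x hx).2
    unfold D at h
    rw [← ENNReal.ofReal_mul (by positivity), ← ofReal_measureReal]
    apply ENNReal.ofReal_le_ofReal
    have e1 : 5 * (A.r (κ x + 1) / 5) = A.r (κ x + 1) := by ring
    have e2 : A.τ * 5 ^ n * (A.r (κ x + 1) / 5) ^ n = A.τ * A.r (κ x + 1) ^ n := by
      rw [div_pow]; field_simp
    rw [e1, e2]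
    linarith
  · intro F hF hdis
    have hpos : ∀ x : EuclideanSpace ℝ (Fin d), 0 < A.r (κ x + 1) := fun x => A.r_pos _
    rw [← ENNReal.ofReal_sum_of_nonneg (fun x _ => by have := hpos x; positivity)]
    apply ENNReal.ofReal_le_ofReal
    have hp := packing A.hn F A.q (fun x => A.r (κ x + 1) / 10) (fun x _ => by
      have := hpos x; positivity) (A.q A.x0) A.r0 hr0.le ?_ ?_
    · have : ∑ x ∈ F, (A.r (κ x + 1) / 5) ^ n = 2 ^ n * ∑ x ∈ F, (A.r (κ x + 1) / 10) ^ n := by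
        rw [Finset.mul_sum]
        refine Finset.sum_congr rfl fun x _ => ?_
        rw [← mul_pow]; congr 1; ring
      rw [this]
      gcongr
    · intro x hx x' hx' hne
      have h1 := hdis hx hx' hne
      simp only [Function.onFun] at h1 ⊢
      have px := hpos x
      have px' := hpos x'
      rw [disjoint_closedBall_closedBall_iff (by positivity) (by positivity)] at h1
      have s1 := A.r_succ (κ x)
      have s2 := A.r_succ (κ x')
      have h2 := A.cone_sep (hκ x (hF hx)).1 (hκ x' (hF hx')).1 (by linarith)
      apply ball_disjoint_ball
      rw [dist_eq_norm]
      linarith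
    · intro x hx
      apply ball_subset_closedBall.trans
      apply closedBall_subset_closedBall'
      rw [dist_eq_norm]
      have h1 := A.q_le x A.x0
      have h2 := A.hB0 (hκ x (hF hx)).1.1
      rw [mem_closedBall] at h2
      have h3 := A.r_le (κ x + 1)
      linarith

theorem far0 : A.σ {x ∈ A.B0 | A.D x 0 ∧ A.r 0 / 300 < ‖A.h x - ev (A.Pm x 0) (A.q x)‖} ≤
    ENNReal.ofReal (360000 * (A.η * A.r0 ^ n)) := by
  have := A.fin
  have hr0 := A.hr0
  rcases {x ∈ A.B0 | A.D x 0 ∧ A.r 0 / 300 <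
    ‖A.h x - ev (A.Pm x 0) (A.q x)‖}.eq_empty_or_nonempty with he | ⟨x, hx⟩
  · rw [he]; simp
  · have h1 := A.plane0 x hx.1 (1 / 300) (by norm_num)
    have hM := A.M_ge
    have h2 : {x ∈ A.B0 | A.D x 0 ∧ A.r 0 / 300 < ‖A.h x - ev (A.Pm x 0) (A.q x)‖} ⊆
        {y ∈ closedBall x (A.M * A.r0) | 1 / 300 * A.r0 <
          ‖hm A.ι A.p0 y - ev 0 (qm A.ι A.p0 y)‖} := by
      intro y hy
      refine ⟨?_, ?_⟩
      · have a1 := A.hB0 hx.1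
        have a2 := A.hB0 hy.1
        rw [mem_closedBall] at a1 a2 ⊢
        have := dist_triangle_right y x A.x0
        nlinarith
      · have := hy.2.2
        have e : A.Pm y 0 = 0 := by simp [Pm]
        rw [e, r_zero] at this
        have e2 : 1 / 300 * A.r0 = A.r0 / 300 := by ring
        rw [e2]
        exact this
    refine (measure_mono h2).trans ?_
    rw [← ofReal_measureReal]
    apply ENNReal.ofReal_le_ofReal
    refine h1.trans ?_
    have hb := A.b_le hx.1 hx.2.1
    calc _ = 360000 * (A.b x 0 * A.r0 ^ n) := by ring
      _ ≤ _ := by gcongr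

theorem exists_N {x : EuclideanSpace ℝ (Fin d)} {k : ℕ} (hx : x ∈ A.E k) :
    ∃ z, z ∈ A.N k (A.q x) := by
  refine ⟨fun i => ⌊(A.r k)⁻¹ * A.q x i⌋, ?_⟩
  have h1 : ∀ i, |(A.r k)⁻¹ * A.q x i - (⌊(A.r k)⁻¹ * A.q x i⌋ : ℤ)| ≤ 1 := by
    intro i
    rw [abs_le]
    have a := Int.floor_le ((A.r k)⁻¹ * A.q x i)
    have b := Int.lt_floor_add_one ((A.r k)⁻¹ * A.q x i)
    constructor <;> linarith
  rw [A.mem_N, A.mem_Gd]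
  exact ⟨⟨x, hx, fun i => (h1 i).trans (by norm_num)⟩, h1⟩

theorem far (hη3 : A.Λ * √(A.η + A.η) ≤ 1 / 600) :
    A.σ {x | ∃ k, x ∈ A.E k ∧ A.D x (k + 1) ∧ A.HasP x (k + 1) ∧
      A.r (k + 1) / 300 < ‖A.h x - ev (A.Pm x (k + 1)) (A.q x)‖} ≤
    ENNReal.ofReal (5760000 * (11 ^ n * A.τ⁻¹ * (A.C0 * 2 ^ n) * (A.η * A.r0 ^ n))) := by
  have := A.fin
  have hM := A.M_ge
  set T : ℕ → (Fin n → ℤ) → Set (EuclideanSpace ℝ (Fin d)) := fun k z =>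
    {y ∈ closedBall (A.X k z) (A.M * A.r k) | 1 / 1200 * A.r k <
          ‖hm A.ι A.p0 y - ev (A.Pz k z) (qm A.ι A.p0 y)‖} with hT
  have hsub : {x | ∃ k, x ∈ A.E k ∧ A.D x (k + 1) ∧ A.HasP x (k + 1) ∧
      A.r (k + 1) / 300 < ‖A.h x - ev (A.Pm x (k + 1)) (A.q x)‖} ⊆
      ⋃ k, ⋃ z ∈ A.Gd k, T k z := by
    rintro x ⟨k, hxE, hD, hP, hF⟩
    obtain ⟨z, hz⟩ := A.exists_N hxE
    have hzG := (A.mem_N.1 hz).1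
    simp only [mem_iUnion]
    refine ⟨k, z, hzG, ?_⟩
    have hr := A.r_pos k
    have hrs := A.r_succ k
    have hX := (A.X_spec hzG).1
    have hq := A.S_dist' hz
    have hn := A.n_one
    have hdist : dist x (A.X k z) ≤ 10 / 7 * (n * (5 * A.r k)) :=
      A.dist_le_of_q hxE hX le_rfl hq (by nlinarith)
    have hMn := A.hM
    have hd2 : dist x (A.X k z) ≤ (A.M - 1) * A.r k := by
      refine hdist.trans ?_
      have : 10 / 7 * (n * 5) ≤ A.M - 1 := by linarith
      calc _ = 10 / 7 * (n * 5) * A.r k := by ring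
        _ ≤ _ := by gcongr
    have hc := (A.compare' hX hxE.1 hD hP (Or.inr rfl) (by rw [dist_comm]; exact hd2)).2
    have hs : A.Λ * √(A.b (A.X k z) k + A.b x (k + 1)) ≤ 1 / 600 := by
      refine le_trans ?_ hη3
      have := A.Λ_pos
      have h1 : √(A.b (A.X k z) k + A.b x (k + 1)) ≤ √(A.η + A.η) :=
        Real.sqrt_le_sqrt (add_le_add (A.mem_spec hX).2.2.2.2 (A.b_le hxE.1 hD))
      gcongr
    have hr1 := A.r_pos (k + 1)
    have hc2 : ‖ev (A.Pm (A.X k z) k - A.Pm x (k + 1)) (A.q x)‖ ≤ 1 / 600 * A.r (k + 1) :=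
      hc.trans (by gcongr)
    refine ⟨?_, ?_⟩
    · rw [mem_closedBall]; nlinarith
    · change 1 / 1200 * A.r k < ‖A.h x - ev (A.Pm (A.X k z) k) (A.q x)‖
      have e : A.h x - ev (A.Pm x (k + 1)) (A.q x) = (A.h x - ev (A.Pm (A.X k z) k) (A.q x)) +
        ev (A.Pm (A.X k z) k - A.Pm x (k + 1)) (A.q x) := by rw [ev_sub]; abel
      rw [e] at hF
      have := norm_add_le (A.h x - ev (A.Pm (A.X k z) k) (A.q x))
        (ev (A.Pm (A.X k z) k - A.Pm x (k + 1)) (A.q x))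
      linarith
  refine (measure_mono hsub).trans ((measure_iUnion_le _).trans ?_)
  have hTle : ∀ k, A.σ (⋃ z ∈ A.Gd k, T k z) ≤ ENNReal.ofReal (5760000 * A.bsum k) := by
    intro k
    refine (measure_biUnion_finset_le _ _).trans ?_
    have hr := A.r_pos k
    have h1 : ∀ z ∈ A.Gd k, A.σ (T k z) ≤ ENNReal.ofReal (5760000 * (A.bz k z * A.r k ^ n)) := by
      intro z hz
      have h2 := (A.mem_spec (A.X_spec hz).1).2.2.1 (1 / 1200) (by norm_num)
      rw [← ofReal_measureReal]
      apply ENNReal.ofReal_le_ofReal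
      refine h2.trans (le_of_eq ?_)
      unfold bz
      ring
    refine (Finset.sum_le_sum h1).trans ?_
    rw [← ENNReal.ofReal_sum_of_nonneg (fun z _ => by have := A.bz_pos k z; positivity),
      ← Finset.mul_sum]
    rfl
  refine (ENNReal.tsum_le_tsum hTle).trans ?_
  refine ENNReal.tsum_le_of_sum_range_le fun K => ?_
  rw [← ENNReal.ofReal_sum_of_nonneg (fun k _ => mul_nonneg (by norm_num) (A.bsum_nonneg k)),
    ← Finset.mul_sum]
  apply ENNReal.ofReal_le_ofReal
  have := A.bsum_total K
  gcongr

end Dat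

open MeasureTheory Metric Set Filter

/-- Total mass of the partition function. -/
noncomputable def cn (n : ℕ) : ℝ := ∫ w, theta n w

theorem cn_pos (n : ℕ) : 0 < cn n := by
  apply Continuous.integral_pos_of_hasCompactSupport_nonneg_nonzero (theta_contDiff n).continuous
    (theta_hasCompactSupport n) (fun w => theta_nonneg w) (x := 0)
  simp [theta, chi]

theorem thetaS_supp {n : ℕ} {r : ℝ} (hr : 0 < r) (v : EuclideanSpace ℝ (Fin n)) :
    HasCompactSupport (thetaS r v) := by
  apply HasCompactSupport.intro (isCompact_closedBall (r • v) (n * r))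
  intro w hw
  apply thetaS_eq_zero
  by_contra hcon
  push Not at hcon
  apply hw
  rw [mem_closedBall, dist_eq_norm]
  apply norm_le_of_coord
  intro i
  have h1 := (hcon i).le
  have e : (w - r • v) i = r * (r⁻¹ * w i - v i) := by
    simp; field_simp
  rw [e, abs_mul, abs_of_pos hr]
  nlinarith

theorem thetaS_integral {n : ℕ} {r : ℝ} (hr : 0 < r) (v : EuclideanSpace ℝ (Fin n)) :
    ∫ w, thetaS r v w = r ^ n * cn n := by
  unfold thetaS cn
  have h := Measure.integral_comp_smul (volume : Measure (EuclideanSpace ℝ (Fin n)))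
    (fun u => theta n (u - v)) r⁻¹
  rw [h, integral_sub_right_eq_self (fun u => theta n u) v]
  simp [abs_of_pos hr]

theorem thetaS_fderiv {n : ℕ} {r : ℝ} (hr : 0 < r) (v w : EuclideanSpace ℝ (Fin n)) (i : Fin n) :
    |fderiv ℝ (thetaS r v) w (eb i)| ≤ Cth n / r := by
  have h := DB_thetaS r hr v w 1 (by norm_num)
  rw [norm_iteratedFDeriv_one, pow_one] at h
  rw [le_div_iff₀ hr]
  refine le_trans ?_ h
  gcongr
  have := (fderiv ℝ (thetaS r v) w).le_opNorm (eb i)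
  rwa [eb_norm, mul_one, Real.norm_eq_abs] at this

theorem exists_coord {n d : ℕ} (hn : 0 < n)
    (T : EuclideanSpace ℝ (Fin n) →L[ℝ] EuclideanSpace ℝ (Fin d)) (hT : 1 / 8 < ‖T‖) :
    ∃ i, 1 / (8 * n) ≤ ‖T (eb i)‖ := by
  have hn' : (0 : ℝ) < n := by exact_mod_cast hn
  by_contra hcon
  push Not at hcon
  apply absurd hT
  rw [not_lt]
  apply T.opNorm_le_bound (by norm_num)
  intro w
  have e : w = ∑ i, w i • eb i := by
    ext j
    simp [eb, Finset.sum_apply, Pi.single_apply]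
  calc ‖T w‖ = ‖∑ i, w i • T (eb i)‖ := by
        conv_lhs => rw [e]
        rw [map_sum]; simp
    _ ≤ ∑ i, ‖w i • T (eb i)‖ := norm_sum_le _ _
    _ ≤ ∑ _i : Fin n, ‖w‖ * (1 / (8 * n)) := by
        apply Finset.sum_le_sum
        intro i _
        rw [norm_smul]
        exact mul_le_mul (coord_le_norm w i) (hcon i).le (norm_nonneg _) (norm_nonneg _)
    _ = 1 / 8 * ‖w‖ := by
        rw [Finset.sum_const, Finset.card_univ, Fintype.card_fin, nsmul_eq_mul]
        field_simp

/-- Energy lower bound from a slope. -/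
theorem slope_energy {n d : ℕ} {f : EuclideanSpace ℝ (Fin n) → EuclideanSpace ℝ (Fin d)}
    (hf : ContDiff ℝ 2 f) (P : Aff n d) {r : ℝ} (hr : 0 < r) (v : EuclideanSpace ℝ (Fin n))
    (ε s : ℝ) (hs : 0 < s) (hε : 0 ≤ ε)
    (hle : ∀ w : EuclideanSpace ℝ (Fin n), (∀ i, |r⁻¹ * w i - v i| ≤ 1) → ‖f w - ev P w‖ ≤ ε * r)
    (i : Fin n) (hi : s ≤ ‖P.2 (eb i)‖)
    (hsm : Cth n * ε * (n ^ n * Dat.Vn n) ≤ s * cn n / 4) :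
    s ^ 2 * cn n / 2 * r ^ n ≤ ∫ w, thetaS r v w * ‖fderiv ℝ f w (eb i)‖ ^ 2 := by
  set φ := thetaS r v with hφ
  have cφ : ContDiff ℝ 2 φ := thetaS_contDiff r v
  have sφ : HasCompactSupport φ := thetaS_supp hr v
  have cg : ContDiff ℝ 2 (fun w => f w - ev P w) := hf.sub (ev_contDiff P)
  have cdf : Continuous (fun w => fderiv ℝ f w (eb i)) := (fderiv_apply_contDiff hf _).continuous
  have cdφ : Continuous (fun w => fderiv ℝ φ w (eb i)) :=
    (cφ.continuous_fderiv (by norm_num)).clm_apply continuous_const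
  have hdg : ∀ w, fderiv ℝ (fun w => f w - ev P w) w (eb i) = fderiv ℝ f w (eb i) - P.2 (eb i) := by
    intro w
    rw [fderiv_fun_sub ((hf.differentiable (by norm_num)) w)
      (((ev_contDiff P).differentiable (by norm_num)) w)]
    unfold ev
    rw [fderiv_const_add, P.2.fderiv]
    rfl
  have cdg : Continuous (fun w => fderiv ℝ (fun w => f w - ev P w) w (eb i)) :=
    (fderiv_apply_contDiff cg _).continuous
  have sdφ : HasCompactSupport (fun w => fderiv ℝ φ w (eb i)) := sφ.fderiv_apply (𝕜 := ℝ) _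
  have i1 : Integrable (fun w => fderiv ℝ φ w (eb i) • (f w - ev P w)) :=
    (cdφ.smul cg.continuous).integrable_of_hasCompactSupport sdφ.smul_right
  have i2 : Integrable (fun w => φ w • fderiv ℝ (fun w => f w - ev P w) w (eb i)) :=
    (cφ.continuous.smul cdg).integrable_of_hasCompactSupport sφ.smul_right
  have i3 : Integrable (fun w => φ w • (f w - ev P w)) :=
    (cφ.continuous.smul cg.continuous).integrable_of_hasCompactSupport sφ.smul_right
  have hparts := integral_bilinear_fderiv_right_eq_neg_left_of_integrable (μ := volume)
    (f := φ) (g := fun w => f w - ev P w) (v := eb i) (B := ContinuousLinearMap.lsmul ℝ ℝ)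
    i1 i2 i3 (fun w _ => (cφ.differentiable (by norm_num)) w)
    (fun w _ => (cg.differentiable (by norm_num)) w)
  simp only [ContinuousLinearMap.lsmul_apply] at hparts
  have i4 : Integrable (fun w => φ w • fderiv ℝ f w (eb i)) :=
    (cφ.continuous.smul cdf).integrable_of_hasCompactSupport sφ.smul_right
  have i5 : Integrable φ := cφ.continuous.integrable_of_hasCompactSupport sφ
  have i5' : Integrable (fun w => φ w • P.2 (eb i)) := i5.smul_const _
  have i6 : Integrable (fun w => φ w * ‖fderiv ℝ f w (eb i)‖ ^ 2) :=
    (cφ.continuous.mul (cdf.norm.pow 2)).integrable_of_hasCompactSupport sφ.mul_right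
  have i7 : Integrable (fun w => φ w * ‖fderiv ℝ f w (eb i)‖) :=
    (cφ.continuous.mul cdf.norm).integrable_of_hasCompactSupport sφ.mul_right
  have hintg := thetaS_integral hr v
  have hc := cn_pos n
  -- the error term
  have herr : ‖∫ w, fderiv ℝ φ w (eb i) • (f w - ev P w)‖ ≤
      Cth n / r * (ε * r) * ((n * r) ^ n * Dat.Vn n) := by
    have hz0 : ∀ w : EuclideanSpace ℝ (Fin n), ¬ (∀ i, |r⁻¹ * w i - v i| ≤ 1) →
        fderiv ℝ φ w (eb i) • (f w - ev P w) = 0 := by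
      intro w hw
      push Not at hw
      obtain ⟨j, hj⟩ := hw
      have h0 : φ =ᶠ[nhds w] 0 := by
        have hop : IsOpen {w : EuclideanSpace ℝ (Fin n) | 1 < |r⁻¹ * w j - v j|} :=
          isOpen_lt continuous_const (by fun_prop)
        filter_upwards [hop.mem_nhds hj] with w' hw'
        exact thetaS_eq_zero ⟨j, le_of_lt hw'⟩
      rw [h0.fderiv_eq]
      simp
    have hz : ∀ w, w ∉ closedBall (r • v) (n * r) →
        fderiv ℝ φ w (eb i) • (f w - ev P w) = 0 := by
      intro w hw
      apply hz0
      intro hcon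
      apply hw
      rw [mem_closedBall, dist_eq_norm]
      apply norm_le_of_coord
      intro i
      have h1 := hcon i
      have e : (w - r • v) i = r * (r⁻¹ * w i - v i) := by
        simp; field_simp
      rw [e, abs_mul, abs_of_pos hr]
      nlinarith
    rw [← setIntegral_eq_integral_of_forall_compl_eq_zero hz]
    have hC := Cth_one n
    have h1 : ∀ w ∈ closedBall (r • v) (n * r), ‖fderiv ℝ φ w (eb i) • (f w - ev P w)‖ ≤
        Cth n / r * (ε * r) := by
      intro w _
      by_cases hw : ∀ i, |r⁻¹ * w i - v i| ≤ 1
      · rw [norm_smul]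
        exact mul_le_mul (thetaS_fderiv hr v w i) (hle w hw) (norm_nonneg _) (by positivity)
      · rw [hz0 w hw, norm_zero]; positivity
    refine (norm_setIntegral_le_of_norm_le_const measure_closedBall_lt_top h1).trans (le_of_eq ?_)
    rw [Measure.addHaar_real_closedBall _ _ (by positivity)]
    simp [Dat.Vn]
  have herr2 : Cth n / r * (ε * r) * ((n * r) ^ n * Dat.Vn n) = Cth n * ε * (n ^ n * Dat.Vn n) * r ^ n := by
    rw [mul_pow]; field_simp
  -- main identity
  have hmain : ∫ w, φ w • fderiv ℝ f w (eb i) = (r ^ n * cn n) • P.2 (eb i) -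
      ∫ w, fderiv ℝ φ w (eb i) • (f w - ev P w) := by
    have : ∀ w, φ w • fderiv ℝ (fun w => f w - ev P w) w (eb i) =
        φ w • fderiv ℝ f w (eb i) - φ w • P.2 (eb i) := by
      intro w; rw [hdg, smul_sub]
    simp_rw [this] at hparts
    rw [integral_sub i4 i5', integral_smul_const, hintg] at hparts
    rw [sub_eq_iff_eq_add'.1 hparts, sub_eq_add_neg]
  have hlow : s * (r ^ n * cn n) - Cth n * ε * (n ^ n * Dat.Vn n) * r ^ n ≤
      ∫ w, φ w * ‖fderiv ℝ f w (eb i)‖ := by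
    have h1 : ‖∫ w, φ w • fderiv ℝ f w (eb i)‖ ≤ ∫ w, φ w * ‖fderiv ℝ f w (eb i)‖ := by
      refine (norm_integral_le_integral_norm _).trans (le_of_eq ?_)
      congr 1
      ext w
      rw [norm_smul, Real.norm_eq_abs, abs_of_nonneg (thetaS_nonneg _ _ _)]
    refine le_trans ?_ h1
    rw [hmain]
    refine le_trans ?_ (norm_sub_norm_le _ _)
    rw [norm_smul, Real.norm_eq_abs, abs_of_pos (by positivity)]
    rw [herr2] at herr
    have : s * (r ^ n * cn n) ≤ (r ^ n * cn n) * ‖P.2 (eb i)‖ := by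
      rw [mul_comm s]; gcongr
    linarith
  have hup : ∫ w, φ w * ‖fderiv ℝ f w (eb i)‖ ≤
      (1 / (2 * s)) * (∫ w, φ w * ‖fderiv ℝ f w (eb i)‖ ^ 2) + s / 2 * (r ^ n * cn n) := by
    rw [← hintg, ← integral_const_mul, ← integral_const_mul,
      ← integral_add (i6.const_mul _) (i5.const_mul _)]
    refine integral_mono i7 ((i6.const_mul _).add (i5.const_mul _)) fun w => ?_
    have h0 : 0 ≤ φ w := thetaS_nonneg _ _ _
    simp only
    set a := ‖fderiv ℝ f w (eb i)‖
    have h1 : a ≤ 1 / (2 * s) * a ^ 2 + s / 2 := by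
      have : 0 ≤ (a - s) ^ 2 := sq_nonneg _
      rw [← sub_nonneg]
      have e : 1 / (2 * s) * a ^ 2 + s / 2 - a = (a - s) ^ 2 / (2 * s) := by field_simp; ring
      rw [e]; positivity
    calc φ w * a ≤ φ w * (1 / (2 * s) * a ^ 2 + s / 2) := by gcongr
      _ = _ := by ring
  have hrn : 0 < r ^ n := by positivity
  have h3 : Cth n * ε * (n ^ n * Dat.Vn n) * r ^ n ≤ s * cn n / 4 * r ^ n := by gcongr
  have h4 : s * cn n / 4 * r ^ n ≤ 1 / (2 * s) * ∫ w, φ w * ‖fderiv ℝ f w (eb i)‖ ^ 2 := by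
    nlinarith
  have h5 := mul_le_mul_of_nonneg_left h4 (show 0 ≤ 2 * s by positivity)
  calc _ = 2 * s * (s * cn n / 4 * r ^ n) := by ring
    _ ≤ _ := h5
    _ = _ := by field_simp

open MeasureTheory Metric Set Filter

namespace Dat
variable {n d : ℕ} (A : Dat n d)

/-- Deviation constant. -/
noncomputable def epsC : ℝ := 2 * (A.C2 * √(3 ^ n * A.η + 3 ^ n * A.η)) +
  (n + 1) * (A.Λ * √(A.η + A.η))

theorem epsC_nonneg : 0 ≤ A.epsC := by
  have := A.C2_pos
  have := A.Λ_pos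
  unfold epsC; positivity

theorem Bn_small (k : ℕ) (w : EuclideanSpace ℝ (Fin n)) :
    ‖A.Bn k w‖ ≤ A.C2 * √(3 ^ n * A.η + 3 ^ n * A.η) * A.r k := by
  have h := A.DB_Bn k w 0 (by norm_num)
  rw [norm_iteratedFDeriv_zero, pow_zero, mul_one] at h
  refine h.trans ?_
  have := A.C2_pos
  have := A.r_pos k
  have : A.eps k w ≤ √(3 ^ n * A.η + 3 ^ n * A.η) :=
    Real.sqrt_le_sqrt (add_le_add (A.bs_le _ _) (A.bs_le _ _))
  gcongr

theorem Fn_tail (k m : ℕ) (w : EuclideanSpace ℝ (Fin n)) :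
    ‖A.Fn (k + m) w - A.Fn k w‖ ≤
      A.C2 * √(3 ^ n * A.η + 3 ^ n * A.η) * (2 * A.r k - 2 * A.r (k + m)) := by
  induction m with
  | zero => simp
  | succ m ih =>
    have h1 := A.Bn_small (k + m) w
    have h2 := A.r_succ (k + m)
    have e : A.Fn (k + (m + 1)) w - A.Fn k w = (A.Fn (k + m) w - A.Fn k w) + A.Bn (k + m) w := by
      rw [← add_assoc, Fn_succ]; simp only; abel
    rw [e]
    refine (norm_add_le _ _).trans ((add_le_add ih h1).trans (le_of_eq ?_))
    rw [← add_assoc, h2]; ring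

theorem Fn_near {x : EuclideanSpace ℝ (Fin d)} {k : ℕ} (hx : x ∈ A.E k)
    {w : EuclideanSpace ℝ (Fin n)} (hw : ∀ i, |w i - A.q x i| ≤ A.r k) :
    ‖A.Fn k w - ev (A.Pm x k) w‖ ≤ (n + 1) * (A.Λ * √(A.η + A.η)) * A.r k := by
  have hr := A.r_pos k
  have hΛ := A.Λ_pos
  have hn := A.n_one
  have hM := A.hM
  have hcore : A.core k w := ⟨x, hx, fun i => (hw i).trans_lt (by linarith)⟩
  have hwq : ‖w - A.q x‖ ≤ n * A.r k := norm_le_of_coord _ _ (fun i => by simpa using hw i)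
  have hN := (A.N_nhds k w).self_of_nhds
  have e1 : A.Fn k w - ev (A.Pm x k) w =
      ∑ z ∈ A.N k w, A.th k z w • (ev (A.Pz k z - A.Pm x k) w) := by
    rw [← A.sum_N hN (fun z => ev (A.Pz k z - A.Pm x k) w)]
    simp_rw [ev_sub, smul_sub]
    rw [Finset.sum_sub_distrib, ← Finset.sum_smul, A.core_sum hcore, one_smul, A.core_eq hcore]
  have hsum : ∑ z ∈ A.N k w, A.th k z w ≤ 1 := by
    have h := A.core_sum hcore
    rw [← h]
    apply Finset.sum_le_sum_of_subset_of_nonneg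
    · intro z hz; exact (A.mem_N.1 hz).1
    · intro z _ _; exact thetaS_nonneg _ _ _
  have hbd : ∀ z ∈ A.N k w, ‖ev (A.Pz k z - A.Pm x k) w‖ ≤
      (n + 1) * (A.Λ * √(A.η + A.η)) * A.r k := by
    intro z hz
    have hX := (A.X_spec (A.mem_N.1 hz).1).1
    have hq := A.S_dist' hz
    have hqq : ‖A.q (A.X k z) - A.q x‖ ≤ 6 * n * A.r k := by
      have e : A.q (A.X k z) - A.q x = (w - A.q x) - (w - A.q (A.X k z)) := by abel
      rw [e]
      refine (norm_sub_le _ _).trans ?_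
      linarith
    have hdist := A.dist_le_of_q hX hx le_rfl hqq (by nlinarith)
    have hd2 : dist (A.X k z) x ≤ (A.M - 1) * A.r k := by
      refine hdist.trans ?_
      have : 10 / 7 * (6 * n) ≤ A.M - 1 := by linarith
      calc _ = 10 / 7 * (6 * n) * A.r k := by ring
        _ ≤ _ := by gcongr
    obtain ⟨c1, c2⟩ := A.compare hX hx (Or.inl rfl) hd2
    have hsq : √(A.b (A.X k z) k + A.b x k) ≤ √(A.η + A.η) :=
      Real.sqrt_le_sqrt (add_le_add (A.mem_spec hX).2.2.2.2 (A.mem_spec hx).2.2.2.2)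
    have hΛs : A.Λ * √(A.b (A.X k z) k + A.b x k) ≤ A.Λ * √(A.η + A.η) := by gcongr
    have e : ev (A.Pz k z - A.Pm x k) w = (ev (A.Pz k z - A.Pm x k) w -
      ev (A.Pz k z - A.Pm x k) (A.q x)) + ev (A.Pz k z - A.Pm x k) (A.q x) := by abel
    rw [e]
    refine (norm_add_le _ _).trans ?_
    have h1 := ev_diff (A.Pz k z - A.Pm x k) w (A.q x)
    have h2 : ‖(A.Pz k z - A.Pm x k).2‖ * ‖w - A.q x‖ ≤ A.Λ * √(A.η + A.η) * (n * A.r k) :=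
      mul_le_mul (c1.trans hΛs) hwq (norm_nonneg _) (by positivity)
    have h3 : ‖ev (A.Pz k z - A.Pm x k) (A.q x)‖ ≤ A.Λ * √(A.η + A.η) * A.r k :=
      c2.trans (by gcongr)
    linarith
  rw [e1]
  refine (norm_sum_le _ _).trans ?_
  calc _ ≤ ∑ z ∈ A.N k w, A.th k z w * ((n + 1) * (A.Λ * √(A.η + A.η)) * A.r k) := by
        apply Finset.sum_le_sum
        intro z hz
        have h0 : 0 ≤ A.th k z w := thetaS_nonneg _ _ _
        rw [norm_smul, Real.norm_eq_abs, abs_of_nonneg h0]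
        exact mul_le_mul_of_nonneg_left (hbd z hz) h0
    _ ≤ 1 * ((n + 1) * (A.Λ * √(A.η + A.η)) * A.r k) := by
        rw [← Finset.sum_mul]; gcongr
    _ = _ := one_mul _

theorem Fn_dev {x : EuclideanSpace ℝ (Fin d)} {k K : ℕ} (hx : x ∈ A.E k) (hK : k ≤ K)
    {w : EuclideanSpace ℝ (Fin n)} (hw : ∀ i, |w i - A.q x i| ≤ A.r k) :
    ‖A.Fn K w - ev (A.Pm x k) w‖ ≤ A.epsC * A.r k := by
  obtain ⟨m, rfl⟩ := Nat.exists_eq_add_of_le hK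
  have h1 := A.Fn_near hx hw
  have h2 := A.Fn_tail k m w
  have e : A.Fn (k + m) w - ev (A.Pm x k) w = (A.Fn (k + m) w - A.Fn k w) +
    (A.Fn k w - ev (A.Pm x k) w) := by abel
  rw [e]
  refine (norm_add_le _ _).trans ((add_le_add h2 h1).trans ?_)
  have := A.r_pos (k + m)
  have := A.C2_pos
  have h3 : A.C2 * √(3 ^ n * A.η + 3 ^ n * A.η) * (2 * A.r k - 2 * A.r (k + m)) ≤
    A.C2 * √(3 ^ n * A.η + 3 ^ n * A.η) * (2 * A.r k) := by
    gcongr; linarith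
  unfold epsC
  linarith

theorem steep {x : EuclideanSpace ℝ (Fin d)} {k : ℕ} (hx : x ∈ A.E k) (hD : A.D x (k + 1))
    (hP : ¬ A.HasP x (k + 1)) : 1 / 8 < ‖(A.Pm x k).2‖ := by
  have := A.fin
  by_contra hcon
  push Not at hcon
  apply hP
  obtain ⟨L, pL, hpL, hLn, hL⟩ := A.plane x hx.1 (k + 1) (by omega) hD
  have hb := (A.mem_spec hx).2.2.2.2
  have hb' := A.b_le hx.1 hD
  have h1 := A.hη1
  exact lemGraph A.ι A.p0 A.σ A.hn A.C0 A.hC0 A.hreg A.δ A.hδ A.hδ1 A.τ A.hδτ (A.Pm x k) hcon x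
    A.M (A.r k) (A.r (k + 1)) (A.b x k) (A.b x (k + 1)) (A.r_pos _) (by linarith [A.M_ge])
    (A.r_succ k) (A.hb _ _) (A.hb _ _) (le_trans (by gcongr) h1) hD (A.mem_spec hx).2.2.1 L pL
    hpL hLn hL

/-- The slope threshold. -/
noncomputable def sl (n : ℕ) : ℝ := 1 / (8 * n)

set_option maxHeartbeats 800000 in
theorem ba_energy (hη4 : Cth n * A.epsC * (n ^ n * Vn n) ≤ sl n * cn n / 4)
    (F : Finset (EuclideanSpace ℝ (Fin d))) (κ : EuclideanSpace ℝ (Fin d) → ℕ)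
    (hF : ∀ x ∈ F, x ∈ A.E (κ x) ∧ 1 / 8 < ‖(A.Pm x (κ x)).2‖)
    (hdis : (F : Set _).PairwiseDisjoint (fun x => closedBall x (2 * n * A.r (κ x))))
    (K : ℕ) (hK : ∀ x ∈ F, κ x ≤ K) :
    sl n ^ 2 * cn n / 2 * ∑ x ∈ F, A.r (κ x) ^ n ≤ En (A.Fn K) := by
  have hn := A.n_one
  have hs : 0 < sl n := by unfold sl; positivity
  have hf := A.Fn_contDiff K
  set φ : EuclideanSpace ℝ (Fin d) → EuclideanSpace ℝ (Fin n) → ℝ :=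
    fun x => thetaS (A.r (κ x)) ((A.r (κ x))⁻¹ • A.q x) with hφ
  have cdf : ∀ i, Continuous (fun w => fderiv ℝ (A.Fn K) w (eb i)) :=
    fun i => (fderiv_apply_contDiff hf _).continuous
  have i1 : ∀ x i, Integrable (fun w => φ x w * ‖fderiv ℝ (A.Fn K) w (eb i)‖ ^ 2) := fun x i =>
    ((thetaS_contDiff _ _).continuous.mul ((cdf i).norm.pow 2)).integrable_of_hasCompactSupport
      (thetaS_supp (A.r_pos _) _).mul_right
  have hlow : ∀ x ∈ F, sl n ^ 2 * cn n / 2 * A.r (κ x) ^ n ≤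
      ∑ i, ∫ w, φ x w * ‖fderiv ℝ (A.Fn K) w (eb i)‖ ^ 2 := by
    intro x hx
    obtain ⟨hxE, hT⟩ := hF x hx
    have hr := A.r_pos (κ x)
    obtain ⟨i, hi⟩ := exists_coord A.hn _ hT
    have h1 := slope_energy hf (A.Pm x (κ x)) hr ((A.r (κ x))⁻¹ • A.q x) A.epsC (sl n) hs
      A.epsC_nonneg ?_ i hi hη4
    · refine h1.trans ?_
      exact Finset.single_le_sum (f := fun i => ∫ w, φ x w * ‖fderiv ℝ (A.Fn K) w (eb i)‖ ^ 2)
        (fun i _ => integral_nonneg fun w => mul_nonneg (thetaS_nonneg _ _ _) (by positivity))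
        (Finset.mem_univ i)
    · intro w hw
      apply A.Fn_dev hxE (hK x hx)
      intro i
      have h2 := hw i
      have e : w i - A.q x i = A.r (κ x) * ((A.r (κ x))⁻¹ * w i - ((A.r (κ x))⁻¹ • A.q x) i) := by
        simp; field_simp
      rw [e, abs_mul, abs_of_pos hr]
      nlinarith
  rw [Finset.mul_sum]
  refine (Finset.sum_le_sum hlow).trans ?_
  rw [Finset.sum_comm]
  unfold En
  apply Finset.sum_le_sum
  intro i _
  rw [← integral_finsetSum _ (fun x _ => i1 x i)]
  have i2 : Integrable (fun w => ‖fderiv ℝ (A.Fn K) w (eb i)‖ ^ 2) := by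
    apply Continuous.integrable_of_hasCompactSupport
    · exact ((cdf i).norm.pow 2)
    · exact (fderiv_apply_supp (A.Fn_supp K) (eb i)).norm.comp_left (g := fun t : ℝ => t ^ 2)
        (by norm_num)
  have i3 : Integrable (fun w => ∑ x ∈ F, φ x w * ‖fderiv ℝ (A.Fn K) w (eb i)‖ ^ 2) :=
    integrable_finsetSum _ (fun x _ => i1 x i)
  refine integral_mono i3 i2 ?_
  · intro w
    simp only
    rw [← Finset.sum_mul]
    have hle : ∑ x ∈ F, φ x w ≤ 1 := by
      by_cases hex : ∃ x ∈ F, φ x w ≠ 0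
      · obtain ⟨x, hx, hxw⟩ := hex
        rw [Finset.sum_eq_single_of_mem x hx]
        · exact thetaS_le_one _ _ _
        · intro x' hx' hne
          by_contra hx'w
          have key : ∀ y, φ y w ≠ 0 → ‖w - A.q y‖ ≤ n * A.r (κ y) := by
            intro y hy
            have hr := A.r_pos (κ y)
            apply norm_le_of_coord
            intro j
            by_contra hcon
            push Not at hcon
            apply hy
            apply thetaS_eq_zero
            refine ⟨j, ?_⟩
            have e : (w - A.q y) j = A.r (κ y) *
                ((A.r (κ y))⁻¹ * w j - ((A.r (κ y))⁻¹ • A.q y) j) := by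
              simp; field_simp
            rw [e, abs_mul, abs_of_pos hr] at hcon
            by_contra h2
            push Not at h2
            nlinarith
          have k1 := key x hxw
          have k2 := key x' hx'w
          have hd := hdis hx' hx hne
          simp only [Function.onFun] at hd
          have r1 := A.r_pos (κ x)
          have r2 := A.r_pos (κ x')
          rw [disjoint_closedBall_closedBall_iff (by positivity) (by positivity)] at hd
          have hc := A.cone_sep (hF x' hx').1 (hF x hx).1 (by nlinarith)
          have e : A.q x' - A.q x = (w - A.q x) - (w - A.q x') := by abel
          rw [e] at hc
          have := norm_sub_le (w - A.q x) (w - A.q x')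
          nlinarith
      · push Not at hex
        rw [Finset.sum_eq_zero hex]; norm_num
    calc _ ≤ 1 * ‖fderiv ℝ (A.Fn K) w (eb i)‖ ^ 2 := by gcongr
      _ = _ := one_mul _

/-- The constant for the steep part. -/
noncomputable def C4 : ℝ := (2 * n) ^ n * (2 / (sl n ^ 2 * cn n)) * (2 * A.C3 *
  (11 ^ n * A.τ⁻¹ * (A.C0 * 2 ^ n)))

theorem ba (hη4 : Cth n * A.epsC * (n ^ n * Vn n) ≤ sl n * cn n / 4) :
    A.σ {x | ∃ k, x ∈ A.E k ∧ A.D x (k + 1) ∧ ¬ A.HasP x (k + 1)} ≤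
    ENNReal.ofReal (A.C0 * 5 ^ n) * ENNReal.ofReal (A.C4 * (A.η * A.r0 ^ n)) := by
  classical
  have := A.fin
  have hn := A.n_one
  have hC0 := A.hC0
  have hs : 0 < sl n := by unfold sl; positivity
  have hc := cn_pos n
  have hch : ∀ x : EuclideanSpace ℝ (Fin d), ∃ k,
      x ∈ {x | ∃ k, x ∈ A.E k ∧ A.D x (k + 1) ∧ ¬ A.HasP x (k + 1)} →
      x ∈ A.E k ∧ 1 / 8 < ‖(A.Pm x k).2‖ := by
    intro x
    by_cases h : x ∈ {x | ∃ k, x ∈ A.E k ∧ A.D x (k + 1) ∧ ¬ A.HasP x (k + 1)}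
    · obtain ⟨k, hk⟩ := h
      exact ⟨k, fun _ => ⟨hk.1, A.steep hk.1 hk.2.1 hk.2.2⟩⟩
    · exact ⟨0, fun h' => absurd h' h⟩
  choose κ hκ using hch
  have hpos : ∀ x : EuclideanSpace ℝ (Fin d), 0 < 2 * n * A.r (κ x) := fun x => by
    have := A.r_pos (κ x); positivity
  apply vitali_bound (n := n) A.σ _ (fun x => 2 * n * A.r (κ x)) (2 * n * A.r0)
  · intro x hx
    have h2 := A.r_le (κ x)
    exact ⟨hpos x, by gcongr⟩
  · intro x hx
    have h1 := hpos x
    rw [← ENNReal.ofReal_mul (by positivity), ← ofReal_measureReal]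
    apply ENNReal.ofReal_le_ofReal
    refine (A.hreg x _ (by positivity)).trans (le_of_eq ?_)
    rw [mul_pow]; ring
  · intro F hF hdis
    rw [← ENNReal.ofReal_sum_of_nonneg (fun x _ => pow_nonneg (hpos x).le n)]
    apply ENNReal.ofReal_le_ofReal
    have h1 := A.ba_energy hη4 F κ (fun x hx => hκ x (hF hx)) hdis (F.sup κ)
      (fun x hx => Finset.le_sup hx)
    have h2 := A.energy_le (F.sup κ)
    have h3 := A.bsum_total (F.sup κ + 1)
    have hC3 := A.C3_nonneg
    have h4 : sl n ^ 2 * cn n / 2 * ∑ x ∈ F, A.r (κ x) ^ n ≤ 2 * A.C3 *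
      (11 ^ n * A.τ⁻¹ * (A.C0 * 2 ^ n) * (A.η * A.r0 ^ n)) :=
      h1.trans (h2.trans (by gcongr))
    have h5 := mul_le_mul_of_nonneg_left h4 (show 0 ≤ (2 * n : ℝ) ^ n * (2 / (sl n ^ 2 * cn n))
      by positivity)
    have e : ∑ x ∈ F, (2 * n * A.r (κ x)) ^ n = (2 * n : ℝ) ^ n * (2 / (sl n ^ 2 * cn n)) *
        (sl n ^ 2 * cn n / 2 * ∑ x ∈ F, A.r (κ x) ^ n) := by
      simp_rw [mul_pow _ (A.r _)]
      rw [← Finset.mul_sum]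
      field_simp
    rw [e]
    refine h5.trans (le_of_eq ?_)
    unfold C4; ring

end Dat

open MeasureTheory Metric Set Filter
open scoped ENNReal NNReal

namespace Dat
variable {n d : ℕ} (A : Dat n d)

/-- Total constant in front of the flatness parameter. -/
noncomputable def C5 : ℝ := 360000 + 5760000 * (11 ^ n * A.τ⁻¹ * (A.C0 * 2 ^ n)) +
  A.C0 * 5 ^ n * A.C4

theorem C4_nonneg : 0 ≤ A.C4 := by
  have := A.C3_nonneg
  have := A.hC0
  have := A.τ_pos
  have hn := A.n_one
  have hs : 0 < sl n := by unfold sl; positivity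
  have hc := cn_pos n
  unfold C4; positivity

theorem good_pos (hη3 : A.Λ * √(A.η + A.η) ≤ 1 / 600)
    (hη4 : Cth n * A.epsC * (n ^ n * Vn n) ≤ sl n * cn n / 4) (c0 : ℝ) (hc0 : 0 < c0)
    (hB : ENNReal.ofReal (c0 * A.r0 ^ n) ≤ A.σ A.B0) (hτ : A.τ * (1 + 10 ^ n) ≤ c0 / 4)
    (hη5 : A.C5 * A.η ≤ c0 / 4) : 0 < A.σ (⋂ k, A.E k) := by
  have hr0 := A.hr0
  have hτp := A.τ_pos
  have hC0 := A.hC0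
  have hC4 := A.C4_nonneg
  have hη := A.hη
  have hrn : 0 < A.r0 ^ n := by positivity
  set S1 := {x ∈ A.B0 | ¬ A.D x 0}
  set S2 := {x | ∃ k, x ∈ A.E k ∧ ¬ A.D x (k + 1)}
  set S3 := {x ∈ A.B0 | A.D x 0 ∧ A.r 0 / 300 < ‖A.h x - ev (A.Pm x 0) (A.q x)‖}
  set S4 := {x | ∃ k, x ∈ A.E k ∧ A.D x (k + 1) ∧ A.HasP x (k + 1) ∧
      A.r (k + 1) / 300 < ‖A.h x - ev (A.Pm x (k + 1)) (A.q x)‖}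
  set S5 := {x | ∃ k, x ∈ A.E k ∧ A.D x (k + 1) ∧ ¬ A.HasP x (k + 1)}
  have hcov : A.B0 ⊆ (⋂ k, A.E k) ∪ (S1 ∪ (S2 ∪ (S3 ∪ (S4 ∪ S5)))) := by
    intro x hx
    by_contra hcon
    simp only [mem_union, not_or] at hcon
    obtain ⟨h0, h1, h2, h3, h4, h5⟩ := hcon
    apply h0
    have hg : ∀ k, x ∈ A.E k := by
      intro k
      induction k with
      | zero =>
        refine ⟨hx, fun j hj => ?_⟩
        obtain rfl : j = 0 := by omega
        have hD : A.D x 0 := by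
          by_contra hD; exact h1 ⟨hx, hD⟩
        refine ⟨hD, ⟨0, by simp, ?_⟩, ?_⟩
        · rw [r_zero]; exact A.plane0 x hx
        · by_contra hF
          push Not at hF
          exact h3 ⟨hx, hD, hF⟩
      | succ k ih =>
        refine ⟨hx, fun j hj => ?_⟩
        rcases Nat.lt_or_ge j (k + 1) with hj' | hj'
        · exact ih.2 j (by omega)
        obtain rfl : j = k + 1 := by omega
        have hD : A.D x (k + 1) := by
          by_contra hD; exact h2 ⟨k, ih, hD⟩
        have hP : A.HasP x (k + 1) := by
          by_contra hP; exact h5 ⟨k, ih, hD, hP⟩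
        refine ⟨hD, hP, ?_⟩
        by_contra hF
        push Not at hF
        exact h4 ⟨k, ih, hD, hP, hF⟩
    simpa using hg
  have m1 : A.σ S1 ≤ _ := A.ld0
  have m2 : A.σ S2 ≤ _ := A.ld
  have m3 : A.σ S3 ≤ _ := A.far0
  have m4 : A.σ S4 ≤ _ := A.far hη3
  have m5 : A.σ S5 ≤ _ := A.ba hη4
  rw [← ENNReal.ofReal_mul (by positivity)] at m2 m5
  rw [pos_iff_ne_zero]
  intro hz
  have h1 := hB.trans (measure_mono hcov)
  have h2 := (measure_union_le (μ := A.σ) (⋂ k, A.E k) (S1 ∪ (S2 ∪ (S3 ∪ (S4 ∪ S5))))).trans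
    (add_le_add hz.le ((measure_union_le _ _).trans (add_le_add m1 ((measure_union_le _ _).trans
      (add_le_add m2 ((measure_union_le _ _).trans (add_le_add m3 ((measure_union_le _ _).trans
        (add_le_add m4 m5)))))))))
  have h3 := h1.trans h2
  rw [zero_add, ← ENNReal.ofReal_add (by positivity) (by positivity),
    ← ENNReal.ofReal_add (by positivity) (by positivity),
    ← ENNReal.ofReal_add (by positivity) (by positivity),
    ← ENNReal.ofReal_add (by positivity) (by positivity),
    ENNReal.ofReal_le_ofReal_iff (by positivity)] at h3
  have e10 : (10 : ℝ) ^ n = 5 ^ n * 2 ^ n := by rw [← mul_pow]; norm_num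
  have h4 : c0 * A.r0 ^ n ≤ (A.τ * (1 + 10 ^ n) + A.C5 * A.η) * A.r0 ^ n := by
    refine h3.trans (le_of_eq ?_)
    unfold C5
    rw [e10]; ring
  have h5 := le_of_mul_le_mul_right h4 hrn
  linarith

theorem concl (hη3 : A.Λ * √(A.η + A.η) ≤ 1 / 600)
    (hη4 : Cth n * A.epsC * (n ^ n * Vn n) ≤ sl n * cn n / 4) (c0 : ℝ) (hc0 : 0 < c0)
    (hB : ENNReal.ofReal (c0 * A.r0 ^ n) ≤ A.σ A.B0) (hτ : A.τ * (1 + 10 ^ n) ≤ c0 / 4)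
    (hη5 : A.C5 * A.η ≤ c0 / 4) :
    ∃ (f : EuclideanSpace ℝ (Fin n) → EuclideanSpace ℝ (Fin d)) (K : ℝ≥0), LipschitzWith K f ∧
      0 < A.σ (A.B0 ∩ range f) := by
  classical
  have hpos := A.good_pos hη3 hη4 c0 hc0 hB hτ hη5
  set Z := ⋂ k, A.E k with hZ
  have hZm : ∀ x ∈ Z, ∀ k, x ∈ A.E k := fun x hx k => mem_iInter.1 hx k
  have hch : ∀ w : EuclideanSpace ℝ (Fin n), ∃ x : EuclideanSpace ℝ (Fin d),
      w ∈ A.q '' Z → x ∈ Z ∧ A.q x = w := by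
    intro w
    by_cases h : w ∈ A.q '' Z
    · obtain ⟨x, hx⟩ := h
      exact ⟨x, fun _ => hx⟩
    · exact ⟨0, fun h' => absurd h' h⟩
  choose f0 hf0 using hch
  have hlip : LipschitzOnWith (10 / 7) f0 (A.q '' Z) := by
    apply LipschitzOnWith.of_dist_le_mul
    intro w hw w' hw'
    obtain ⟨a1, a2⟩ := hf0 w hw
    obtain ⟨b1, b2⟩ := hf0 w' hw'
    have h := A.cone_lim (hZm _ a1) (hZm _ b1)
    rw [a2, b2, ← dist_eq_norm] at h
    have : ((10 / 7 : ℝ≥0) : ℝ) = 10 / 7 := by norm_num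
    rw [this]
    linarith
  obtain ⟨g, hg, hgeq⟩ := hlip.extend_finite_dimension
  refine ⟨g, _, hg, lt_of_lt_of_le hpos (measure_mono ?_)⟩
  intro x hx
  refine ⟨(hZm x hx 0).1, A.q x, ?_⟩
  have hw : A.q x ∈ A.q '' Z := ⟨x, hx, rfl⟩
  rw [← hgeq hw]
  obtain ⟨a1, a2⟩ := hf0 _ hw
  have h := A.cone_lim (hZm _ a1) (hZm _ hx)
  rw [a2, sub_self, norm_zero] at h
  have h2 : dist (f0 (A.q x)) x ≤ 0 := by linarith
  exact dist_le_zero.1 h2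

end Dat

/-- All smallness conditions hold for small flatness parameter. -/
theorem small_ok (n : ℕ) (hn : 0 < n) (C0 τ δ c0 : ℝ) (hτ : 0 < τ) (hδ : 0 < δ)
    (hc0 : 0 < c0) (hτc : τ * (1 + 10 ^ n) ≤ c0 / 4) :
    ∀ᶠ η in nhdsWithin (0 : ℝ) (Ioi 0), 2 ^ 20 * 2 ^ n * (η + η) ≤ τ * δ ^ 2 ∧
      (1 + 2 / δ) * √(256 * 2 ^ n / τ) * √(η + η) ≤ 1 / 300 ∧
      ∀ (d : ℕ) (A : Dat n d), A.C0 = C0 → A.τ = τ → A.δ = δ → A.η = η →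
        ENNReal.ofReal (c0 * A.r0 ^ n) ≤ A.σ A.B0 →
        ∃ (f : EuclideanSpace ℝ (Fin n) → EuclideanSpace ℝ (Fin d)) (K : ℝ≥0), LipschitzWith K f ∧
          0 < A.σ (A.B0 ∩ range f) := by
  set Λ := (1 + 2 / δ) * √(256 * 2 ^ n / τ) with hΛ
  set C1 := (3 : ℝ) ^ n * (4 * (Cth n * ((3 * n + 2) * Λ))) with hC1
  set C2 := (3 : ℝ) ^ n * (4 * ((4 * Cth n) * C1)) with hC2
  set C3 := n * ((C2 ^ 2 + 2 * (C2 * C1)) * (Dat.Vn n * n ^ n)) with hC3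
  set C4 := (2 * n : ℝ) ^ n * (2 / (Dat.sl n ^ 2 * cn n)) * (2 * C3 *
    (11 ^ n * τ⁻¹ * (C0 * 2 ^ n))) with hC4
  set C5 := 360000 + 5760000 * (11 ^ n * τ⁻¹ * (C0 * 2 ^ n)) + C0 * 5 ^ n * C4 with hC5
  have hn' : (0 : ℝ) < n := by exact_mod_cast hn
  have hs : 0 < Dat.sl n := by unfold Dat.sl; positivity
  have hc := cn_pos n
  have key : ∀ (f : ℝ → ℝ) (a : ℝ), Continuous f → f 0 < a →
      ∀ᶠ η in nhdsWithin (0 : ℝ) (Ioi 0), f η ≤ a := by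
    intro f a hf h0
    have : ∀ᶠ η in nhds (0 : ℝ), f η < a := hf.continuousAt.eventually (gt_mem_nhds h0)
    exact (this.filter_mono nhdsWithin_le_nhds).mono fun _ h => h.le
  have k1 := key (fun η => 2 ^ 20 * 2 ^ n * (η + η)) (τ * δ ^ 2) (by fun_prop) (by simp; positivity)
  have k2 := key (fun η => Λ * √(η + η)) (1 / 600) (by fun_prop) (by simp)
  have k3 := key (fun η => Cth n * (2 * (C2 * √(3 ^ n * η + 3 ^ n * η)) +
    (n + 1) * (Λ * √(η + η))) * (n ^ n * Dat.Vn n)) (Dat.sl n * cn n / 4) (by fun_prop)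
    (by simp; positivity)
  have k4 := key (fun η => C5 * η) (c0 / 4) (by fun_prop) (by simp; positivity)
  filter_upwards [k1, k2, k3, k4] with η h1 h2 h3 h4
  refine ⟨h1, h2.trans (by norm_num), ?_⟩
  intro d A e1 e2 e3 e4 hB
  have eΛ : A.Λ = Λ := by unfold Dat.Λ; rw [e2, e3]
  have eC1 : A.C1 = C1 := by unfold Dat.C1; rw [eΛ]
  have eC2 : A.C2 = C2 := by unfold Dat.C2; rw [eC1]
  have eC3 : A.C3 = C3 := by unfold Dat.C3; rw [eC1, eC2]
  have eC4 : A.C4 = C4 := by unfold Dat.C4; rw [eC3, e1, e2]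
  have eC5 : A.C5 = C5 := by unfold Dat.C5; rw [eC4, e1, e2]
  apply A.concl _ _ c0 hc0 hB
  · rw [e2]; exact hτc
  · rw [eC5, e4]; exact h4
  · rw [eΛ, e4]; exact h2
  · unfold Dat.epsC; rw [eC2, eΛ, e4]; exact h3

open MeasureTheory Metric Set Filter
open scoped ENNReal NNReal

/-- Unnormalised flatness. -/
noncomputable def Gf (n d : ℕ) (μ : Measure (EuclideanSpace ℝ (Fin d)))
    (x : EuclideanSpace ℝ (Fin d)) (r : ℝ) : ℝ≥0∞ :=
  ⨅ L : {L : AffineSubspace ℝ (EuclideanSpace ℝ (Fin d)) //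
      Module.finrank ℝ L.direction = n},
    ∫⁻ y in closedBall x r,
        ENNReal.ofReal ((infDist y (L.1 : Set (EuclideanSpace ℝ (Fin d)))) ^ 2) ∂μ

theorem beta_eq (n d : ℕ) (μ : Measure (EuclideanSpace ℝ (Fin d)))
    (x : EuclideanSpace ℝ (Fin d)) (r : ℝ) (hr : 0 < r) :
    beta2sq n d μ x r = Gf n d μ x r / ENNReal.ofReal (r ^ (n + 2)) := by
  have h0 : ENNReal.ofReal (r ^ (n + 2)) ≠ 0 := by
    have : 0 < r ^ (n + 2) := by positivity
    simpa using this
  unfold beta2sq Gf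
  rw [ENNReal.iInf_div_of_ne h0 ENNReal.ofReal_ne_top]
  congr 1
  ext L
  have h2 : (ENNReal.ofReal (r ^ 2))⁻¹ ≠ ⊤ := by
    simpa using hr.ne'
  have : ∀ y, ENNReal.ofReal ((infDist y (L.1 : Set (EuclideanSpace ℝ (Fin d))) / r) ^ 2) =
      ENNReal.ofReal ((infDist y (L.1 : Set (EuclideanSpace ℝ (Fin d)))) ^ 2) *
        (ENNReal.ofReal (r ^ 2))⁻¹ := by
    intro y
    rw [div_pow, ENNReal.ofReal_div_of_pos (by positivity), div_eq_mul_inv]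
  simp_rw [this]
  rw [lintegral_mul_const' _ _ h2, div_eq_mul_inv, div_eq_mul_inv, mul_assoc,
    pow_add r n 2, ENNReal.ofReal_mul (by positivity),
    ENNReal.mul_inv (Or.inr ENNReal.ofReal_ne_top) (Or.inl ENNReal.ofReal_ne_top),
    mul_comm (ENNReal.ofReal (r ^ n))⁻¹]

theorem Gf_mono (n d : ℕ) (μ : Measure (EuclideanSpace ℝ (Fin d)))
    (x z : EuclideanSpace ℝ (Fin d)) (r s : ℝ) (h : closedBall x r ⊆ closedBall z s) :
    Gf n d μ x r ≤ Gf n d μ z s := by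
  unfold Gf
  exact iInf_mono fun L => lintegral_mono_set h

theorem usc_ball (d : ℕ) (ν : Measure (EuclideanSpace ℝ (Fin d))) (r : ℝ)
    (hf : ∀ x r, ν (closedBall x r) ≠ ⊤) :
    UpperSemicontinuous fun x => ν (closedBall x r) := by
  intro x c hc
  have hI : closedBall x r = ⋂ m : ℕ, closedBall x (r + 1 / ((m : ℝ) + 1)) := by
    ext y
    simp only [mem_closedBall, mem_iInter]
    constructor
    · intro h m
      have : (0 : ℝ) < 1 / ((m : ℝ) + 1) := by positivity
      linarith
    · intro h
      apply le_of_forall_pos_le_add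
      intro ε hε
      obtain ⟨m, hm⟩ := exists_nat_one_div_lt hε
      linarith [h m]
  have ht := tendsto_measure_iInter_atTop (μ := ν)
    (s := fun m : ℕ => closedBall x (r + 1 / ((m : ℝ) + 1)))
    (fun m => measurableSet_closedBall.nullMeasurableSet)
    (fun a b hab => closedBall_subset_closedBall (by
      have : 1 / ((b : ℝ) + 1) ≤ 1 / ((a : ℝ) + 1) := Nat.one_div_le_one_div hab
      linarith)) ⟨0, hf _ _⟩
  rw [← hI] at ht
  obtain ⟨m, hm⟩ := (ht.eventually (gt_mem_nhds hc)).exists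
  have hp : (0 : ℝ) < 1 / ((m : ℝ) + 1) := by positivity
  filter_upwards [ball_mem_nhds x hp] with y hy
  refine lt_of_le_of_lt (measure_mono ?_) hm
  apply closedBall_subset_closedBall'
  rw [mem_ball] at hy
  linarith

theorem Gf_meas (n d : ℕ) (μ : Measure (EuclideanSpace ℝ (Fin d))) [IsFiniteMeasure μ] (r : ℝ) :
    Measurable fun x => Gf n d μ x r := by
  apply UpperSemicontinuous.measurable
  unfold Gf
  apply upperSemicontinuous_iInf
  rintro ⟨L, hL⟩
  set f : EuclideanSpace ℝ (Fin d) → ℝ≥0∞ :=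
    fun y => ENNReal.ofReal ((infDist y (L : Set (EuclideanSpace ℝ (Fin d)))) ^ 2) with hfd
  have hfc : Continuous fun y => (infDist y (L : Set (EuclideanSpace ℝ (Fin d)))) ^ 2 :=
    (continuous_infDist_pt _).pow 2
  have := usc_ball d (μ.withDensity f) r (by
    intro x r
    rw [withDensity_apply _ measurableSet_closedBall]
    obtain ⟨C, hC⟩ := (isCompact_closedBall x r).exists_bound_of_continuousOn hfc.continuousOn
    refine ne_of_lt (lt_of_le_of_lt (setLIntegral_mono' (g := fun _ => ENNReal.ofReal C)
      measurableSet_closedBall ?_) ?_)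
    · intro y hy
      exact ENNReal.ofReal_le_ofReal ((le_abs_self _).trans (hC y hy))
    · rw [setLIntegral_const]
      exact ENNReal.mul_lt_top ENNReal.ofReal_lt_top (measure_lt_top _ _))
  simpa only [withDensity_apply _ measurableSet_closedBall] using this

theorem ball_meas (d : ℕ) (μ : Measure (EuclideanSpace ℝ (Fin d))) [IsFiniteMeasure μ] (r : ℝ) :
    Measurable fun x => μ (closedBall x r) :=
  (usc_ball d μ r fun _ _ => measure_ne_top _ _).measurable

/-- Dyadic scale. -/
noncomputable def Sc (i : ℕ) : ℝ := (1 / 2) ^ i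

theorem Sc_pos (i : ℕ) : 0 < Sc i := by unfold Sc; positivity

theorem Sc_succ (i : ℕ) : Sc i = 2 * Sc (i + 1) := by unfold Sc; rw [pow_succ]; ring

theorem Sc_anti : Antitone Sc := fun a b h => pow_le_pow_of_le_one (by norm_num) (by norm_num) h

/-- Discrete Jones term. -/
noncomputable def Jt (p : ℝ) (n d : ℕ) (μ : Measure (EuclideanSpace ℝ (Fin d))) (i : ℕ)
    (x : EuclideanSpace ℝ (Fin d)) : ℝ≥0∞ :=
  beta2sq n d μ x (Sc i) * densityN n d μ x (Sc i) ^ p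

theorem Jt_meas (p : ℝ) (n d : ℕ) (μ : Measure (EuclideanSpace ℝ (Fin d))) [IsFiniteMeasure μ]
    (i : ℕ) : Measurable (Jt p n d μ i) := by
  have : Jt p n d μ i = fun x => Gf n d μ x (Sc i) / ENNReal.ofReal ((Sc i) ^ (n + 2)) *
      (μ (closedBall x (Sc i)) / ENNReal.ofReal ((Sc i) ^ n)) ^ p := by
    ext x
    unfold Jt
    rw [beta_eq _ _ _ _ _ (Sc_pos i)]; rfl
  rw [this]
  exact ((Gf_meas n d μ _).div_const _).mul (((ball_meas d μ _).div_const _).pow_const p)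

theorem beta_mono (n d : ℕ) (μ : Measure (EuclideanSpace ℝ (Fin d)))
    (x z : EuclideanSpace ℝ (Fin d)) (r s : ℝ) (hr : 0 < r) (hs : 0 < s)
    (h : closedBall x r ⊆ closedBall z s) :
    beta2sq n d μ x r ≤ ENNReal.ofReal ((s / r) ^ (n + 2)) * beta2sq n d μ z s := by
  have h1 : ENNReal.ofReal (s ^ (n + 2)) ≠ 0 := by
    have : 0 < s ^ (n + 2) := by positivity
    simpa using this
  rw [beta_eq _ _ _ _ _ hr, beta_eq _ _ _ _ _ hs, div_pow,
    ENNReal.ofReal_div_of_pos (by positivity)]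
  calc _ ≤ Gf n d μ z s / ENNReal.ofReal (r ^ (n + 2)) :=
        ENNReal.div_le_div_right (Gf_mono _ _ _ _ _ _ _ h) _
    _ = (ENNReal.ofReal (s ^ (n + 2)) * (ENNReal.ofReal (s ^ (n + 2)))⁻¹) *
          (Gf n d μ z s / ENNReal.ofReal (r ^ (n + 2))) := by
        rw [ENNReal.mul_inv_cancel h1 ENNReal.ofReal_ne_top, one_mul]
    _ = _ := by simp only [div_eq_mul_inv]; ring

theorem dens_mono (n d : ℕ) (μ : Measure (EuclideanSpace ℝ (Fin d)))
    (x z : EuclideanSpace ℝ (Fin d)) (r s : ℝ) (hr : 0 < r) (hs : 0 < s)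
    (h : closedBall x r ⊆ closedBall z s) :
    densityN n d μ x r ≤ ENNReal.ofReal ((s / r) ^ n) * densityN n d μ z s := by
  have h1 : ENNReal.ofReal (s ^ n) ≠ 0 := by
    have : 0 < s ^ n := by positivity
    simpa using this
  unfold densityN
  rw [div_pow, ENNReal.ofReal_div_of_pos (by positivity)]
  calc _ ≤ μ (closedBall z s) / ENNReal.ofReal (r ^ n) :=
        ENNReal.div_le_div_right (measure_mono h) _
    _ = (ENNReal.ofReal (s ^ n) * (ENNReal.ofReal (s ^ n))⁻¹) *
          (μ (closedBall z s) / ENNReal.ofReal (r ^ n)) := by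
        rw [ENNReal.mul_inv_cancel h1 ENNReal.ofReal_ne_top, one_mul]
    _ = _ := by simp only [div_eq_mul_inv]; ring

theorem Jt_le (p : ℝ) (hp : 0 ≤ p) (n d : ℕ) (μ : Measure (EuclideanSpace ℝ (Fin d))) (i : ℕ)
    (x : EuclideanSpace ℝ (Fin d)) :
    Jt p n d μ (i + 1) x ≤ 2 * (ENNReal.ofReal (2 ^ (n + 2)) * ENNReal.ofReal (2 ^ n) ^ p) *
      ∫⁻ r in Ioo (Sc (i + 1)) (Sc i),
        beta2sq n d μ x r * densityN n d μ x r ^ p / ENNReal.ofReal r := by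
  set K := ENNReal.ofReal (2 ^ (n + 2)) * ENNReal.ofReal (2 ^ n) ^ p with hK
  have hS := Sc_pos (i + 1)
  have hKt : K ≠ ⊤ := ENNReal.mul_ne_top ENNReal.ofReal_ne_top
    (ENNReal.rpow_ne_top_of_nonneg hp ENNReal.ofReal_ne_top)
  set S := Sc (i + 1) with hSd
  have hSi : Sc i = 2 * S := Sc_succ i
  have hS0 : ENNReal.ofReal S ≠ 0 := by simpa using hS
  rw [hSi]
  have key : ∀ r ∈ Ioo S (2 * S), Jt p n d μ (i + 1) x / ENNReal.ofReal (2 * S) ≤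
      K * (beta2sq n d μ x r * densityN n d μ x r ^ p / ENNReal.ofReal r) := by
    intro r hr
    have hr0 : 0 < r := hS.trans hr.1
    have hsub : closedBall x S ⊆ closedBall x r := closedBall_subset_closedBall hr.1.le
    have hrs : r / S ≤ 2 := by rw [div_le_iff₀ hS]; exact hr.2.le
    have b1 := beta_mono n d μ x x S r hS hr0 hsub
    have b2 := dens_mono n d μ x x S r hS hr0 hsub
    have b1' : beta2sq n d μ x S ≤ ENNReal.ofReal (2 ^ (n + 2)) * beta2sq n d μ x r :=
      b1.trans (by gcongr)
    have b2' : densityN n d μ x S ^ p ≤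
        ENNReal.ofReal (2 ^ n) ^ p * densityN n d μ x r ^ p := by
      rw [← ENNReal.mul_rpow_of_nonneg _ _ hp]
      exact ENNReal.rpow_le_rpow (b2.trans (by gcongr)) hp
    unfold Jt
    rw [← hSd]
    calc _ ≤ (ENNReal.ofReal (2 ^ (n + 2)) * beta2sq n d μ x r) *
          (ENNReal.ofReal (2 ^ n) ^ p * densityN n d μ x r ^ p) / ENNReal.ofReal r := by
          refine ENNReal.div_le_div (mul_le_mul' b1' b2') (ENNReal.ofReal_le_ofReal hr.2.le)
      _ = _ := by simp only [div_eq_mul_inv, hK]; ring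
  have h1 : ∫⁻ r in Ioo S (2 * S), Jt p n d μ (i + 1) x / ENNReal.ofReal (2 * S) ≤
      K * ∫⁻ r in Ioo S (2 * S),
        beta2sq n d μ x r * densityN n d μ x r ^ p / ENNReal.ofReal r := by
    rw [← lintegral_const_mul' _ _ hKt]
    exact setLIntegral_mono' measurableSet_Ioo key
  rw [setLIntegral_const, Real.volume_Ioo] at h1
  have e : 2 * S - S = S := by ring
  rw [e, ENNReal.ofReal_mul (by norm_num)] at h1
  calc Jt p n d μ (i + 1) x = 2 * (Jt p n d μ (i + 1) x /
        (ENNReal.ofReal 2 * ENNReal.ofReal S) * ENNReal.ofReal S) := by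
        rw [div_eq_mul_inv, ENNReal.mul_inv (Or.inr ENNReal.ofReal_ne_top)
          (Or.inl ENNReal.ofReal_ne_top), mul_assoc, mul_assoc,
          ENNReal.inv_mul_cancel hS0 ENNReal.ofReal_ne_top, mul_one, mul_comm _ (_)⁻¹, ← mul_assoc]
        have : ENNReal.ofReal 2 = 2 := by simp
        rw [this, ENNReal.mul_inv_cancel (by norm_num) (by norm_num), one_mul]
    _ ≤ 2 * _ := mul_le_mul_right h1 2
    _ = _ := by ring

theorem Jt_sum (p : ℝ) (hp : 0 ≤ p) (n d : ℕ) (μ : Measure (EuclideanSpace ℝ (Fin d)))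
    (x : EuclideanSpace ℝ (Fin d))
    (h : (∫⁻ r in Set.Ioo (0 : ℝ) 1,
        beta2sq n d μ x r * densityN n d μ x r ^ p / ENNReal.ofReal r) < ⊤) :
    ∑' i, Jt p n d μ (i + 1) x < ⊤ := by
  refine lt_of_le_of_lt (ENNReal.tsum_le_tsum fun i => Jt_le p hp n d μ i x) ?_
  rw [ENNReal.tsum_mul_left]
  apply ENNReal.mul_lt_top
  · refine ENNReal.mul_lt_top (by norm_num) (ENNReal.mul_lt_top ENNReal.ofReal_lt_top
      (ENNReal.rpow_lt_top_of_nonneg hp ENNReal.ofReal_ne_top))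
  · rw [← lintegral_iUnion (fun i => measurableSet_Ioo)]
    · refine lt_of_le_of_lt (lintegral_mono_set ?_) h
      refine iUnion_subset fun i => Ioo_subset_Ioo (Sc_pos _).le ?_
      have := Sc_anti (Nat.zero_le i)
      simpa [Sc] using this
    · intro i j hij
      wlog hlt : i < j generalizing i j
      · exact (this hij.symm (by omega)).symm
      rw [Function.onFun, Set.disjoint_left]
      intro r h1 h2
      have := Sc_anti (show i + 1 ≤ j from hlt)
      exact absurd h1.1 (not_lt.2 (h2.2.le.trans this))

open MeasureTheory Metric Set Filter
open scoped ENNReal NNReal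

theorem cheb (n d : ℕ) (μ σ : Measure (EuclideanSpace ℝ (Fin d))) [IsFiniteMeasure μ]
    (hσ : σ ≤ μ) (S : Set (EuclideanSpace ℝ (Fin d))) (hS : MeasurableSet S)
    (f : EuclideanSpace ℝ (Fin d) → ℝ) (r : ℝ) (hr : 0 < r) (B : ℝ) (hB0 : 0 ≤ B)
    (hf : Measurable f) (h : ∫⁻ y in S, ENNReal.ofReal (f y ^ 2) ∂μ ≤ ENNReal.ofReal (B * r ^ (n + 2)))
    (T : Set (EuclideanSpace ℝ (Fin d))) (hT : T ⊆ S) (t : ℝ) (ht : 0 < t)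
    (hTf : ∀ y ∈ T, t * r < f y) :
    σ.real T ≤ B / t ^ 2 * r ^ n := by
  have hsub : T ⊆ S ∩ {y | t * r < f y} := fun y hy => ⟨hT hy, hTf y hy⟩
  have hm : MeasurableSet (S ∩ {y | t * r < f y}) := hS.inter (measurableSet_lt measurable_const hf)
  have h1 : ENNReal.ofReal ((t * r) ^ 2) * μ (S ∩ {y | t * r < f y}) ≤
      ENNReal.ofReal (B * r ^ (n + 2)) := by
    refine le_trans ?_ ((lintegral_mono_set (inter_subset_left (s := S) (t := {y | t * r < f y}))).trans h)
    rw [← setLIntegral_const]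
    apply setLIntegral_mono' hm
    intro y hy
    apply ENNReal.ofReal_le_ofReal
    have h0 : 0 < t * r := by positivity
    have h3 : t * r < f y := hy.2
    exact pow_le_pow_left₀ h0.le h3.le 2
  have h2 : σ.real T ≤ μ.real (S ∩ {y | t * r < f y}) := by
    unfold Measure.real
    exact ENNReal.toReal_mono (measure_ne_top _ _) ((hσ T).trans (measure_mono hsub))
  have h3 : (t * r) ^ 2 * μ.real (S ∩ {y | t * r < f y}) ≤ B * r ^ (n + 2) := by
    have := ENNReal.toReal_mono ENNReal.ofReal_ne_top h1
    rwa [ENNReal.toReal_mul, ENNReal.toReal_ofReal (by positivity),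
      ENNReal.toReal_ofReal (by positivity)] at this
  refine h2.trans ?_
  have h4 : 0 < (t * r) ^ 2 := by positivity
  refine le_of_mul_le_mul_left (h3.trans (le_of_eq ?_)) h4
  field_simp
  ring

theorem near (n d : ℕ) (μ : Measure (EuclideanSpace ℝ (Fin d)))
    (x : EuclideanSpace ℝ (Fin d)) (r ε : ℝ) (hε : 0 < ε) (h : Gf n d μ x r < ⊤) :
    ∃ L : AffineSubspace ℝ (EuclideanSpace ℝ (Fin d)), Module.finrank ℝ L.direction = n ∧
      ∫⁻ y in closedBall x r, ENNReal.ofReal ((infDist y (L : Set (EuclideanSpace ℝ (Fin d)))) ^ 2)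
        ∂μ ≤ ENNReal.ofReal ((Gf n d μ x r).toReal + ε) := by
  have h1 : Gf n d μ x r < ENNReal.ofReal ((Gf n d μ x r).toReal + ε) := by
    rw [ENNReal.lt_ofReal_iff_toReal_lt h.ne]; linarith
  unfold Gf at h1
  rw [iInf_lt_iff] at h1
  obtain ⟨⟨L, hL⟩, h2⟩ := h1
  exact ⟨L, hL, h2.le⟩

theorem exists_pt {n d : ℕ} (hn : 0 < n) (L : AffineSubspace ℝ (EuclideanSpace ℝ (Fin d)))
    (hL : Module.finrank ℝ L.direction = n) : ∃ p, p ∈ L := by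
  rcases L.eq_bot_or_nonempty with h | h
  · subst h
    rw [AffineSubspace.direction_bot, finrank_bot] at hL; omega
  · exact h

theorem iotaL {n d : ℕ} (L : AffineSubspace ℝ (EuclideanSpace ℝ (Fin d)))
    (hL : Module.finrank ℝ L.direction = n) (p0 : EuclideanSpace ℝ (Fin d)) (hp0 : p0 ∈ L) :
    ∃ ι : EuclideanSpace ℝ (Fin n) →ₗᵢ[ℝ] EuclideanSpace ℝ (Fin d),
      ∀ y, ‖hm ι p0 y‖ ≤ infDist y (L : Set (EuclideanSpace ℝ (Fin d))) := by
  let e := ((stdOrthonormalBasis ℝ L.direction).reindex (finCongr hL)).repr.symm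
  let ι : EuclideanSpace ℝ (Fin n) →ₗᵢ[ℝ] EuclideanSpace ℝ (Fin d) :=
    L.direction.subtypeₗᵢ.comp e.toLinearIsometry
  refine ⟨ι, fun y => ?_⟩
  rw [le_infDist ⟨p0, hp0⟩]
  intro z hz
  have hv : z - p0 ∈ L.direction := AffineSubspace.vsub_mem_direction hz hp0
  have hw : ι (e.symm ⟨z - p0, hv⟩) = z - p0 := by
    simp [ι]
  have h0 : hm ι p0 z = 0 := by
    unfold hm qm
    rw [← hw, adj_iota, sub_self]
  have := hm_le ι p0 y z
  rw [h0, sub_zero] at this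
  rwa [dist_eq_norm]

theorem dens_low (n d : ℕ) (μ : Measure (EuclideanSpace ℝ (Fin d)))
    (x x' : EuclideanSpace ℝ (Fin d)) (r Q τ : ℝ) (hr : 0 < r) (hQ : 0 < Q)
    (hsub : closedBall x' r ⊆ closedBall x (Q * r))
    (h : ENNReal.ofReal (τ * r ^ n) ≤ μ (closedBall x' r)) :
    ENNReal.ofReal (τ / Q ^ n) ≤ densityN n d μ x (Q * r) := by
  unfold densityN
  have e : τ / Q ^ n = τ * r ^ n / (Q * r) ^ n := by
    rw [mul_pow]; field_simp
  rw [e, ENNReal.ofReal_div_of_pos (by positivity)]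
  exact ENNReal.div_le_div_right (h.trans (measure_mono hsub)) _

theorem Gle (p : ℝ) (hp : 0 ≤ p) (n d : ℕ) (μ : Measure (EuclideanSpace ℝ (Fin d)))
    (x : EuclideanSpace ℝ (Fin d)) (r Q θ : ℝ) (hr : 0 < r) (hQ : 0 < Q) (hθ : 0 < θ)
    (h : ENNReal.ofReal θ ≤ densityN n d μ x (Q * r)) :
    Gf n d μ x (Q * r) / ENNReal.ofReal (r ^ (n + 2)) ≤ ENNReal.ofReal (Q ^ (n + 2) / θ ^ p) *
      (beta2sq n d μ x (Q * r) * densityN n d μ x (Q * r) ^ p) := by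
  have hθp : 0 < θ ^ p := Real.rpow_pos_of_pos hθ p
  have h1 : ENNReal.ofReal (θ ^ p) ≤ densityN n d μ x (Q * r) ^ p := by
    rw [← ENNReal.ofReal_rpow_of_nonneg hθ.le hp]
    exact ENNReal.rpow_le_rpow h hp
  refine le_trans ?_ (mul_le_mul_right (mul_le_mul_right h1 _) _)
  rw [beta_eq _ _ _ _ _ (by positivity), ENNReal.ofReal_div_of_pos hθp]
  have hQ0 : ENNReal.ofReal (Q ^ (n + 2)) ≠ 0 := by
    have : 0 < Q ^ (n + 2) := by positivity
    simpa using this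
  have hθ0 : ENNReal.ofReal (θ ^ p) ≠ 0 := by simpa using hθp
  rw [mul_pow, ENNReal.ofReal_mul (by positivity)]
  simp only [div_eq_mul_inv]
  rw [ENNReal.mul_inv (Or.inr ENNReal.ofReal_ne_top) (Or.inl ENNReal.ofReal_ne_top)]
  apply le_of_eq
  calc _ = (ENNReal.ofReal (Q ^ (n + 2)) * (ENNReal.ofReal (Q ^ (n + 2)))⁻¹) *
      (ENNReal.ofReal (θ ^ p) * (ENNReal.ofReal (θ ^ p))⁻¹) *
        (Gf n d μ x (Q * r) * (ENNReal.ofReal (r ^ (n + 2)))⁻¹) := by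
        rw [ENNReal.mul_inv_cancel hQ0 ENNReal.ofReal_ne_top,
          ENNReal.mul_inv_cancel hθ0 ENNReal.ofReal_ne_top, one_mul, one_mul]
    _ = _ := by ring

/-- Upper regularity for the restricted measure. -/
theorem upreg (n d : ℕ) (μ : Measure (EuclideanSpace ℝ (Fin d))) [IsFiniteMeasure μ]
    (E : Set (EuclideanSpace ℝ (Fin d))) (C : ℕ)
    (hU : ∀ x ∈ E, ∀ k ≥ C, μ (closedBall x (Sc k)) ≤ ENNReal.ofReal (C * Sc k ^ n))
    (x0 : EuclideanSpace ℝ (Fin d)) (hx0 : x0 ∈ E) (x : EuclideanSpace ℝ (Fin d)) (ρ : ℝ)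
    (hρ : 0 < ρ) :
    (μ.restrict (E ∩ closedBall x0 (Sc C))).real (closedBall x ρ) ≤ C * 4 ^ n * ρ ^ n := by
  have hmain : μ (closedBall x ρ ∩ (E ∩ closedBall x0 (Sc C))) ≤
      ENNReal.ofReal (C * 4 ^ n * ρ ^ n) := by
    by_cases hbig : Sc C ≤ 4 * ρ
    · refine (measure_mono (inter_subset_right.trans inter_subset_right)).trans
        ((hU x0 hx0 C le_rfl).trans (ENNReal.ofReal_le_ofReal ?_))
      rw [mul_assoc, ← mul_pow]
      have := (Sc_pos C).le
      gcongr
    push Not at hbig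
    rcases (closedBall x ρ ∩ (E ∩ closedBall x0 (Sc C))).eq_empty_or_nonempty with he | ⟨z, hz⟩
    · rw [he]; simp
    have hlim : ∃ k, Sc k < 2 * ρ := by
      obtain ⟨k, hk⟩ := exists_pow_lt_of_lt_one (show (0 : ℝ) < 2 * ρ by positivity)
        (show (1 / 2 : ℝ) < 1 by norm_num)
      exact ⟨k, hk⟩
    classical
    have hk := Nat.find_spec hlim
    set k := Nat.find hlim
    have hkC : C < k := by
      by_contra hcon
      have := Sc_anti (not_lt.1 hcon)
      linarith
    obtain ⟨j, hj⟩ : ∃ j, k = j + 1 := ⟨k - 1, by omega⟩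
    have hj2 : 2 * ρ ≤ Sc j := by
      have := Nat.find_min hlim (show j < k by omega)
      exact not_lt.1 this
    rw [hj] at hk
    have hjj := Sc_succ j
    refine (measure_mono (t := closedBall z (Sc j)) ?_).trans
      ((hU z hz.2.1 j (by omega)).trans (ENNReal.ofReal_le_ofReal ?_))
    · rintro y ⟨hy, -⟩
      rw [mem_closedBall] at *
      have := mem_closedBall.1 hz.1
      linarith [dist_triangle_right y z x]
    · rw [mul_assoc, ← mul_pow]
      have := (Sc_pos j).le
      have : Sc j ≤ 4 * ρ := by linarith
      gcongr
  unfold Measure.real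
  rw [Measure.restrict_apply measurableSet_closedBall]
  exact ENNReal.toReal_le_of_le_ofReal (by positivity) hmain

open MeasureTheory Metric Set Filter
open scoped ENNReal NNReal

theorem Sc_div (a k : ℕ) : Sc a / 2 ^ k = Sc (a + k) := by
  unfold Sc; rw [pow_add]; simp [div_eq_mul_inv]

theorem Sc_mul (a m : ℕ) : 4 * 2 ^ m * Sc (a + m + 2) = Sc a := by
  unfold Sc; rw [pow_add, pow_add]
  have : (1 / 2 : ℝ) ^ m * 2 ^ m = 1 := by rw [← mul_pow]; norm_num
  calc _ = (1 / 2 : ℝ) ^ a * ((1 / 2 : ℝ) ^ m * 2 ^ m) := by ring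
    _ = _ := by rw [this, mul_one]

set_option maxHeartbeats 4000000 in
/-- The core construction: reduce to the flat situation. -/
theorem core (p : ℝ) (hp : 0 ≤ p) (n : ℕ) (hn : 0 < n) (d : ℕ) (C : ℕ) (hC : 0 < C) :
    ∃ (m : ℕ) (ε : ℝ), 0 < ε ∧ ∀ (μ : Measure (EuclideanSpace ℝ (Fin d))) (_ : IsFiniteMeasure μ)
      (E : Set (EuclideanSpace ℝ (Fin d))), MeasurableSet E →
      (∀ x ∈ E, ∀ k ≥ C, μ (closedBall x (Sc k)) ≤ ENNReal.ofReal (C * Sc k ^ n)) →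
      ∀ i0 ≥ C, (∀ x ∈ E, ∑' k, Jt p n d μ (i0 + k) x ≤ ENNReal.ofReal ε) →
      ∀ x0 ∈ E, ENNReal.ofReal ((2 * C : ℝ)⁻¹ * Sc (i0 + m + 3) ^ n) ≤
        μ (E ∩ closedBall x0 (Sc (i0 + m + 3))) →
      ∃ (f : EuclideanSpace ℝ (Fin n) → EuclideanSpace ℝ (Fin d)) (K : ℝ≥0), LipschitzWith K f ∧
        0 < μ (E ∩ range f) := by
  have hC' : (0 : ℝ) < C := by exact_mod_cast hC
  set c0 : ℝ := (2 * C : ℝ)⁻¹ / 2 ^ n with hc0d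
  have hc0 : 0 < c0 := by positivity
  set C0 : ℝ := C * 4 ^ n with hC0d
  have hC0 : 0 < C0 := by positivity
  set τ : ℝ := c0 / 4 / (1 + 10 ^ n) with hτd
  have hτ : 0 < τ := by positivity
  have hτc : τ * (1 + 10 ^ n) ≤ c0 / 4 := by
    rw [hτd, div_mul_cancel₀]; positivity
  set δ : ℝ := min (1 / 4) (τ / (32 * 60 ^ n * C0)) with hδd
  have hδ : 0 < δ := by rw [hδd]; positivity
  have hδ1 : δ ≤ 1 / 4 := min_le_left _ _
  have hδτ : 8 * 60 ^ n * C0 * δ < τ / 2 := by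
    have h1 : δ ≤ τ / (32 * 60 ^ n * C0) := min_le_right _ _
    rw [le_div_iff₀ (by positivity)] at h1
    linarith
  obtain ⟨m, hmm⟩ := pow_unbounded_of_one_lt (100 * ((n : ℝ) + 1)) (show (1 : ℝ) < 2 by norm_num)
  obtain ⟨η, ⟨hη1, hη2, hfin⟩, hη⟩ :=
    ((small_ok n hn C0 τ δ c0 hτ hδ hc0 hτc).and self_mem_nhdsWithin).exists
  replace hη : 0 < η := hη
  set M : ℝ := 2 ^ m with hMd
  have hM1 : 100 ≤ M := by
    have : (0 : ℝ) ≤ n := by positivity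
    nlinarith
  set θ : ℝ := τ / (4 * M) ^ n with hθd
  have hθ : 0 < θ := by positivity
  set κ : ℝ := (4 * M) ^ (n + 2) / θ ^ p with hκd
  have hκ : 0 < κ := by
    have := Real.rpow_pos_of_pos hθ p
    positivity
  refine ⟨m, η / (2 * κ), by positivity, ?_⟩
  intro μ hμ E hE hU i0 hi0 hJ x0 hx0 hlow
  set r0 := Sc (i0 + m + 2) with hr0d
  have hr0 : 0 < r0 := Sc_pos _
  have hr0h : r0 / 2 = Sc (i0 + m + 3) := by
    have := Sc_div (i0 + m + 2) 1
    rw [pow_one] at this; rw [hr0d, this]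
  have hrk : ∀ k : ℕ, 0 < r0 / 2 ^ k := fun k => by positivity
  have hsc : ∀ k : ℕ, 4 * M * (r0 / 2 ^ k) = Sc (i0 + k) := by
    intro k
    rw [hr0d, Sc_div, show i0 + m + 2 + k = (i0 + k) + m + 2 by ring, hMd, Sc_mul]
  set σ := μ.restrict (E ∩ closedBall x0 (Sc C)) with hσd
  have hσμ : σ ≤ μ := Measure.restrict_le_self
  have hσf : IsFiniteMeasure σ := by rw [hσd]; infer_instance
  set B0 := E ∩ closedBall x0 (r0 / 2) with hB0d
  have hB0m : MeasurableSet B0 := hE.inter measurableSet_closedBall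
  have hB0s : B0 ⊆ E ∩ closedBall x0 (Sc C) := by
    refine inter_subset_inter_right _ (closedBall_subset_closedBall ?_)
    rw [hr0h]
    exact Sc_anti (by omega)
  have hσB0 : σ B0 = μ B0 := by
    rw [hσd, Measure.restrict_apply hB0m, inter_eq_left.2 hB0s]
  have hB0low : ENNReal.ofReal (c0 * r0 ^ n) ≤ μ B0 := by
    rw [hB0d, hr0h]
    refine le_trans (ENNReal.ofReal_le_ofReal (le_of_eq ?_)) hlow
    rw [← hr0h, hc0d, div_pow]; ring
  have hJfin : ∀ x ∈ E, ∀ k, Jt p n d μ (i0 + k) x < ⊤ := fun x hx k =>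
    lt_of_le_of_lt ((ENNReal.le_tsum k).trans (hJ x hx)) ENNReal.ofReal_lt_top
  have hGfin : ∀ x ∈ E, ∀ k : ℕ, 0 < μ (closedBall x (4 * M * (r0 / 2 ^ k))) →
      Gf n d μ x (4 * M * (r0 / 2 ^ k)) < ⊤ := by
    intro x hx k hpos
    have h1 := hJfin x hx k
    unfold Jt at h1
    rw [← hsc k] at h1
    have hs : 0 < 4 * M * (r0 / 2 ^ k) := by positivity
    have h2 : densityN n d μ x (4 * M * (r0 / 2 ^ k)) ^ p ≠ 0 := by
      unfold densityN
      have hne : μ (closedBall x (4 * M * (r0 / 2 ^ k))) /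
          ENNReal.ofReal ((4 * M * (r0 / 2 ^ k)) ^ n) ≠ 0 :=
        (ENNReal.div_pos hpos.ne' ENNReal.ofReal_ne_top).ne'
      have hnt : μ (closedBall x (4 * M * (r0 / 2 ^ k))) /
          ENNReal.ofReal ((4 * M * (r0 / 2 ^ k)) ^ n) ≠ ⊤ := by
        refine (ENNReal.div_lt_top (measure_ne_top _ _) ?_).ne
        have : 0 < (4 * M * (r0 / 2 ^ k)) ^ n := by positivity
        simpa using this
      exact (ENNReal.rpow_pos (pos_iff_ne_zero.2 hne) hnt).ne'
    have h3 : beta2sq n d μ x (4 * M * (r0 / 2 ^ k)) ≠ ⊤ := by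
      intro h; rw [h, ENNReal.top_mul h2] at h1; exact lt_irrefl _ h1
    rw [beta_eq _ _ _ _ _ hs] at h3
    by_contra hcon
    rw [not_lt, top_le_iff] at hcon
    rw [hcon] at h3
    exact h3 (ENNReal.top_div_of_ne_top ENNReal.ofReal_ne_top)
  set s : ℕ → ℝ := fun k => η / 4 * (1 / 2) ^ k with hsd
  have hs : ∀ k, 0 < s k := fun k => by simp only [hsd]; positivity
  set cw : EuclideanSpace ℝ (Fin d) → ℕ → EuclideanSpace ℝ (Fin d) :=
    fun x k => if k = 0 then x0 else x with hcw
  set b : EuclideanSpace ℝ (Fin d) → ℕ → ℝ := fun x k =>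
    (Gf n d μ (cw x k) (2 * M * (r0 / 2 ^ k))).toReal / (r0 / 2 ^ k) ^ (n + 2) + s k with hbd
  set g : ℕ → EuclideanSpace ℝ (Fin d) → ℝ≥0∞ := fun k x =>
    ENNReal.ofReal κ * Jt p n d μ (i0 + k) x + ENNReal.ofReal (s k) with hgd
  have hb : ∀ x k, 0 < b x k := by
    intro x k
    simp only [hbd]
    have := hs k
    positivity
  have hbr : ∀ x k, b x k * (r0 / 2 ^ k) ^ (n + 2) =
      (Gf n d μ (cw x k) (2 * M * (r0 / 2 ^ k))).toReal + s k * (r0 / 2 ^ k) ^ (n + 2) := by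
    intro x k
    simp only [hbd]
    have := hrk k
    field_simp
  have hcwd : ∀ x' ∈ B0, ∀ k, dist (cw x' k) x' ≤ r0 / 2 ^ k := by
    intro x' hx' k
    simp only [hcw]
    split_ifs with hk
    · subst hk
      have := mem_closedBall.1 hx'.2
      rw [dist_comm]; simp; linarith
    · simp only [dist_self]; exact (hrk k).le
  have hcwE : ∀ x' ∈ B0, ∀ k, cw x' k ∈ E := by
    intro x' hx' k
    simp only [hcw]
    split_ifs with hk
    · exact hx0
    · exact hx'.1
  have hsig : ∀ x' (k : ℕ), τ * (r0 / 2 ^ k) ^ n ≤ σ.real (closedBall x' (r0 / 2 ^ k)) →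
      ENNReal.ofReal (τ * (r0 / 2 ^ k) ^ n) ≤ μ (closedBall x' (r0 / 2 ^ k)) := by
    intro x' k h
    refine le_trans ?_ (hσμ _)
    rw [ENNReal.ofReal_le_iff_le_toReal (measure_ne_top _ _)]
    exact h
  have hg1 : ∀ x' ∈ B0, ∀ k, τ * (r0 / 2 ^ k) ^ n ≤ σ.real (closedBall x' (r0 / 2 ^ k)) →
      ∀ x ∈ closedBall x' (r0 / 2 ^ k), ENNReal.ofReal (b x' k) ≤ g k x := by
    intro x' hx' k hd x hx
    have hr := hrk k
    rw [mem_closedBall] at hx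
    have hsub : closedBall x' (r0 / 2 ^ k) ⊆ closedBall x (4 * M * (r0 / 2 ^ k)) := by
      apply closedBall_subset_closedBall'
      rw [dist_comm]; nlinarith
    have hdl := dens_low n d μ x x' (r0 / 2 ^ k) (4 * M) τ hr (by positivity) hsub (hsig x' k hd)
    have hG := Gle p hp n d μ x (r0 / 2 ^ k) (4 * M) θ hr (by positivity) hθ hdl
    simp only [hgd, hbd]
    rw [ENNReal.ofReal_add (by positivity) (hs k).le]
    refine add_le_add ?_ le_rfl
    rw [ENNReal.ofReal_div_of_pos (by positivity)]
    unfold Jt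
    rw [← hsc k]
    refine le_trans (ENNReal.div_le_div_right ?_ _) hG
    refine ENNReal.ofReal_toReal_le.trans (Gf_mono _ _ _ _ _ _ _ ?_)
    apply closedBall_subset_closedBall'
    have h1 := hcwd x' hx' k
    have h2 := dist_triangle (cw x' k) x' x
    rw [dist_comm x' x] at h2
    nlinarith
  have hg2 : ∀ᵐ x ∂σ, ∑' k, g k x ≤ ENNReal.ofReal η := by
    have hme : MeasurableSet (E ∩ closedBall x0 (Sc C)) := hE.inter measurableSet_closedBall
    filter_upwards [ae_restrict_mem hme] with x hx
    simp only [hgd]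
    rw [ENNReal.tsum_add, ENNReal.tsum_mul_left]
    have h1 : ∑' k, ENNReal.ofReal (s k) = ENNReal.ofReal (η / 2) := by
      have hsum : HasSum s (η / 4 * 2) := hasSum_geometric_two.mul_left (η / 4)
      rw [← ENNReal.ofReal_tsum_of_nonneg (fun k => (hs k).le) hsum.summable, hsum.tsum_eq]
      congr 1; ring
    have h2 : ENNReal.ofReal κ * ∑' k, Jt p n d μ (i0 + k) x ≤ ENNReal.ofReal (η / 2) := by
      refine (mul_le_mul_right (hJ x hx.1) _).trans (le_of_eq ?_)
      rw [← ENNReal.ofReal_mul hκ.le]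
      congr 1; field_simp
    rw [h1]
    refine (add_le_add h2 le_rfl).trans (le_of_eq ?_)
    rw [← ENNReal.ofReal_add (by positivity) (by positivity)]
    congr 1; ring
  have hpos0 : 0 < μ B0 := lt_of_lt_of_le (by
    have : 0 < c0 * r0 ^ n := by positivity
    simpa using this) hB0low
  have hG2 : ∀ x (k : ℕ), Gf n d μ x (2 * M * (r0 / 2 ^ k)) ≤ Gf n d μ x (4 * M * (r0 / 2 ^ k)) := by
    intro x k
    apply Gf_mono
    apply closedBall_subset_closedBall
    nlinarith [hrk k]
  -- reference plane
  have hGx0 : Gf n d μ x0 (2 * M * (r0 / 2 ^ 0)) < ⊤ := by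
    refine lt_of_le_of_lt (hG2 x0 0) (hGfin x0 hx0 0 (hpos0.trans_le (measure_mono ?_)))
    refine inter_subset_right.trans (closedBall_subset_closedBall ?_)
    simp only [pow_zero, div_one]
    nlinarith
  obtain ⟨L0, hL0, hint0⟩ := near n d μ x0 (2 * M * (r0 / 2 ^ 0)) (s 0 * (r0 / 2 ^ 0) ^ (n + 2))
    (by have := hs 0; positivity) hGx0
  obtain ⟨p0, hp0⟩ := exists_pt hn L0 hL0
  obtain ⟨ι, hι⟩ := iotaL L0 hL0 p0 hp0
  have plane0 : ∀ x ∈ B0, Cl ι p0 σ x (M * r0) r0 (4 * b x 0) 0 := by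
    intro x hx t ht
    have hb0 := hb x 0
    have hbe := hbr x 0
    simp only [hcw, if_true] at hbe
    rw [← hbe] at hint0
    simp only [pow_zero, div_one] at hint0
    have := cheb n d μ σ hσμ (closedBall x0 (2 * M * r0)) measurableSet_closedBall
      (fun y => infDist y (L0 : Set (EuclideanSpace ℝ (Fin d)))) r0 hr0 (b x 0) hb0.le
      (continuous_infDist_pt _).measurable hint0
      {y ∈ closedBall x (M * r0) | t * r0 < ‖hm ι p0 y - ev (0 : Aff n d) (qm ι p0 y)‖} ?_ t ht ?_
    · refine this.trans ?_
      have h4 : b x 0 ≤ 4 * b x 0 := by linarith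
      gcongr
    · rintro y ⟨hy, -⟩
      have h5 := mem_closedBall.1 hx.2
      have h6 : r0 / 2 ≤ M * r0 := by nlinarith
      exact closedBall_subset_closedBall' (show M * r0 + dist x x0 ≤ 2 * M * r0 by linarith) hy
    · rintro y ⟨-, hy⟩
      have e : ev (0 : Aff n d) (qm ι p0 y) = 0 := by simp [ev]
      rw [e, sub_zero] at hy
      exact hy.trans_le (hι y)
  have plane : ∀ x ∈ B0, ∀ k, 1 ≤ k →
      τ * (r0 / 2 ^ k) ^ n ≤ σ.real (closedBall x (r0 / 2 ^ k)) →
      ∃ (L : AffineSubspace ℝ (EuclideanSpace ℝ (Fin d))) (pL : EuclideanSpace ℝ (Fin d)),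
      pL ∈ L ∧ Module.finrank ℝ L.direction = n ∧
      ∀ t : ℝ, 0 < t → σ.real {y ∈ closedBall x (M * (r0 / 2 ^ k)) | t * (r0 / 2 ^ k) <
        infDist y (L : Set (EuclideanSpace ℝ (Fin d)))} ≤ b x k / t ^ 2 * (r0 / 2 ^ k) ^ n := by
    intro x hx k hk hd
    have hr := hrk k
    have hc : cw x k = x := by simp only [hcw]; rw [if_neg (by omega)]
    have hGx : Gf n d μ x (2 * M * (r0 / 2 ^ k)) < ⊤ := by
      refine lt_of_le_of_lt (hG2 x k) (hGfin x hx.1 k ?_)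
      have h1 : 0 < μ (closedBall x (r0 / 2 ^ k)) := lt_of_lt_of_le (by
        have : 0 < τ * (r0 / 2 ^ k) ^ n := by positivity
        exact ENNReal.ofReal_pos.2 this) (hsig x k hd)
      refine h1.trans_le (measure_mono (closedBall_subset_closedBall ?_))
      nlinarith
    obtain ⟨L, hL, hintg⟩ := near n d μ x (2 * M * (r0 / 2 ^ k)) (s k * (r0 / 2 ^ k) ^ (n + 2))
      (by have := hs k; positivity) hGx
    obtain ⟨pL, hpL⟩ := exists_pt hn L hL
    refine ⟨L, pL, hpL, hL, fun t ht => ?_⟩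
    have hbe := hbr x k
    rw [hc] at hbe
    rw [← hbe] at hintg
    refine cheb n d μ σ hσμ (closedBall x (2 * M * (r0 / 2 ^ k))) measurableSet_closedBall
      (fun y => infDist y (L : Set (EuclideanSpace ℝ (Fin d)))) _ hr (b x k) (hb x k).le
      (continuous_infDist_pt _).measurable hintg _ ?_ t ht ?_
    · rintro y ⟨hy, -⟩
      refine closedBall_subset_closedBall ?_ hy
      nlinarith
    · rintro y ⟨-, hy⟩
      exact hy
  let A : Dat n d := {
    σ := σ, fin := hσf, hn := hn, ι := ι, p0 := p0, x0 := x0, r0 := r0, hr0 := hr0, B0 := B0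
    hB0 := inter_subset_right, C0 := C0, hC0 := hC0.le
    hreg := fun x ρ hρ => upreg n d μ E C hU x0 hx0 x ρ hρ
    τ := τ, δ := δ, η := η, M := M, hδ := hδ, hδ1 := hδ1, hδτ := hδτ, hM := hmm.le, hη := hη
    hη1 := hη1, hη2 := hη2, b := b, hb := hb, g := g, hg1 := hg1, hg2 := hg2, plane0 := plane0
    plane := plane }
  obtain ⟨f, K, hf, hpos⟩ := hfin d A rfl rfl rfl rfl (by
    change ENNReal.ofReal (c0 * r0 ^ n) ≤ σ B0
    rw [hσB0]; exact hB0low)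
  refine ⟨f, K, hf, lt_of_lt_of_le hpos ((hσμ _).trans (measure_mono ?_))⟩
  exact inter_subset_inter_left _ inter_subset_left

open MeasureTheory Metric Set Filter
open scoped ENNReal NNReal

/-- Upper density control. -/
def Us (n d : ℕ) (μ : Measure (EuclideanSpace ℝ (Fin d))) (C : ℕ) :
    Set (EuclideanSpace ℝ (Fin d)) :=
  {x | ∀ k ≥ C, μ (closedBall x (Sc k)) ≤ ENNReal.ofReal (C * Sc k ^ n)}

/-- Lower density control along a subsequence. -/
def Ls (n d : ℕ) (μ : Measure (EuclideanSpace ℝ (Fin d))) (C : ℕ) :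
    Set (EuclideanSpace ℝ (Fin d)) :=
  {x | ∀ N, ∃ k ≥ N, ENNReal.ofReal ((C : ℝ)⁻¹ * Sc k ^ n) ≤ μ (closedBall x (Sc k))}

theorem Us_meas (n d : ℕ) (μ : Measure (EuclideanSpace ℝ (Fin d))) [IsFiniteMeasure μ] (C : ℕ) :
    MeasurableSet (Us n d μ C) := by
  have : Us n d μ C = ⋂ k, ⋂ (_ : k ≥ C),
      {x | μ (closedBall x (Sc k)) ≤ ENNReal.ofReal (C * Sc k ^ n)} := by
    ext x; simp [Us]
  rw [this]
  exact MeasurableSet.iInter fun k => MeasurableSet.iInter fun _ =>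
    measurableSet_le (ball_meas d μ _) measurable_const

theorem Ls_meas (n d : ℕ) (μ : Measure (EuclideanSpace ℝ (Fin d))) [IsFiniteMeasure μ] (C : ℕ) :
    MeasurableSet (Ls n d μ C) := by
  have : Ls n d μ C = ⋂ N : ℕ, ⋃ k, ⋃ (_ : k ≥ N),
      {x | ENNReal.ofReal ((C : ℝ)⁻¹ * Sc k ^ n) ≤ μ (closedBall x (Sc k))} := by
    ext x; simp [Ls]
  rw [this]
  exact MeasurableSet.iInter fun N => MeasurableSet.iUnion fun k => MeasurableSet.iUnion fun _ =>
    measurableSet_le measurable_const (ball_meas d μ _)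

theorem Us_mono (n d : ℕ) (μ : Measure (EuclideanSpace ℝ (Fin d))) : Monotone (Us n d μ) := by
  intro a b hab x hx k hk
  refine (hx k (hab.trans hk)).trans (ENNReal.ofReal_le_ofReal ?_)
  have := (Sc_pos k).le
  have : (a : ℝ) ≤ b := by exact_mod_cast hab
  gcongr

theorem Ls_mono (n d : ℕ) (μ : Measure (EuclideanSpace ℝ (Fin d))) (a b : ℕ) (ha : 0 < a)
    (hab : a ≤ b) : Ls n d μ a ⊆ Ls n d μ b := by
  intro x hx N
  obtain ⟨k, hk, h⟩ := hx N
  refine ⟨k, hk, le_trans (ENNReal.ofReal_le_ofReal ?_) h⟩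
  have := (Sc_pos k).le
  have h1 : (a : ℝ) ≤ b := by exact_mod_cast hab
  have h2 : (0 : ℝ) < a := by exact_mod_cast ha
  gcongr

theorem Sc_tendsto : Tendsto Sc atTop (nhdsWithin 0 (Ioi 0)) := by
  rw [tendsto_nhdsWithin_iff]
  refine ⟨tendsto_pow_atTop_nhds_zero_of_lt_one (by norm_num) (by norm_num), ?_⟩
  exact Eventually.of_forall fun k => Sc_pos k

theorem mem_Us (n d : ℕ) (μ : Measure (EuclideanSpace ℝ (Fin d)))
    (x : EuclideanSpace ℝ (Fin d)) (h : upperDensity n d μ x < ⊤) : ∃ C, x ∈ Us n d μ C := by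
  obtain ⟨c, h1, h2⟩ := exists_between h
  have h3 := Sc_tendsto.eventually (eventually_lt_of_limsup_lt h1)
  obtain ⟨N, hN⟩ := eventually_atTop.1 h3
  obtain ⟨C, hC⟩ := exists_nat_gt (c.toReal * 2 ^ n)
  refine ⟨max N C, fun k hk => ?_⟩
  have h4 := hN k ((le_max_left _ _).trans hk)
  have hS := Sc_pos k
  have hp : 0 < (2 * Sc k) ^ n := by positivity
  have h5 := (ENNReal.div_le_iff (by simpa using hp) ENNReal.ofReal_ne_top).1 h4.le
  refine h5.trans ?_
  rw [← ENNReal.ofReal_toReal h2.ne, ← ENNReal.ofReal_mul (by positivity)]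
  apply ENNReal.ofReal_le_ofReal
  have h6 : (C : ℝ) ≤ (max N C : ℕ) := by exact_mod_cast le_max_right _ _
  rw [mul_pow, ← mul_assoc]
  have h7 := hC.le.trans h6
  gcongr

theorem mem_Ls (n d : ℕ) (μ : Measure (EuclideanSpace ℝ (Fin d)))
    (x : EuclideanSpace ℝ (Fin d)) (h : 0 < upperDensity n d μ x) :
    ∃ C, 0 < C ∧ x ∈ Ls n d μ C := by
  obtain ⟨c, h1, h2⟩ := exists_between h
  have hf := frequently_lt_of_lt_limsup (by isBoundedDefault) h2
  have hct : c ≠ ⊤ := (h2.trans_le le_top).ne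
  have hc0 : 0 < c.toReal := ENNReal.toReal_pos h1.ne' hct
  obtain ⟨C, hC⟩ := exists_nat_gt (c.toReal)⁻¹
  have hC0 : (0 : ℝ) < C := lt_trans (by positivity) hC
  refine ⟨C, by exact_mod_cast hC0, fun N => ?_⟩
  have hev : ∀ᶠ r in nhdsWithin (0 : ℝ) (Ioi 0), r ∈ Ioo 0 (Sc N) :=
    Ioo_mem_nhdsGT (Sc_pos N)
  obtain ⟨r, hr1, hr2⟩ := (hf.and_eventually hev).exists
  have hlim : ∃ k, Sc k < r := by
    obtain ⟨k, hk⟩ := exists_pow_lt_of_lt_one hr2.1 (show (1 / 2 : ℝ) < 1 by norm_num)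
    exact ⟨k, hk⟩
  classical
  have hk := Nat.find_spec hlim
  have hmin := fun j => Nat.find_min (m := j) hlim
  generalize Nat.find hlim = k at hk hmin
  have hkN : N < k := by
    by_contra hcon
    have := Sc_anti (not_lt.1 hcon)
    linarith [hr2.2]
  obtain ⟨j, rfl⟩ : ∃ j, k = j + 1 := ⟨k - 1, by omega⟩
  have hj := not_lt.1 (hmin j (by omega))
  refine ⟨j, by omega, ?_⟩
  have hr0 := hr2.1
  have hp : 0 < (2 * r) ^ n := by positivity
  have h5 := (ENNReal.lt_div_iff_mul_lt (Or.inl (by simpa using hp))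
    (Or.inl ENNReal.ofReal_ne_top)).1 hr1
  refine le_trans ?_ (h5.le.trans (measure_mono (closedBall_subset_closedBall hj)))
  rw [← ENNReal.ofReal_toReal hct, ← ENNReal.ofReal_mul (by positivity)]
  apply ENNReal.ofReal_le_ofReal
  have hS := Sc_pos j
  have h6 : Sc j ≤ 2 * r := by rw [Sc_succ j]; linarith
  have h7 : (C : ℝ)⁻¹ ≤ c.toReal := by
    rw [inv_le_comm₀ hC0 hc0]; exact hC.le
  gcongr

/-- Every set of positive measure meets some Lipschitz image. -/
theorem select (p : ℝ) (hp : 0 ≤ p) (n : ℕ) (hn : 0 < n) (d : ℕ)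
    (μ : Measure (EuclideanSpace ℝ (Fin d))) [IsFiniteMeasure μ]
    (hdens : ∀ᵐ x ∂μ, 0 < upperDensity n d μ x ∧ upperDensity n d μ x < ⊤)
    (hjones : ∀ᵐ x ∂μ,
      (∫⁻ r in Set.Ioo (0 : ℝ) 1,
        beta2sq n d μ x r * densityN n d μ x r ^ p / ENNReal.ofReal r) < ⊤)
    (F : Set (EuclideanSpace ℝ (Fin d))) (hF : MeasurableSet F) (hFp : μ F ≠ 0) :
    ∃ (f : EuclideanSpace ℝ (Fin n) → EuclideanSpace ℝ (Fin d)) (K : ℝ≥0), LipschitzWith K f ∧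
      0 < μ (F ∩ range f) := by
  obtain ⟨C, hC⟩ : ∃ C : ℕ, μ (F ∩ (Us n d μ (C + 1) ∩ Ls n d μ (C + 1) ∩
      {x | ∑' i, Jt p n d μ (i + 1) x < ⊤})) ≠ 0 := by
    by_contra hcon
    push Not at hcon
    apply hFp
    have h0 := measure_iUnion_null hcon
    rw [measure_eq_zero_iff_ae_notMem] at h0 ⊢
    filter_upwards [h0, hdens, hjones] with x hx hd hj hxF
    apply hx
    obtain ⟨C1, h1⟩ := mem_Us n d μ x hd.2
    obtain ⟨C2, hC2, h2⟩ := mem_Ls n d μ x hd.1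
    rw [mem_iUnion]
    exact ⟨C1 + C2, hxF, ⟨Us_mono n d μ (by omega) h1, Ls_mono n d μ C2 _ hC2 (by omega) h2⟩,
      Jt_sum p hp n d μ x hj⟩
  obtain ⟨m, ε, hε, hcore⟩ := core p hp n hn d (C + 1) (by omega)
  set F1 := F ∩ (Us n d μ (C + 1) ∩ Ls n d μ (C + 1) ∩
      {x | ∑' i, Jt p n d μ (i + 1) x < ⊤}) with hF1
  obtain ⟨K, hK⟩ : ∃ K : ℕ, μ (F1 ∩
      {x | ∀ i ≥ K, ∑' k, Jt p n d μ (i + k) x ≤ ENNReal.ofReal ε}) ≠ 0 := by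
    by_contra hcon
    push Not at hcon
    apply hC
    have h0 := measure_iUnion_null hcon
    refine measure_mono_null ?_ h0
    intro x hx
    have ht := ENNReal.tendsto_sum_nat_add _ (ne_of_lt (show ∑' i, Jt p n d μ (i + 1) x < ⊤ from hx.2.2))
    have hε' : 0 < ENNReal.ofReal ε := by simpa using hε
    obtain ⟨N, hN⟩ := eventually_atTop.1 (ht.eventually (gt_mem_nhds hε'))
    rw [mem_iUnion]
    refine ⟨N + 1, hx, ?_⟩
    intro i hi
    have := hN (i - 1) (by omega)
    refine le_of_eq_of_le ?_ this.le
    apply tsum_congr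
    intro k
    congr 1; omega
  set E := F1 ∩ {x | ∀ i ≥ K, ∑' k, Jt p n d μ (i + k) x ≤ ENNReal.ofReal ε} with hEd
  have hEm : MeasurableSet E := by
    refine (hF.inter (((Us_meas n d μ _).inter (Ls_meas n d μ _)).inter ?_)).inter ?_
    · exact measurableSet_lt (Measurable.ennreal_tsum fun i => Jt_meas p n d μ _) measurable_const
    · have : {x | ∀ i ≥ K, ∑' k, Jt p n d μ (i + k) x ≤ ENNReal.ofReal ε} =
        ⋂ i, ⋂ (_ : i ≥ K), {x | ∑' k, Jt p n d μ (i + k) x ≤ ENNReal.ofReal ε} := by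
        ext x; simp
      rw [this]
      exact MeasurableSet.iInter fun k => MeasurableSet.iInter fun _ =>
        measurableSet_le (Measurable.ennreal_tsum fun i => Jt_meas p n d μ _) measurable_const
  have hne : (ae (μ.restrict E)).NeBot := by
    rw [ae_neBot]
    intro h
    exact hK (by rw [← Measure.restrict_apply_self, h]; simp)
  obtain ⟨x0, hx0t, hx0⟩ := ((Besicovitch.ae_tendsto_measure_inter_div μ E).and
    (ae_restrict_mem hEm)).exists
  have ht := (hx0t.comp Sc_tendsto).eventually (lt_mem_nhds (show (1 / 2 : ℝ≥0∞) < 1 by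
    rw [one_div]; exact ENNReal.one_half_lt_one))
  obtain ⟨N, hN⟩ := eventually_atTop.1 ht
  obtain ⟨k, hk, hkl⟩ := hx0.1.2.1.2 (N + K + C + m + 4)
  obtain ⟨i0, rfl⟩ : ∃ i0, k = i0 + m + 3 := ⟨k - m - 3, by omega⟩
  have h1 := hN _ (show i0 + m + 3 ≥ N by omega)
  simp only [Function.comp] at h1
  obtain ⟨f, L, hf, hpos⟩ := hcore μ inferInstance E hEm (fun x hx => hx.1.2.1.1) i0 (by omega)
    (fun x hx => hx.2 i0 (by omega)) x0 hx0 (by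
      have h2 := ENNReal.mul_le_of_le_div h1.le
      refine le_trans ?_ h2
      refine le_trans ?_ (mul_le_mul_right hkl _)
      have : (1 / 2 : ℝ≥0∞) = ENNReal.ofReal (1 / 2) := by
        rw [ENNReal.ofReal_div_of_pos (by norm_num)]; simp
      rw [this, ← ENNReal.ofReal_mul (by norm_num)]
      apply ENNReal.ofReal_le_ofReal
      apply le_of_eq
      rw [mul_inv]; ring)
  refine ⟨f, L, hf, hpos.trans_le (measure_mono (inter_subset_inter_left _ ?_))⟩
  exact inter_subset_left.trans inter_subset_left

theorem range_meas {n d : ℕ} (f : EuclideanSpace ℝ (Fin n) → EuclideanSpace ℝ (Fin d))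
    (hf : Continuous f) : MeasurableSet (range f) := by
  have : range f = ⋃ m : ℕ, f '' closedBall 0 m := by
    rw [← image_univ, ← iUnion_closedBall_nat (0 : EuclideanSpace ℝ (Fin n)), image_iUnion]
  rw [this]
  exact MeasurableSet.iUnion fun m => ((isCompact_closedBall _ _).image hf).measurableSet

/-- Exhaustion argument. -/
theorem exhaust (n d : ℕ) (μ : Measure (EuclideanSpace ℝ (Fin d))) [IsFiniteMeasure μ]
    (h : ∀ F : Set (EuclideanSpace ℝ (Fin d)), MeasurableSet F → μ F ≠ 0 →
      ∃ (f : EuclideanSpace ℝ (Fin n) → EuclideanSpace ℝ (Fin d)) (K : ℝ≥0), LipschitzWith K f ∧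
      0 < μ (F ∩ range f)) :
    ∃ f : ℕ → EuclideanSpace ℝ (Fin n) → EuclideanSpace ℝ (Fin d),
      (∀ i, ∃ K : NNReal, LipschitzWith K (f i)) ∧
      μ (Set.univ \ ⋃ i, Set.range (f i)) = 0 := by
  let 𝒮 := {f : ℕ → EuclideanSpace ℝ (Fin n) → EuclideanSpace ℝ (Fin d) //
    ∀ i, ∃ K : NNReal, LipschitzWith K (f i)}
  let v : 𝒮 → ℝ≥0∞ := fun f => μ (⋃ i, range (f.1 i))
  let s : ℝ≥0∞ := ⨆ f, v f
  have hne : Nonempty 𝒮 := ⟨⟨fun _ _ => 0, fun _ => ⟨0, LipschitzWith.const 0⟩⟩⟩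
  have hst : s ≠ ⊤ := ne_top_of_le_ne_top (measure_ne_top μ univ)
    (iSup_le fun f => measure_mono (subset_univ _))
  obtain ⟨u, hu⟩ : ∃ u : ℕ → 𝒮, ∀ m : ℕ, s ≤ v (u m) + ENNReal.ofReal (1 / ((m : ℝ) + 1)) := by
    have : ∀ m : ℕ, ∃ f : 𝒮, s ≤ v f + ENNReal.ofReal (1 / ((m : ℝ) + 1)) := by
      intro m
      by_contra hcon
      push Not at hcon
      have hpos : (0 : ℝ≥0∞) < ENNReal.ofReal (1 / ((m : ℝ) + 1)) :=
        ENNReal.ofReal_pos.2 (by positivity)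
      have h1 : s ≤ s - ENNReal.ofReal (1 / ((m : ℝ) + 1)) := iSup_le fun f =>
        ENNReal.le_sub_of_add_le_right ENNReal.ofReal_ne_top (hcon f).le
      have h0 : s ≠ 0 := by
        intro h0
        have := hcon hne.some
        rw [h0] at this
        exact not_lt_zero this
      exact absurd h1 (not_le.2 (ENNReal.sub_lt_self hst h0 hpos.ne'))
    choose u hu using this
    exact ⟨u, hu⟩
  let w : 𝒮 := ⟨fun i => (u i.unpair.1).1 i.unpair.2, fun i => (u i.unpair.1).2 i.unpair.2⟩
  have hw : s ≤ v w := by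
    have h1 : ∀ m : ℕ, s ≤ v w + ENNReal.ofReal (1 / ((m : ℝ) + 1)) := by
      intro m
      refine (hu m).trans (add_le_add (measure_mono ?_) le_rfl)
      refine iUnion_subset fun j => ?_
      refine subset_iUnion_of_subset (Nat.pair m j) ?_
      simp [w]
    have ht : Tendsto (fun m : ℕ => v w + ENNReal.ofReal (1 / ((m : ℝ) + 1))) atTop
        (nhds (v w + ENNReal.ofReal 0)) :=
      tendsto_const_nhds.add (ENNReal.tendsto_ofReal tendsto_one_div_add_atTop_nhds_zero_nat)
    simp only [ENNReal.ofReal_zero, add_zero] at ht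
    exact ge_of_tendsto' ht h1
  refine ⟨w.1, w.2, ?_⟩
  by_contra hcon
  have hUm : MeasurableSet (⋃ i, range (w.1 i)) := MeasurableSet.iUnion fun i => by
    obtain ⟨K, hK⟩ := w.2 i
    exact range_meas _ hK.continuous
  obtain ⟨f, K, hf, hpos⟩ := h _ (MeasurableSet.univ.diff hUm) hcon
  let w' : 𝒮 := ⟨fun i => Nat.casesOn i f w.1, fun i => by
    cases i with
    | zero => exact ⟨K, hf⟩
    | succ j => exact w.2 j⟩
  have h1 : v w + μ ((univ \ ⋃ i, range (w.1 i)) ∩ range f) ≤ v w' := by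
    have hd : Disjoint (⋃ i, range (w.1 i)) ((univ \ ⋃ i, range (w.1 i)) ∩ range f) := by
      rw [Set.disjoint_left]
      intro x hx hx'
      exact hx'.1.2 hx
    have hm2 : MeasurableSet ((univ \ ⋃ i, range (w.1 i)) ∩ range f) :=
      (MeasurableSet.univ.diff hUm).inter (range_meas f hf.continuous)
    change μ _ + _ ≤ μ _
    rw [← measure_union hd hm2]
    apply measure_mono
    apply union_subset
    · exact iUnion_subset fun i => subset_iUnion_of_subset (i + 1) subset_rfl
    · exact subset_iUnion_of_subset 0 inter_subset_right
  have h2 : v w' ≤ v w := (le_iSup v w').trans hw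
  have h3 : v w < v w + μ ((univ \ ⋃ i, range (w.1 i)) ∩ range f) :=
    ENNReal.lt_add_right (measure_ne_top _ _) hpos.ne'
  exact absurd (h1.trans h2) (not_le.2 h3)

open MeasureTheory Metric Set Filter
open scoped ENNReal NNReal

theorem abs_cont (n d : ℕ) (μ : Measure (EuclideanSpace ℝ (Fin d))) [IsFiniteMeasure μ]
    (hdens : ∀ᵐ x ∂μ, upperDensity n d μ x < ⊤) :
    μ ≪ μH[(n : ℝ)] := by
  rcases Nat.eq_zero_or_pos n with hn | hn
  · subst hn
    refine Measure.AbsolutelyContinuous.mk fun s _ hs => ?_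
    rcases s.eq_empty_or_nonempty with he | ⟨x, hx⟩
    · rw [he]; simp
    exfalso
    have h1 := measure_mono_null (singleton_subset_iff.2 hx) hs
    rw [Nat.cast_zero, Measure.hausdorffMeasure_zero_singleton] at h1
    exact one_ne_zero h1
  refine Measure.AbsolutelyContinuous.mk fun s _ hs => ?_
  have hU : ∀ C0 : ℕ, μ (s ∩ Us n d μ (C0 + 1)) = 0 := by
    intro C0
    set C := C0 + 1 with hCd
    have hC : 0 < C := by omega
    set c : ℝ := C * 4 ^ n with hc
    have hC' : (0 : ℝ) < C := by exact_mod_cast hC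
    have hcp : 0 < c := by positivity
    have hc0 : ENNReal.ofReal c ≠ 0 := by simpa using hcp
    have hle : (ENNReal.ofReal c)⁻¹ • μ.restrict (Us n d μ C) ≤ μH[(n : ℝ)] := by
      apply Measure.le_hausdorffMeasure _ _ (ENNReal.ofReal (Sc C)) (by simpa using Sc_pos C)
      intro t ht
      rw [Measure.smul_apply, Measure.restrict_apply' (Us_meas n d μ C), smul_eq_mul]
      rcases (t ∩ Us n d μ C).eq_empty_or_nonempty with he | ⟨z, hz⟩
      · rw [he]; simp
      have hDt : ediam t ≠ ⊤ := ne_top_of_le_ne_top ENNReal.ofReal_ne_top ht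
      set D := (ediam t).toReal with hD
      have hD0 : 0 ≤ D := ENNReal.toReal_nonneg
      have hDC : D ≤ Sc C := ENNReal.toReal_le_of_le_ofReal (Sc_pos C).le ht
      have hdist : ∀ y ∈ t, dist y z ≤ D := by
        intro y hy
        rw [dist_edist]
        exact ENNReal.toReal_mono hDt (edist_le_ediam_of_mem hy hz.1)
      have hb : ∀ ρ, D < ρ → μ (t ∩ Us n d μ C) ≤ ENNReal.ofReal (c * ρ ^ n) := by
        intro ρ hρ
        have h1 := upreg n d μ (Us n d μ C) C (fun x hx => hx) z hz.2 z ρ (hD0.trans_lt hρ)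
        have h2 : μ (t ∩ Us n d μ C) ≤
            (μ.restrict (Us n d μ C ∩ closedBall z (Sc C))) (closedBall z ρ) := by
          rw [Measure.restrict_apply measurableSet_closedBall]
          apply measure_mono
          rintro y ⟨hy, hy2⟩
          have := hdist y hy
          exact ⟨mem_closedBall.2 (this.trans hρ.le), hy2, mem_closedBall.2 (this.trans hDC)⟩
        refine h2.trans ?_
        exact (ENNReal.le_ofReal_iff_toReal_le (measure_ne_top _ _) (by
          have := hD0.trans_lt hρ
          positivity)).2 h1
      have hb2 : μ (t ∩ Us n d μ C) ≤ ENNReal.ofReal (c * D ^ n) := by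
        have hcont : Continuous fun ρ : ℝ => ENNReal.ofReal (c * ρ ^ n) :=
          ENNReal.continuous_ofReal.comp (by fun_prop)
        have hT : Tendsto (fun ρ : ℝ => ENNReal.ofReal (c * ρ ^ n)) (nhdsWithin D (Ioi D))
          (nhds (ENNReal.ofReal (c * D ^ n))) := hcont.continuousAt.mono_left nhdsWithin_le_nhds
        refine ge_of_tendsto hT ?_
        filter_upwards [self_mem_nhdsWithin] with ρ hρ using hb ρ hρ
      calc _ ≤ (ENNReal.ofReal c)⁻¹ * ENNReal.ofReal (c * D ^ n) := mul_le_mul_right hb2 _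
        _ = ENNReal.ofReal (D ^ n) := by
          rw [ENNReal.ofReal_mul hcp.le, ← mul_assoc, ENNReal.inv_mul_cancel hc0
            ENNReal.ofReal_ne_top, one_mul]
        _ = ediam t ^ (n : ℝ) := by
          rw [ENNReal.ofReal_pow hD0, hD, ENNReal.ofReal_toReal hDt, ENNReal.rpow_natCast]
    have h1 := hle s
    rw [hs, Measure.smul_apply, Measure.restrict_apply' (Us_meas n d μ C), smul_eq_mul] at h1
    have h2 := le_zero_iff.1 h1
    rcases mul_eq_zero.1 h2 with h | h
    · simp at h
    · exact h
  have h0 := measure_iUnion_null hU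
  rw [measure_eq_zero_iff_ae_notMem] at h0 ⊢
  filter_upwards [h0, hdens] with x hx hd hxs
  obtain ⟨C, hC⟩ := mem_Us n d μ x hd
  exact hx (mem_iUnion.2 ⟨C, hxs, Us_mono n d μ (Nat.le_succ C) hC⟩)

theorem zero_case (d : ℕ) (μ : Measure (EuclideanSpace ℝ (Fin d))) [IsFiniteMeasure μ]
    (hdens : ∀ᵐ x ∂μ, 0 < upperDensity 0 d μ x)
    (F : Set (EuclideanSpace ℝ (Fin d))) (hFp : μ F ≠ 0) :
    ∃ (f : EuclideanSpace ℝ (Fin 0) → EuclideanSpace ℝ (Fin d)) (K : ℝ≥0), LipschitzWith K f ∧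
      0 < μ (F ∩ range f) := by
  obtain ⟨x, hxF, hx⟩ : ∃ x ∈ F, 0 < upperDensity 0 d μ x := by
    by_contra hcon
    push Not at hcon
    apply hFp
    rw [measure_eq_zero_iff_ae_notMem]
    filter_upwards [hdens] with x hx hxF
    exact absurd hx (not_lt.2 (hcon x hxF))
  refine ⟨fun _ => x, 0, LipschitzWith.const x, ?_⟩
  have hr : range (fun _ : EuclideanSpace ℝ (Fin 0) => x) = {x} := range_const
  rw [hr, inter_eq_right.2 (singleton_subset_iff.2 hxF)]
  obtain ⟨C, hC, hL⟩ := mem_Ls 0 d μ x hx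
  have hI : ({x} : Set (EuclideanSpace ℝ (Fin d))) = ⋂ k : ℕ, closedBall x (Sc k) := by
    ext y
    simp only [mem_singleton_iff, mem_iInter, mem_closedBall]
    constructor
    · rintro rfl k; simpa using (Sc_pos k).le
    · intro h
      have := ge_of_tendsto' (Sc_tendsto.mono_right nhdsWithin_le_nhds) h
      exact dist_le_zero.1 this
  have hanti : Antitone fun k : ℕ => closedBall x (Sc k) := fun a b hab =>
    closedBall_subset_closedBall (Sc_anti hab)
  have ht := tendsto_measure_iInter_atTop (μ := μ) (s := fun k : ℕ => closedBall x (Sc k))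
    (fun m => measurableSet_closedBall.nullMeasurableSet) hanti ⟨0, measure_ne_top _ _⟩
  rw [← hI] at ht
  have hCp : 0 < ENNReal.ofReal ((C : ℝ)⁻¹) := by
    have : (0 : ℝ) < C := by exact_mod_cast hC
    exact ENNReal.ofReal_pos.2 (by positivity)
  refine hCp.trans_le (ge_of_tendsto' ht fun N => ?_)
  obtain ⟨k, hk, h⟩ := hL N
  simp only [pow_zero, mul_one] at h
  exact h.trans (measure_mono (hanti hk))

theorem stmt9 (p : ℝ) (hp : 0 ≤ p) (n d : ℕ)
    (μ : Measure (EuclideanSpace ℝ (Fin d))) [IsFiniteMeasure μ]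
    (hdens : ∀ᵐ x ∂μ, 0 < upperDensity n d μ x ∧ upperDensity n d μ x < ⊤)
    (hjones : ∀ᵐ x ∂μ,
      (∫⁻ r in Set.Ioo (0 : ℝ) 1,
        beta2sq n d μ x r * densityN n d μ x r ^ p / ENNReal.ofReal r) < ⊤) :
    ∃ f : ℕ → EuclideanSpace ℝ (Fin n) → EuclideanSpace ℝ (Fin d),
      (∀ i, ∃ K : NNReal, LipschitzWith K (f i)) ∧
      μ (Set.univ \ ⋃ i, Set.range (f i)) = 0 ∧
      μ ≪ μH[(n : ℝ)] := by
  have hex : ∀ F : Set (EuclideanSpace ℝ (Fin d)), MeasurableSet F → μ F ≠ 0 →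
      ∃ (f : EuclideanSpace ℝ (Fin n) → EuclideanSpace ℝ (Fin d)) (K : ℝ≥0), LipschitzWith K f ∧
      0 < μ (F ∩ range f) := by
    intro F hF hFp
    rcases Nat.eq_zero_or_pos n with hn | hn
    · subst hn
      exact zero_case d μ (hdens.mono fun _ h => h.1) F hFp
    · exact select p hp n hn d μ hdens hjones F hF hFp
  obtain ⟨f, h1, h2⟩ := exhaust n d μ hex
  exact ⟨f, h1, h2, abs_cont n d μ (hdens.mono fun _ h => h.2)⟩
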